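/- Assume h̃(d) < h**(d) and let ε > 0 with 6ε < h**(d) − h̃(d). Then there exist an integer ℓ₀ ≥ 1000 depending only on d, positive constants C₃, C₄, c₅ and an integer L₀ ≥ 1, depending only on ε and d, such that, with the scales L_n := ℓ₀^n L₀ and the fields χ^t, ψ^t defined accordingly, for every h ∈ (h̃(d)+2ε, h**(d)−2ε), every r, R with C₃ ≤ r ≤ R/2, and every t ≥ 1, R ≥ 1 with q_R(t,h) ≥ c₆, the following holds: Σ_{x∈Z^d} E[f(ψ^t_x)·1_{Piv_x} | χ^t_x = h] ≤ E[f(ψ^t_0) | χ^t_0 = h] · ( e^{C₄ t^{18}} · Σ_{x∈Z^d} P[Piv_x | χ^t_x = h] + exp(C₄ t³ − r^{c₅} e^{−C₄ t³}) ), for every nonnegative measurable f : R → [0,∞) with E[f(ψ^t_0) | χ^t_0 = h] < ∞. -/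

import Mathlib

open MeasureTheory ProbabilityTheory Filter Set

namespace GFFperc

noncomputable section

/-- The lattice `ℤ^d`. -/
abbrev V (d : ℕ) := Fin d → ℤ

/-- Nearest-neighbour adjacency on `ℤ^d`. -/
def adj {d : ℕ} (x y : V d) : Prop := (∑ i, (x i - y i).natAbs) = 1

/-- `ℓ∞` distance between two points. -/
def dinf {d : ℕ} (x y : V d) : ℕ := Finset.univ.sup fun i => (x i - y i).natAbs

/-- `A` and `B` are joined by a nearest-neighbour path contained in `S`. -/
def ConnIn {d : ℕ} (S A B : Set (V d)) : Prop :=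
  ∃ (n : ℕ) (γ : ℕ → V d), γ 0 ∈ A ∧ γ n ∈ B ∧ (∀ k, k ≤ n → γ k ∈ S) ∧
    ∀ k, k < n → adj (γ k) (γ (k + 1))

/-- A set is connected: any two of its points are joined inside it. -/
def IsConnSet {d : ℕ} (S : Set (V d)) : Prop := ∀ x ∈ S, ∀ y ∈ S, ConnIn S {x} {y}

/-- The connected component of `x` in `S`. -/
def comp {d : ℕ} (S : Set (V d)) (x : V d) : Set (V d) := {y | ConnIn S {x} {y}}

/-- Box of (real) radius `r` centered at `x`. -/
def boxAt {d : ℕ} (x : V d) (r : ℝ) : Set (V d) := {y | ∀ i, |(y i : ℝ) - (x i : ℝ)| ≤ r}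

def box (d : ℕ) (r : ℝ) : Set (V d) := boxAt (0 : V d) r

/-- Inner vertex boundary of the box of radius `r` centered at `x`. -/
def bdryAt {d : ℕ} (x : V d) (r : ℝ) : Set (V d) :=
  {y | y ∈ boxAt x r ∧ ∃ z, z ∉ boxAt x r ∧ adj y z}

def bdry (d : ℕ) (r : ℝ) : Set (V d) := bdryAt (0 : V d) r

/-- `A` is connected to infinity within `S`. -/
def ConnToInf {d : ℕ} (S A : Set (V d)) : Prop := ∀ R : ℕ, 1 ≤ R → ConnIn S A (bdry d R)

/-- The `ℓ∞`-diameter of `S` is at least `r`. -/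
def diamGE {d : ℕ} (S : Set (V d)) (r : ℝ) : Prop := ∃ x ∈ S, ∃ y ∈ S, r ≤ (dinf x y : ℝ)

def unitV (d : ℕ) (i : Fin d) : V d := fun j => if j = i then 1 else 0

/-- `k`-step transition probabilities of simple random walk on `ℤ^d`. -/
def srwP (d : ℕ) : ℕ → V d → V d → ℝ
  | 0, x, y => if x = y then 1 else 0
  | (k + 1), x, y =>
      (1 / (2 * d)) * ∑ i : Fin d, (srwP d k (x + unitV d i) y + srwP d k (x - unitV d i) y)

/-- Green function of simple random walk on `ℤ^d`. -/
def green (d : ℕ) (x y : V d) : ℝ := ∑' k : ℕ, srwP d k x y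

/-- `ℓ`-step transition kernel of the lazy simple random walk on `ℤ^d`. -/
def lazyP (d : ℕ) : ℕ → V d → V d → ℝ
  | 0, x, y => if x = y then 1 else 0
  | (k + 1), x, y =>
      (1 / 2) * lazyP d k x y +
        (1 / (4 * d)) * ∑ i : Fin d, (lazyP d k (x + unitV d i) y + lazyP d k (x - unitV d i) y)

/-- `φ` is a centered Gaussian field with covariance function `C`: every finite linear
combination is a centered Gaussian variable with the corresponding variance. -/
def IsCGF {Ω : Type*} [MeasurableSpace Ω] {d : ℕ} (P : Measure Ω)
    (φ : V d → Ω → ℝ) (C : V d → V d → ℝ) : Prop :=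
  (∀ x, Measurable (φ x)) ∧
    ∀ (s : Finset (V d)) (a : V d → ℝ),
      Measure.map (fun ω => ∑ x ∈ s, a x * φ x ω) P =
        gaussianReal 0 (Real.toNNReal (∑ x ∈ s, ∑ y ∈ s, a x * a y * C x y))

/-- `φ` is a Gaussian free field on `ℤ^d`. -/
def IsGFF {Ω : Type*} [MeasurableSpace Ω] {d : ℕ} (P : Measure Ω) (φ : V d → Ω → ℝ) : Prop :=
  IsCGF P φ (green d)

/-- The level set `{φ ≥ h}`. -/
def lvl {d : ℕ} {Ω : Type*} (φ : V d → Ω → ℝ) (h : ℝ) (ω : Ω) : Set (V d) := {x | h ≤ φ x ω}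

/-- The whole field, as one random variable with values in `V d → ℝ`. -/
def proc {Ω : Type*} {d : ℕ} (φ : V d → Ω → ℝ) : Ω → V d → ℝ := fun ω x => φ x ω

/-- The critical parameter `h_*`. -/
def hStar (d : ℕ) {Ω : Type*} [MeasurableSpace Ω] (P : Measure Ω) (φ : V d → Ω → ℝ) : ℝ :=
  sInf {h : ℝ | P {ω | ConnToInf (lvl φ h ω) {(0 : V d)}} = 0}

/-- The critical parameter `h_{**}`. -/
def hStarStar (d : ℕ) {Ω : Type*} [MeasurableSpace Ω] (P : Measure Ω) (φ : V d → Ω → ℝ) : ℝ :=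
  sInf {h : ℝ |
    (⨅ R : ℕ, P {ω | ConnIn (lvl φ h ω) (box d ((R : ℝ) + 1)) (bdry d (2 * ((R : ℝ) + 1)))}) = 0}

/-- `u(R) = exp((log R)^{1/3})`. -/
def ufn (R : ℝ) : ℝ := Real.exp (Real.log R ^ ((1 : ℝ) / 3))

def tildeSet (d : ℕ) {Ω : Type*} [MeasurableSpace Ω] (P : Measure Ω) (φ : V d → Ω → ℝ) :
    Set ℝ :=
  {h : ℝ |
    (⨅ R : ℕ, ENNReal.ofReal (((R : ℝ) + 1) ^ d) *
        P {ω | ¬ ConnIn (lvl φ h ω) (box d (ufn ((R : ℝ) + 1))) (bdry d ((R : ℝ) + 1))}) = 0}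

/-- The critical parameter `h̃`. -/
def hTilde (d : ℕ) {Ω : Type*} [MeasurableSpace Ω] (P : Measure Ω) (φ : V d → Ω → ℝ) : ℝ :=
  sSup (tildeSet d P φ)

/-- The event `Exist(R,α)`. -/
def ExistEv (d : ℕ) {Ω : Type*} (φ : V d → Ω → ℝ) (R : ℕ) (α : ℝ) : Set Ω :=
  {ω | ∃ x ∈ lvl φ α ω ∩ box d (R : ℝ),
    diamGE (comp (lvl φ α ω ∩ box d (R : ℝ)) x) ((R : ℝ) / 5)}

/-- The event `Unique(R,α)`. -/
def UniqueEv (d : ℕ) {Ω : Type*} (φ : V d → Ω → ℝ) (R : ℕ) (α : ℝ) : Set Ω :=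
  {ω | ∀ x ∈ lvl φ α ω ∩ box d (R : ℝ), ∀ y ∈ lvl φ α ω ∩ box d (R : ℝ),
    diamGE (comp (lvl φ α ω ∩ box d (R : ℝ)) x) ((R : ℝ) / 10) →
    diamGE (comp (lvl φ α ω ∩ box d (R : ℝ)) y) ((R : ℝ) / 10) →
    ConnIn (lvl φ α ω ∩ box d (2 * (R : ℝ))) {x} {y}}

/-- `φ` strongly percolates up to level `h`. -/
def StronglyPerc (d : ℕ) {Ω : Type*} [MeasurableSpace Ω] (P : Measure Ω)
    (φ : V d → Ω → ℝ) (h : ℝ) : Prop :=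
  ∃ c : ℝ, 0 < c ∧ ∃ ρ : ℝ, ρ ∈ Set.Ioc (0 : ℝ) 1 ∧
    ∀ α : ℝ, α ≤ h → ∀ R : ℕ, 1 ≤ R →
      ENNReal.ofReal (1 - Real.exp (-c * (R : ℝ) ^ ρ)) ≤ P (ExistEv d φ R α) ∧
      ENNReal.ofReal (1 - Real.exp (-c * (R : ℝ) ^ ρ)) ≤ P (UniqueEv d φ R α)

/-- The critical parameter `h̄`. -/
def hBar (d : ℕ) {Ω : Type*} [MeasurableSpace Ω] (P : Measure Ω) (φ : V d → Ω → ℝ) : ℝ :=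
  sSup {h : ℝ | StronglyPerc d P φ h}


/-- The scales `L_n = ℓ₀^n L₀`. -/
def Lsc (ℓ₀ L₀ n : ℕ) : ℕ := ℓ₀ ^ n * L₀

/-- Configuration space for the family `(ξ^ℓ_y)`. -/
abbrev Cfg (d : ℕ) := ℕ × V d → ℝ

/-- The family `(ξ^ℓ_y)` as one random configuration. -/
def cfg {Ω : Type*} {d : ℕ} (ξ : ℕ → V d → Ω → ℝ) (ω : Ω) : Cfg d := fun p => ξ p.1 p.2 ω

/-- `(ξ^ℓ)_{ℓ ≥ 0}` is a family of independent centered Gaussian fields with covariances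
`E[ξ^ℓ_x ξ^ℓ_y] = (1/2) q_ℓ(x,y)`. -/
def IsXiFamily {Ω : Type*} [MeasurableSpace Ω] (d : ℕ) (P : Measure Ω)
    (ξ : ℕ → V d → Ω → ℝ) : Prop :=
  (∀ ℓ : ℕ, IsCGF P (ξ ℓ) fun x y => (1 / 2) * lazyP d ℓ x y) ∧
    iIndep (fun ℓ : ℕ => MeasurableSpace.comap (proc (ξ ℓ)) inferInstance) P

/-- The Gaussian free field `φ = Σ_ℓ ξ^ℓ`. -/
def phiOf {Ω : Type*} {d : ℕ} (ξ : ℕ → V d → Ω → ℝ) : V d → Ω → ℝ :=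
  fun x ω => ∑' ℓ : ℕ, ξ ℓ x ω

/-- The interpolated field `χ^t`, as a function of the configuration `c = (ξ^ℓ_y)`:
`χ^t = φ^{L_{⌊t⌋}} + (t - ⌊t⌋) ψ^t`. -/
def chiFun (d ℓ₀ L₀ : ℕ) (t : ℝ) (c : Cfg d) (x : V d) : ℝ :=
  (∑ ℓ ∈ Finset.range (Lsc ℓ₀ L₀ ⌊t⌋₊ + 1), c (ℓ, x)) +
    (t - ⌊t⌋₊) * ∑ ℓ ∈ Finset.Ioc (Lsc ℓ₀ L₀ ⌊t⌋₊) (Lsc ℓ₀ L₀ ⌈t⌉₊), c (ℓ, x)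

/-- The field `ψ^t = φ^{L_{⌈t⌉}} - φ^{L_{⌊t⌋}}`, as a function of the configuration. -/
def psiFun (d ℓ₀ L₀ : ℕ) (t : ℝ) (c : Cfg d) (x : V d) : ℝ :=
  ∑ ℓ ∈ Finset.Ioc (Lsc ℓ₀ L₀ ⌊t⌋₊) (Lsc ℓ₀ L₀ ⌈t⌉₊), c (ℓ, x)

/-- The covariance `Cov(ξ^ℓ_y, χ^t_x)`. -/
def covXiChi (d ℓ₀ L₀ : ℕ) (t : ℝ) (ℓ : ℕ) (y x : V d) : ℝ :=
  if ℓ ≤ Lsc ℓ₀ L₀ ⌊t⌋₊ then (1 / 2) * lazyP d ℓ y x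
  else if ℓ ≤ Lsc ℓ₀ L₀ ⌈t⌉₊ then (t - ⌊t⌋₊) * ((1 / 2) * lazyP d ℓ y x)
  else 0

/-- The variance `Var(χ^t_x)`. -/
def varChi (d ℓ₀ L₀ : ℕ) (t : ℝ) (x : V d) : ℝ :=
  (∑ ℓ ∈ Finset.range (Lsc ℓ₀ L₀ ⌊t⌋₊ + 1), (1 / 2) * lazyP d ℓ x x) +
    (t - ⌊t⌋₊) ^ 2 *
      ∑ ℓ ∈ Finset.Ioc (Lsc ℓ₀ L₀ ⌊t⌋₊) (Lsc ℓ₀ L₀ ⌈t⌉₊), (1 / 2) * lazyP d ℓ x x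

/-- The shifted configuration realising the regular conditional law given `χ^t_x = h`. -/
def shiftCfg (d ℓ₀ L₀ : ℕ) (t : ℝ) (x : V d) (h : ℝ) (c : Cfg d) : Cfg d :=
  fun p => c p -
    covXiChi d ℓ₀ L₀ t p.1 p.2 x / varChi d ℓ₀ L₀ t x * (chiFun d ℓ₀ L₀ t c x - h)

/-- The pivotality event `Piv_x` (as a set of configurations): `B_r` is joined to `∂B_R`
in `{χ^t ≥ h} ∪ {x}` but not in `{χ^t ≥ h} ∖ {x}`. -/
def PivSet (d ℓ₀ L₀ : ℕ) (t h : ℝ) (r R : ℕ) (x : V d) : Set (Cfg d) :=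
  {c | ConnIn ({y | h ≤ chiFun d ℓ₀ L₀ t c y} ∪ {x}) (box d (r : ℝ)) (bdry d (R : ℝ)) ∧
    ¬ ConnIn ({y | h ≤ chiFun d ℓ₀ L₀ t c y} \ {x}) (box d (r : ℝ)) (bdry d (R : ℝ))}

/-- The constant `c₆` of (5.9). -/
def cSix {Ω : Type*} [MeasurableSpace Ω] (d : ℕ) (P : Measure Ω)
    (ξ : ℕ → V d → Ω → ℝ) (ε : ℝ) : ℝ :=
  (1 / 2) * sInf {v : ℝ | ∃ n : ℕ, 1 ≤ n ∧ ∃ h' : ℝ,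
    hTilde d P (phiOf ξ) + ε < h' ∧ h' < hStarStar d P (phiOf ξ) - ε ∧
    (v = (n : ℝ) ^ d *
        (P {ω | ¬ ConnIn (lvl (phiOf ξ) h' ω) (box d (ufn (n : ℝ)))
          (bdry d (n : ℝ))}).toReal ∨
      v = (P {ω | ConnIn (lvl (phiOf ξ) h' ω) (box d (((n + 1) / 2 : ℕ) : ℝ))
        (bdry d (n : ℝ))}).toReal)}

set_option linter.all false

section
lemma lazyP_zero (d : ℕ) (x y : V d) : lazyP d 0 x y = if x = y then 1 else 0 := rfl

lemma lazyP_succ (d k : ℕ) (x y : V d) : lazyP d (k+1) x y = (1 / 2) * lazyP d k x y +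
        (1 / (4 * d)) * ∑ i : Fin d, (lazyP d k (x + unitV d i) y + lazyP d k (x - unitV d i) y) := rfl

lemma lazyP_nonneg (d k : ℕ) (x y : V d) : 0 ≤ lazyP d k x y := by
  induction k generalizing x with
  | zero => rw [lazyP_zero]; split_ifs <;> norm_num
  | succ k ih =>
    rw [lazyP_succ]
    have : 0 ≤ ∑ i : Fin d, (lazyP d k (x + unitV d i) y + lazyP d k (x - unitV d i) y) :=
      Finset.sum_nonneg fun i _ => add_nonneg (ih _) (ih _)
    have := ih x
    positivity

lemma lazyP_le_one (d k : ℕ) (x y : V d) : lazyP d k x y ≤ 1 := by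
  induction k generalizing x with
  | zero => rw [lazyP_zero]; split_ifs <;> norm_num
  | succ k ih =>
    rw [lazyP_succ]
    have h1 : ∑ i : Fin d, (lazyP d k (x + unitV d i) y + lazyP d k (x - unitV d i) y) ≤
        ∑ i : Fin d, (2 : ℝ) :=
      Finset.sum_le_sum fun i _ => by linarith [ih (x + unitV d i), ih (x - unitV d i)]
    simp only [Finset.sum_const, Finset.card_univ, Fintype.card_fin, nsmul_eq_mul] at h1
    have h2 := ih x
    rcases Nat.eq_zero_or_pos d with h0 | h0
    · subst h0; simp; linarith
    · have hd : (0:ℝ) < d := by exact_mod_cast h0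
      have : (1 / (4 * d) : ℝ) * ∑ i : Fin d, (lazyP d k (x + unitV d i) y + lazyP d k (x - unitV d i) y)
          ≤ (1 / (4 * d) : ℝ) * (d * 2) := by gcongr
      have h3 : (1 / (4 * d) : ℝ) * (d * 2) = 1/2 := by field_simp; norm_num
      linarith

/-- invariance under lattice automorphisms -/
lemma lazyP_equiv (d k : ℕ) (g : V d ≃+ V d)
    (hg : ∀ F : V d → ℝ, ∑ i, (F (g (unitV d i)) + F (- g (unitV d i))) =
      ∑ i, (F (unitV d i) + F (- unitV d i))) (x y : V d) :
    lazyP d k (g x) (g y) = lazyP d k x y := by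
  induction k generalizing x with
  | zero => simp [lazyP_zero]
  | succ k ih =>
    rw [lazyP_succ, lazyP_succ, ih]
    congr 2
    have := hg (fun v => lazyP d k (g x + v) (g y))
    simp only [← sub_eq_add_neg] at this
    rw [← this]
    refine Finset.sum_congr rfl fun i _ => ?_
    rw [← ih, ← ih, map_add, map_sub]

lemma lazyP_add (d k : ℕ) (x y z : V d) : lazyP d k (x + z) (y + z) = lazyP d k x y := by
  induction k generalizing x with
  | zero => simp [lazyP_zero]
  | succ k ih =>
    rw [lazyP_succ, lazyP_succ, ih]
    congr 2
    refine Finset.sum_congr rfl fun i _ => ?_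
    rw [← ih, ← ih]
    congr 2 <;> abel

lemma lazyP_neg (d k : ℕ) (x y : V d) : lazyP d k (-x) (-y) = lazyP d k x y := by
  have := lazyP_equiv d k (AddEquiv.neg (V d)) (fun F => by
    refine Finset.sum_congr rfl fun i _ => ?_
    simp [add_comm]) x y
  simpa using this

lemma lazyP_symm (d k : ℕ) (x y : V d) : lazyP d k x y = lazyP d k y x := by
  have := lazyP_add d k x y (-(x+y))
  rw [← this, ← lazyP_neg]
  congr 1 <;> abel

lemma lazyP_succ' (d k : ℕ) (x y : V d) : lazyP d (k+1) x y = (1 / 2) * lazyP d k x y +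
        (1 / (4 * d)) * ∑ i : Fin d, (lazyP d k x (y + unitV d i) + lazyP d k x (y - unitV d i)) := by
  rw [lazyP_symm, lazyP_succ, lazyP_symm d k y x]
  simp only [lazyP_symm d k _ x]

lemma dinf_le_iff {d : ℕ} (x y : V d) (n : ℕ) : dinf x y ≤ n ↔ ∀ i, (x i - y i).natAbs ≤ n := by
  simp [dinf, Finset.sup_le_iff]

lemma dinf_comm {d : ℕ} (x y : V d) : dinf x y = dinf y x := by
  unfold dinf
  congr 1; ext i; rw [← Int.natAbs_neg]; congr 1; ring

lemma dinf_self {d : ℕ} (x : V d) : dinf x x = 0 := by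
  simp [dinf]

lemma dinf_eq_zero {d : ℕ} {x y : V d} (h : dinf x y = 0) : x = y := by
  have := (dinf_le_iff x y 0).1 h.le
  ext i; have := this i; omega

lemma natAbs_le_dinf {d : ℕ} (x y : V d) (i : Fin d) : (x i - y i).natAbs ≤ dinf x y :=
  (dinf_le_iff x y _).1 le_rfl i

lemma dinf_tri {d : ℕ} (x y z : V d) : dinf x z ≤ dinf x y + dinf y z := by
  rw [dinf_le_iff]; intro i
  have := natAbs_le_dinf x y i
  have := natAbs_le_dinf y z i
  omega

lemma dinf_add {d : ℕ} (x y z : V d) : dinf (x + z) (y + z) = dinf x y := by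
  simp [dinf]

lemma unitV_le {d : ℕ} (i j : Fin d) : (unitV d i j).natAbs ≤ 1 := by
  unfold unitV; split_ifs <;> simp

lemma dinf_unit_add {d : ℕ} (x : V d) (i : Fin d) : dinf x (x + unitV d i) ≤ 1 := by
  rw [dinf_le_iff]; intro j; have := unitV_le i j; simp; omega

lemma dinf_unit_sub {d : ℕ} (x : V d) (i : Fin d) : dinf x (x - unitV d i) ≤ 1 := by
  rw [dinf_le_iff]; intro j; have := unitV_le i j; simp; omega

lemma lazyP_range (d k : ℕ) (x y : V d) (h : k < dinf x y) : lazyP d k x y = 0 := by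
  induction k generalizing x with
  | zero =>
    rw [lazyP_zero, if_neg]; rintro rfl; simp [dinf_self] at h
  | succ k ih =>
    rw [lazyP_succ, ih x (by omega), Finset.sum_eq_zero]
    · simp
    · intro i _
      have h1 := dinf_unit_add x i
      have h2 := dinf_unit_sub x i
      have h3 := dinf_tri x (x + unitV d i) y
      have h4 := dinf_tri x (x - unitV d i) y
      rw [ih _ (by omega), ih _ (by omega), add_zero]

lemma adj_dinf {d : ℕ} {x y : V d} (h : adj x y) : dinf x y ≤ 1 := by
  rw [dinf_le_iff]; intro i
  unfold adj at h
  rw [← h]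
  exact Finset.single_le_sum (f := fun i => (x i - y i).natAbs) (fun _ _ => Nat.zero_le _) (Finset.mem_univ i)

lemma adj_comm {d : ℕ} {x y : V d} (h : adj x y) : adj y x := by
  unfold adj at *
  rw [← h]
  refine Finset.sum_congr rfl fun i _ => ?_
  omega

lemma adj_unit {d : ℕ} (x : V d) (i : Fin d) : adj x (x + unitV d i) := by
  unfold adj
  rw [Finset.sum_eq_single i]
  · simp [unitV]
  · intro j _ hj; simp [unitV, hj]
  · simp

lemma adj_unit_sub {d : ℕ} (x : V d) (i : Fin d) : adj x (x - unitV d i) := by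
  unfold adj
  rw [Finset.sum_eq_single i]
  · simp [unitV]
  · intro j _ hj; simp [unitV, hj]
  · simp

lemma adj_add {d : ℕ} {x y : V d} (z : V d) (h : adj x y) : adj (x + z) (y + z) := by
  unfold adj at *; simpa using h

/-- finite sup-norm balls -/
def fbox (d : ℕ) (x : V d) (n : ℕ) : Finset (V d) :=
  Fintype.piFinset fun i => Finset.Icc (x i - n) (x i + n)

lemma mem_fbox {d : ℕ} {x y : V d} {n : ℕ} : y ∈ fbox d x n ↔ dinf x y ≤ n := by
  simp only [fbox, Fintype.mem_piFinset, Finset.mem_Icc, dinf_le_iff]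
  refine forall_congr' fun i => ?_
  omega

lemma card_fbox (d : ℕ) (x : V d) (n : ℕ) : (fbox d x n).card = (2*n+1)^d := by
  simp only [fbox, Fintype.card_piFinset, Int.card_Icc]
  rw [Finset.prod_congr rfl (g := fun _ => 2*n+1)]
  · simp
  · intro i _; omega

lemma mem_boxAt {d : ℕ} {x y : V d} {n : ℕ} : y ∈ boxAt x (n:ℝ) ↔ dinf x y ≤ n := by
  simp only [boxAt, mem_ofPred_eq, dinf_le_iff]
  refine forall_congr' fun i => ?_
  rw [← Int.cast_sub, ← Int.cast_abs]
  rw [show (n:ℝ) = ((n:ℤ):ℝ) by simp, Int.cast_le, Int.abs_eq_natAbs]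
  omega

lemma mem_boxAt_floor {d : ℕ} {x y : V d} {r : ℝ} (hr : 0 ≤ r) : y ∈ boxAt x r ↔ dinf x y ≤ ⌊r⌋₊ := by
  simp only [boxAt, mem_ofPred_eq, dinf_le_iff]
  refine forall_congr' fun i => ?_
  rw [← Int.cast_sub, ← Int.cast_abs, Nat.le_floor_iff hr]
  rw [Int.abs_eq_natAbs, show (y i - x i).natAbs = (x i - y i).natAbs by omega, Int.cast_natCast]

lemma mem_box {d : ℕ} {y : V d} {n : ℕ} : y ∈ box d (n:ℝ) ↔ dinf 0 y ≤ n := mem_boxAt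

lemma mem_bdryAt {d : ℕ} {x y : V d} {n : ℕ} (hd : 0 < d) : y ∈ bdryAt x (n:ℝ) ↔ dinf x y = n := by
  simp only [bdryAt, mem_ofPred_eq, mem_boxAt]
  constructor
  · rintro ⟨h1, z, h2, h3⟩
    have := adj_dinf h3
    have := dinf_tri x y z
    omega
  · intro h
    refine ⟨h.le, ?_⟩
    obtain ⟨i, hi⟩ : ∃ i, (x i - y i).natAbs = n := by
      have : Nonempty (Fin d) := ⟨⟨0, hd⟩⟩
      obtain ⟨i, _, hi⟩ := Finset.exists_mem_eq_sup (Finset.univ : Finset (Fin d)) Finset.univ_nonempty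
        (fun i => (x i - y i).natAbs)
      exact ⟨i, by rw [← h]; exact hi.symm⟩
    by_cases hs : x i ≤ y i
    · refine ⟨y + unitV d i, ?_, adj_unit _ _⟩
      have := natAbs_le_dinf x (y + unitV d i) i
      simp [unitV] at this
      omega
    · refine ⟨y - unitV d i, ?_, adj_unit_sub _ _⟩
      have := natAbs_le_dinf x (y - unitV d i) i
      simp [unitV] at this
      omega

lemma mem_bdry {d : ℕ} {y : V d} {n : ℕ} (hd : 0 < d) : y ∈ bdry d (n:ℝ) ↔ dinf 0 y = n := mem_bdryAt hd
end

section
/-- centered Gaussian family -/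
structure GF {Ω ι : Type*} [MeasurableSpace Ω] (P : Measure Ω) (X : ι → Ω → ℝ) : Prop where
  meas : ∀ i, Measurable (X i)
  gp : IsGaussianProcess X P
  mean : ∀ i, ∫ ω, X i ω ∂P = 0

section gf
variable {Ω Ω' ι κ : Type*} [MeasurableSpace Ω] [MeasurableSpace Ω'] {P : Measure Ω} {P' : Measure Ω'}
  {X : ι → Ω → ℝ} {X' : ι → Ω' → ℝ}

lemma GF.memLp (h : GF P X) (i : ι) : MemLp (X i) 2 P := (h.gp.hasGaussianLaw_eval i).memLp_two

lemma GF.integrable (h : GF P X) (i : ι) : Integrable (X i) P := (h.gp.hasGaussianLaw_eval i).integrable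

lemma GF.map_eval (h : GF P X) (i : ι) : P.map (X i) = gaussianReal 0 (Var[X i; P]).toNNReal := by
  have := (h.gp.hasGaussianLaw_eval i).map_eq_gaussianReal
  rwa [h.mean i] at this

lemma GF.lin [IsProbabilityMeasure P] (h : GF P X) {Y : κ → Ω → ℝ} (I : κ → Finset ι) (c : κ → ι → ℝ)
    (hY : ∀ k ω, Y k ω = ∑ i ∈ I k, c k i * X i ω) : GF P Y where
  meas k := by
    have : Y k = fun ω => ∑ i ∈ I k, c k i * X i ω := funext (hY k)
    rw [this]
    exact Finset.measurable_sum _ fun i _ => (h.meas i).const_mul _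
  gp := have hgp := h.gp; hgp.of_isGaussianProcess fun k => ⟨I k,
    ∑ i : I k, c k i • ContinuousLinearMap.proj i, fun ω => by
      rw [hY, ← Finset.sum_coe_sort]
      simp ⟩
  mean k := by
    simp_rw [hY]
    rw [integral_finset_sum _ fun i _ => (h.integrable i).const_mul _]
    refine Finset.sum_eq_zero fun i _ => ?_
    rw [integral_const_mul, h.mean, mul_zero]

lemma GF.comp [IsProbabilityMeasure P] (h : GF P X) (f : κ → ι) : GF P (fun k => X (f k)) :=
  h.lin (fun k => {f k}) (fun _ _ => 1) (by simp)

lemma GF.cov_lin [IsProbabilityMeasure P] (h : GF P X) (I J : Finset ι) (a b : ι → ℝ) :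
    cov[fun ω => ∑ i ∈ I, a i * X i ω, fun ω => ∑ j ∈ J, b j * X j ω; P] =
      ∑ i ∈ I, ∑ j ∈ J, a i * b j * cov[X i, X j; P] := by
  rw [covariance_fun_sum_fun_sum']
  · refine Finset.sum_congr rfl fun i _ => Finset.sum_congr rfl fun j _ => ?_
    rw [covariance_const_mul_left, covariance_const_mul_right]; ring
  · exact fun i _ => (h.memLp i).const_mul _
  · exact fun i _ => (h.memLp i).const_mul _

lemma GF.law_eq [Fintype ι] [IsProbabilityMeasure P] [IsProbabilityMeasure P'] (h : GF P X) (h' : GF P' X')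
    (hc : ∀ i j, cov[X i, X j; P] = cov[X' i, X' j; P']) :
    P.map (fun ω i => X i ω) = P'.map (fun ω i => X' i ω) := by
  have hm : Measurable (fun ω i => X i ω) := measurable_pi_iff.2 h.meas
  have hm' : Measurable (fun ω i => X' i ω) := measurable_pi_iff.2 h'.meas
  have := Measure.isProbabilityMeasure_map hm.aemeasurable (μ := P)
  have := Measure.isProbabilityMeasure_map hm'.aemeasurable (μ := P')
  classical
  apply Measure.ext_of_charFunDual
  ext L
  have hL : ∀ x : ι → ℝ, L x = ∑ i, L (Pi.single i 1) * x i := by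
    intro x
    conv_lhs => rw [← Finset.univ_sum_single x]
    rw [map_sum]
    refine Finset.sum_congr rfl fun i _ => ?_
    rw [show Pi.single i (x i) = x i • (Pi.single i (1:ℝ) : ι → ℝ) by
      rw [← Pi.single_smul]; simp, map_smul, smul_eq_mul, mul_comm]
  have e1 : (fun ω => L (fun i => X i ω)) = fun ω => ∑ i, L (Pi.single i 1) * X i ω := by
    ext ω; exact hL _
  have e1' : (fun ω => L (fun i => X' i ω)) = fun ω => ∑ i, L (Pi.single i 1) * X' i ω := by
    ext ω; exact hL _
  have g1 : GF P (fun _ : Unit => fun ω => L (fun i => X i ω)) :=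
    h.lin (fun _ => Finset.univ) (fun _ i => L (Pi.single i 1)) (fun _ ω => hL _)
  have g1' : GF P' (fun _ : Unit => fun ω => L (fun i => X' i ω)) :=
    h'.lin (fun _ => Finset.univ) (fun _ i => L (Pi.single i 1)) (fun _ ω => hL _)
  have ev : Var[(fun ω => L (fun i => X i ω)); P] = Var[(fun ω => L (fun i => X' i ω)); P'] := by
    rw [← covariance_self (g1.meas ()).aemeasurable, ← covariance_self (g1'.meas ()).aemeasurable, e1, e1',
      h.cov_lin, h'.cov_lin]
    simp_rw [hc]
  have key : (P.map (fun ω i => X i ω)).map L = (P'.map (fun ω i => X' i ω)).map L := by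
    rw [Measure.map_map (by fun_prop) hm, Measure.map_map (by fun_prop) hm']
    have a := g1.map_eval ()
    have b := g1'.map_eval ()
    rw [ev, ← b] at a
    exact a
  rw [charFunDual_eq_charFun_map_one, charFunDual_eq_charFun_map_one, key]

lemma GF.indep [IsProbabilityMeasure P] {Y : κ → Ω → ℝ} (h : GF P (Sum.elim X Y))
    (hc : ∀ i j, cov[X i, Y j; P] = 0) : IndepFun (fun ω i => X i ω) (fun ω j => Y j ω) P :=
  h.gp.indepFun_of_covariance_eq_zero (fun i => (h.meas (Sum.inl i)).aemeasurable)
    (fun i => (h.meas (Sum.inr i)).aemeasurable) hc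

lemma lin_dual {I : Type*} [Fintype I] [DecidableEq I] (L : (I → ℝ) →L[ℝ] ℝ) (x : I → ℝ) :
    L x = ∑ i, L (Pi.single i 1) * x i := by
  conv_lhs => rw [← Finset.univ_sum_single x]
  rw [map_sum]
  refine Finset.sum_congr rfl fun i _ => ?_
  rw [show Pi.single i (x i) = x i • (Pi.single i (1:ℝ) : I → ℝ) by
      rw [← Pi.single_smul]; simp, map_smul, smul_eq_mul, mul_comm]

lemma IsCGF.gf {d : ℕ} [IsProbabilityMeasure P] {φ : V d → Ω → ℝ} {C : V d → V d → ℝ} (h : IsCGF P φ C) :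
    GF P φ where
  meas := h.1
  gp := ⟨fun I => ⟨by
    classical
    apply isGaussian_of_map_eq_gaussianReal
    intro L
    exact ⟨0, _, by
      rw [Measure.map_map (by fun_prop) (by
        apply measurable_pi_iff.2; intro i; exact h.1 i)]
      rw [← h.2 I (fun i => if hi : i ∈ I then L (Pi.single ⟨i, hi⟩ 1) else 0)]
      congr 1
      ext ω
      simp only [Function.comp]
      rw [lin_dual L, ← Finset.sum_coe_sort I]
      refine Finset.sum_congr rfl fun i _ => ?_
      simp [Finset.restrict]⟩⟩⟩
  mean x := by
    have := h.2 {x} (fun _ => 1)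
    simp only [Finset.sum_singleton, one_mul] at this
    have e : ∫ ω, φ x ω ∂P = ∫ y, y ∂(P.map (φ x)) := by
      rw [integral_map (h.1 x).aemeasurable (by fun_prop)]
    rw [e, show φ x = fun ω => φ x ω from rfl, this, integral_id_gaussianReal]

lemma IsCGF.cov {d : ℕ} [IsProbabilityMeasure P] {φ : V d → Ω → ℝ} {C : V d → V d → ℝ} (h : IsCGF P φ C)
    (hC : ∀ x y, 0 ≤ C x y) (hs : ∀ x y, C x y = C y x) (x y : V d) : cov[φ x, φ y; P] = C x y := by
  have hv : ∀ (s : Finset (V d)), Var[fun ω => ∑ x ∈ s, φ x ω; P] = ∑ x ∈ s, ∑ y ∈ s, C x y := by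
    intro s
    have := h.2 s (fun _ => 1)
    simp only [one_mul] at this
    have hm : Measurable (fun ω => ∑ x ∈ s, φ x ω) := Finset.measurable_sum _ fun i _ => h.1 i
    have e : Var[fun ω => ∑ x ∈ s, φ x ω; P] = Var[id; P.map (fun ω => ∑ x ∈ s, φ x ω)] := by
      rw [variance_map (by fun_prop) hm.aemeasurable]; rfl
    rw [e, this, variance_id_gaussianReal, Real.coe_toNNReal]
    exact Finset.sum_nonneg fun i _ => Finset.sum_nonneg fun j _ => hC _ _
  have hx : ∀ x, cov[φ x, φ x; P] = C x x := fun x => by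
    rw [covariance_self (h.1 x).aemeasurable]
    simpa using hv {x}
  by_cases hxy : x = y
  · subst hxy; exact hx x
  have h1 := hv {x, y}
  have g := h.gf
  have hm : Measurable (fun ω => ∑ x ∈ {x, y}, φ x ω) := Finset.measurable_sum _ fun i _ => h.1 i
  rw [← covariance_self hm.aemeasurable,
    covariance_fun_sum_fun_sum' (fun i _ => g.memLp i) (fun i _ => g.memLp i)] at h1
  simp only [Finset.sum_pair hxy, hx] at h1
  rw [covariance_comm (φ y) (φ x), hs y x] at h1
  linarith

end gf

section xi
variable {Ω : Type*} [MeasurableSpace Ω] {d : ℕ} {P : Measure Ω} [IsProbabilityMeasure P] {ξ : ℕ → V d → Ω → ℝ}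

lemma IsXiFamily.iIndepFun (hξ : IsXiFamily d P ξ) : iIndepFun (fun ℓ => proc (ξ ℓ)) P := hξ.2

lemma IsXiFamily.meas (hξ : IsXiFamily d P ξ) (ℓ : ℕ) (x : V d) : Measurable (ξ ℓ x) := (hξ.1 ℓ).1 x

lemma IsXiFamily.gf (hξ : IsXiFamily d P ξ) : GF P (fun p : ℕ × V d => ξ p.1 p.2) where
  meas p := hξ.meas _ _
  mean p := (hξ.1 p.1).gf.mean p.2
  gp := ⟨fun I => by
    classical
    let J := I.image Prod.snd
    let N := (I.image Prod.fst).sup id + 1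
    have hi : ProbabilityTheory.iIndepFun (fun (ℓ : Fin N) ω => J.restrict (fun x => ξ ℓ x ω)) P := by
      have := (hξ.iIndepFun.precomp (g := fun ℓ : Fin N => (ℓ : ℕ)) Fin.val_injective).comp
        (fun _ f => J.restrict f) (fun _ => by fun_prop)
      exact this
    have hg := hi.hasGaussianLaw (fun ℓ : Fin N => (hξ.1 ℓ).gf.gp.hasGaussianLaw J)
    have h1 : ∀ i : I, i.1.1 < N := fun i => by
      have : i.1.1 ≤ (I.image Prod.fst).sup id := Finset.le_sup (f := id) (Finset.mem_image_of_mem _ i.2)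
      omega
    have h2 : ∀ i : I, i.1.2 ∈ J := fun i => Finset.mem_image_of_mem _ i.2
    exact hg.map (ContinuousLinearMap.pi fun i : I =>
      (ContinuousLinearMap.proj (⟨i.1.2, h2 i⟩ : J)).comp
        (ContinuousLinearMap.proj (R := ℝ) (φ := fun _ : Fin N => J → ℝ) (⟨i.1.1, h1 i⟩ : Fin N)))⟩

lemma IsXiFamily.cov (hξ : IsXiFamily d P ξ) (p q : ℕ × V d) :
    cov[ξ p.1 p.2, ξ q.1 q.2; P] = if p.1 = q.1 then (1/2) * lazyP d p.1 p.2 q.2 else 0 := by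
  split_ifs with h
  · rw [← h]
    exact (hξ.1 p.1).cov (fun x y => by have := lazyP_nonneg d p.1 x y; positivity)
      (fun x y => by rw [lazyP_symm]) _ _
  · have := (hξ.iIndepFun.indepFun h).comp (measurable_pi_apply p.2) (measurable_pi_apply q.2)
    exact this.covariance_eq_zero (hξ.gf.memLp p) (hξ.gf.memLp q)

end xi
end

section
/-- covariance of the weighted field -/
def Kf (d L : ℕ) (α : ℕ → ℝ) (y z : V d) : ℝ :=
  ∑ ℓ ∈ Finset.range (L + 1), (α ℓ) ^ 2 * ((1/2) * lazyP d ℓ y z)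

def gchi {d : ℕ} (L : ℕ) (α : ℕ → ℝ) (c : Cfg d) (x : V d) : ℝ :=
  ∑ ℓ ∈ Finset.range (L + 1), α ℓ * c (ℓ, x)

/-- admissible weights -/
structure Adm (α : ℕ → ℝ) : Prop where
  zero : α 0 = 1
  nn : ∀ ℓ, 0 ≤ α ℓ
  le : ∀ ℓ, α ℓ ≤ 1

section
variable {d L : ℕ} {α β : ℕ → ℝ}

lemma Kf_symm (y z : V d) : Kf d L α y z = Kf d L α z y := by
  unfold Kf; simp_rw [lazyP_symm d _ y z]

lemma Kf_add (x y z : V d) : Kf d L α (x + z) (y + z) = Kf d L α x y := by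
  unfold Kf; simp_rw [lazyP_add]

lemma Kf_nonneg (y z : V d) : 0 ≤ Kf d L α y z :=
  Finset.sum_nonneg fun ℓ _ => by have := lazyP_nonneg d ℓ y z; positivity

lemma Kf_range {y z : V d} (h : L < dinf y z) : Kf d L α y z = 0 :=
  Finset.sum_eq_zero fun ℓ hl => by
    rw [lazyP_range d ℓ y z (by have := Finset.mem_range.1 hl; omega)]; simp

lemma Kf_le (ha : Adm α) (y z : V d) : Kf d L α y z ≤ L + 1 := by
  calc Kf d L α y z ≤ ∑ ℓ ∈ Finset.range (L + 1), (1:ℝ) := by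
        refine Finset.sum_le_sum fun ℓ _ => ?_
        have h1 := lazyP_nonneg d ℓ y z
        have h2 := lazyP_le_one d ℓ y z
        have h3 : α ℓ ^ 2 ≤ 1 := by have := ha.nn ℓ; have := ha.le ℓ; nlinarith
        nlinarith [sq_nonneg (α ℓ)]
    _ = L + 1 := by simp

lemma Kf_diag (ha : Adm α) (y : V d) : 1/2 ≤ Kf d L α y y := by
  unfold Kf
  have := Finset.single_le_sum (f := fun ℓ => (α ℓ) ^ 2 * ((1/2) * lazyP d ℓ y y)) (s := Finset.range (L+1))
    (fun ℓ _ => by have := lazyP_nonneg d ℓ y y; positivity) (Finset.mem_range.2 (Nat.succ_pos L))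
  simpa [ha.zero, lazyP_zero] using this

variable {Ω : Type*} [MeasurableSpace Ω] {P : Measure Ω} [IsProbabilityMeasure P] {ξ : ℕ → V d → Ω → ℝ}

lemma lazyP_psd (hξ : IsXiFamily d P ξ) (ℓ : ℕ) (y z : V d) (k : ℝ) :
    0 ≤ lazyP d ℓ z z - 2 * k * lazyP d ℓ z y + k ^ 2 * lazyP d ℓ y y := by
  have h : 0 ≤ Var[fun ω => ξ ℓ z ω - k * ξ ℓ y ω; P] := variance_nonneg _ _
  have m1 : MemLp (ξ ℓ z) 2 P := hξ.gf.memLp (ℓ, z)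
  have m2 : MemLp (fun ω => k * ξ ℓ y ω) 2 P := (hξ.gf.memLp (ℓ, y)).const_mul k
  have mm : AEMeasurable (fun ω => ξ ℓ z ω - k * ξ ℓ y ω) P :=
    ((hξ.meas ℓ z).sub ((hξ.meas ℓ y).const_mul k)).aemeasurable
  rw [← covariance_self mm,
    covariance_fun_sub_fun_sub m1 m2 m1 m2] at h
  simp only [covariance_const_mul_left, covariance_const_mul_right] at h
  have a1 := hξ.cov (ℓ, z) (ℓ, z)
  have a2 := hξ.cov (ℓ, z) (ℓ, y)
  have a3 := hξ.cov (ℓ, y) (ℓ, z)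
  have a4 := hξ.cov (ℓ, y) (ℓ, y)
  simp only [if_true] at a1 a2 a3 a4
  rw [a1, a2, a3, a4, lazyP_symm d ℓ y z] at h
  nlinarith

lemma Kf_nondeg (hξ : IsXiFamily d P ξ) (ha : Adm α) {y z : V d} (hyz : y ≠ z) (k : ℝ) :
    1/2 ≤ Kf d L α z z - 2 * k * Kf d L α z y + k ^ 2 * Kf d L α y y := by
  have e : Kf d L α z z - 2 * k * Kf d L α z y + k ^ 2 * Kf d L α y y =
    ∑ ℓ ∈ Finset.range (L + 1), (α ℓ) ^ 2 * ((1/2) *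
      (lazyP d ℓ z z - 2 * k * lazyP d ℓ z y + k ^ 2 * lazyP d ℓ y y)) := by
    unfold Kf
    rw [Finset.mul_sum, Finset.mul_sum, ← Finset.sum_sub_distrib, ← Finset.sum_add_distrib]
    refine Finset.sum_congr rfl fun ℓ _ => by ring
  rw [e]
  have := Finset.single_le_sum (f := fun ℓ => (α ℓ) ^ 2 * ((1/2) *
      (lazyP d ℓ z z - 2 * k * lazyP d ℓ z y + k ^ 2 * lazyP d ℓ y y))) (s := Finset.range (L+1))
    (fun ℓ _ => by have := lazyP_psd hξ ℓ y z k; positivity) (Finset.mem_range.2 (Nat.succ_pos L))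
  refine le_trans ?_ this
  simp [ha.zero, lazyP_zero, hyz.symm]
  nlinarith [sq_nonneg k]

lemma cov_gchi (hξ : IsXiFamily d P ξ) (y z : V d) :
    cov[fun ω => gchi L α (cfg ξ ω) y, fun ω => gchi L β (cfg ξ ω) z; P] =
      ∑ ℓ ∈ Finset.range (L + 1), α ℓ * β ℓ * ((1/2) * lazyP d ℓ y z) := by
  unfold gchi cfg
  rw [covariance_fun_sum_fun_sum' (X := fun ℓ ω => α ℓ * ξ ℓ y ω) (Y := fun ℓ ω => β ℓ * ξ ℓ z ω)
    (fun i _ => (hξ.gf.memLp (i, y)).const_mul _)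
    (fun i _ => (hξ.gf.memLp (i, z)).const_mul _)]
  refine Finset.sum_congr rfl fun ℓ hl => ?_
  rw [Finset.sum_eq_single ℓ]
  · rw [covariance_const_mul_left, covariance_const_mul_right, hξ.cov (ℓ, y) (ℓ, z)]
    simp; ring
  · intro m _ hm
    rw [covariance_const_mul_left, covariance_const_mul_right, hξ.cov (ℓ, y) (m, z)]
    simp [Ne.symm hm]
  · exact fun h => absurd hl h

lemma gf_gchi2 (hξ : IsXiFamily d P ξ) (L : ℕ) :
    GF P (fun (p : (ℕ → ℝ) × V d) ω => gchi L p.1 (cfg ξ ω) p.2) :=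
  hξ.gf.lin (fun p => Finset.range (L + 1) ×ˢ {p.2}) (fun p q => p.1 q.1) (fun p ω => by
    simp [gchi, Finset.sum_product, cfg])

lemma gf_gchi (hξ : IsXiFamily d P ξ) (L : ℕ) (α : ℕ → ℝ) :
    GF P (fun y ω => gchi L α (cfg ξ ω) y) := (gf_gchi2 hξ L).comp (fun y => (α, y))

lemma cov_gchi' (hξ : IsXiFamily d P ξ) (y z : V d) :
    cov[fun ω => gchi L α (cfg ξ ω) y, fun ω => gchi L α (cfg ξ ω) z; P] = Kf d L α y z := by
  rw [cov_gchi hξ]; unfold Kf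
  refine Finset.sum_congr rfl fun ℓ hl => ?_
  ring

end

/-- weights attached to `t` -/
def alphaT (ℓ₀ L₀ : ℕ) (t : ℝ) (ℓ : ℕ) : ℝ := if ℓ ≤ Lsc ℓ₀ L₀ ⌊t⌋₊ then 1 else t - ⌊t⌋₊
def betaT (ℓ₀ L₀ : ℕ) (t : ℝ) (ℓ : ℕ) : ℝ := if ℓ ≤ Lsc ℓ₀ L₀ ⌊t⌋₊ then 0 else 1

lemma adm_alphaT (ℓ₀ L₀ : ℕ) {t : ℝ} (ht : 0 ≤ t) : Adm (alphaT ℓ₀ L₀ t) where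
  zero := by simp [alphaT]
  nn ℓ := by unfold alphaT; split_ifs; · norm_num
             · have := Nat.floor_le ht; linarith
  le ℓ := by unfold alphaT; split_ifs; · norm_num
             · have := Nat.lt_floor_add_one t; linarith

lemma sum_split {a b : ℕ} (hab : a ≤ b) (f : ℕ → ℝ) : ∑ ℓ ∈ Finset.range (b+1), f ℓ =
    ∑ ℓ ∈ Finset.range (a+1), f ℓ + ∑ ℓ ∈ Finset.Ioc a b, f ℓ := by
  rw [← Finset.sum_union]
  · congr 1; ext i; simp; omega
  · rw [Finset.disjoint_left]; intro i; simp; omega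

section
variable {d ℓ₀ L₀ : ℕ} {t : ℝ}

lemma Lsc_mono (h : 1 ≤ ℓ₀) {a b : ℕ} (hab : a ≤ b) : Lsc ℓ₀ L₀ a ≤ Lsc ℓ₀ L₀ b :=
  Nat.mul_le_mul_right _ (Nat.pow_le_pow_right h hab)

lemma Lsc_fc (h : 1 ≤ ℓ₀) : Lsc ℓ₀ L₀ ⌊t⌋₊ ≤ Lsc ℓ₀ L₀ ⌈t⌉₊ := Lsc_mono h (Nat.floor_le_ceil t)

lemma chiFun_eq (h : 1 ≤ ℓ₀) (c : Cfg d) (x : V d) :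
    chiFun d ℓ₀ L₀ t c x = gchi (Lsc ℓ₀ L₀ ⌈t⌉₊) (alphaT ℓ₀ L₀ t) c x := by
  unfold chiFun gchi
  rw [sum_split (Lsc_fc h), Finset.mul_sum]
  congr 1 <;> refine Finset.sum_congr rfl fun ℓ hl => ?_
  · rw [alphaT, if_pos (by simp at hl; omega), one_mul]
  · rw [alphaT, if_neg (by simp at hl; omega)]

lemma psiFun_eq (h : 1 ≤ ℓ₀) (c : Cfg d) (x : V d) :
    psiFun d ℓ₀ L₀ t c x = gchi (Lsc ℓ₀ L₀ ⌈t⌉₊) (betaT ℓ₀ L₀ t) c x := by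
  unfold psiFun gchi
  rw [sum_split (Lsc_fc h), Finset.sum_eq_zero (s := Finset.range _), zero_add]
  · refine Finset.sum_congr rfl fun ℓ hl => ?_
    rw [betaT, if_neg (by simp at hl; omega), one_mul]
  · intro ℓ hl
    rw [betaT, if_pos (by simp at hl; omega), zero_mul]

lemma varChi_eq (h : 1 ≤ ℓ₀) (x : V d) :
    varChi d ℓ₀ L₀ t x = Kf d (Lsc ℓ₀ L₀ ⌈t⌉₊) (alphaT ℓ₀ L₀ t) x x := by
  unfold varChi Kf
  rw [sum_split (Lsc_fc h), Finset.mul_sum]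
  congr 1 <;> refine Finset.sum_congr rfl fun ℓ hl => ?_
  · rw [alphaT, if_pos (by simp at hl; omega)]; ring
  · rw [alphaT, if_neg (by simp at hl; omega)]

lemma covXiChi_eq (ℓ : ℕ) (hl : ℓ ≤ Lsc ℓ₀ L₀ ⌈t⌉₊) (y x : V d) :
    covXiChi d ℓ₀ L₀ t ℓ y x = alphaT ℓ₀ L₀ t ℓ * ((1/2) * lazyP d ℓ y x) := by
  unfold covXiChi alphaT
  split_ifs <;> simp

lemma gchi_shift (h1 : 1 ≤ ℓ₀) (x y : V d) (h : ℝ) (c : Cfg d) (β : ℕ → ℝ) :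
    gchi (Lsc ℓ₀ L₀ ⌈t⌉₊) β (shiftCfg d ℓ₀ L₀ t x h c) y =
      gchi (Lsc ℓ₀ L₀ ⌈t⌉₊) β c y - (∑ ℓ ∈ Finset.range (Lsc ℓ₀ L₀ ⌈t⌉₊ + 1),
        β ℓ * alphaT ℓ₀ L₀ t ℓ * ((1/2) * lazyP d ℓ y x)) /
        Kf d (Lsc ℓ₀ L₀ ⌈t⌉₊) (alphaT ℓ₀ L₀ t) x x *
        (gchi (Lsc ℓ₀ L₀ ⌈t⌉₊) (alphaT ℓ₀ L₀ t) c x - h) := by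
  rw [div_eq_mul_inv, Finset.sum_mul, Finset.sum_mul]
  conv_lhs => unfold gchi
  conv_rhs => rw [gchi]
  rw [← Finset.sum_sub_distrib]
  refine Finset.sum_congr rfl fun ℓ hl => ?_
  rw [shiftCfg, covXiChi_eq ℓ (by simp at hl; omega), varChi_eq h1, chiFun_eq h1]
  ring

end
end

section
/-- bounded monotone measurable functions -/
structure BM {E : Type*} [MeasurableSpace E] [Preorder E] (f : E → ℝ) : Prop where
  meas : Measurable f
  mono : Monotone f
  nn : ∀ x, 0 ≤ f x
  le : ∀ x, f x ≤ 1

/-- positive association -/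
def PosAssoc {E : Type*} [MeasurableSpace E] [Preorder E] (μ : Measure E) : Prop :=
  ∀ f g : E → ℝ, BM f → BM g → (∫ x, f x ∂μ) * (∫ x, g x ∂μ) ≤ ∫ x, f x * g x ∂μ

lemma BM.int {E : Type*} [MeasurableSpace E] [Preorder E] {f : E → ℝ} (h : BM f) (μ : Measure E)
    [IsProbabilityMeasure μ] : Integrable f μ :=
  Integrable.of_bound h.meas.aestronglyMeasurable 1 (ae_of_all _ fun x => by
    rw [Real.norm_eq_abs, abs_of_nonneg (h.nn x)]; exact h.le x)

lemma BM.int_mul {E : Type*} [MeasurableSpace E] [Preorder E] {f g : E → ℝ} (h : BM f) (h' : BM g) (μ : Measure E)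
    [IsProbabilityMeasure μ] : Integrable (fun x => f x * g x) μ :=
  Integrable.of_bound (h.meas.mul h'.meas).aestronglyMeasurable 1 (ae_of_all _ fun x => by
    rw [Real.norm_eq_abs, abs_of_nonneg (mul_nonneg (h.nn x) (h'.nn x))]
    exact mul_le_one₀ (h.le x) (h'.nn x) (h'.le x))

lemma posAssoc_real (ν : Measure ℝ) [IsProbabilityMeasure ν] : PosAssoc ν := by
  intro f g hf hg
  have h0 : ∀ x y, 0 ≤ (f x - f y) * (g x - g y) := by
    intro x y
    rcases le_total x y with h | h
    · exact mul_nonneg_of_nonpos_of_nonpos (sub_nonpos.2 (hf.mono h)) (sub_nonpos.2 (hg.mono h))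
    · exact mul_nonneg (sub_nonneg.2 (hf.mono h)) (sub_nonneg.2 (hg.mono h))
  have h1 : ∀ x, 0 ≤ f x * g x - f x * (∫ y, g y ∂ν) - g x * (∫ y, f y ∂ν) + ∫ y, f y * g y ∂ν := by
    intro x
    have : 0 ≤ ∫ y, (f x - f y) * (g x - g y) ∂ν := integral_nonneg (h0 x)
    have e : (fun y => (f x - f y) * (g x - g y)) =
        fun y => (f x * g x - f x * g y - g x * f y) + f y * g y := by ext y; ring
    rw [e, integral_add _ (hf.int_mul hg ν), integral_sub _ ((hf.int ν).const_mul _),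
      integral_sub (integrable_const _) ((hg.int ν).const_mul _), integral_const_mul, integral_const_mul] at this
    · simpa [integral_const_mul] using this
    · exact (integrable_const _).sub ((hg.int ν).const_mul _)
    · exact ((integrable_const _).sub ((hg.int ν).const_mul _)).sub ((hf.int ν).const_mul _)
  have h2 : 0 ≤ ∫ x, (f x * g x - f x * (∫ y, g y ∂ν) - g x * (∫ y, f y ∂ν) + ∫ y, f y * g y ∂ν) ∂ν :=
    integral_nonneg h1
  rw [integral_add _ (integrable_const _), integral_sub _ ((hg.int ν).mul_const _),
    integral_sub (hf.int_mul hg ν) ((hf.int ν).mul_const _), integral_mul_const, integral_mul_const] at h2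
  · simp at h2
    nlinarith
  · exact (hf.int_mul hg ν).sub ((hf.int ν).mul_const _)
  · exact ((hf.int_mul hg ν).sub ((hf.int ν).mul_const _)).sub ((hg.int ν).mul_const _)

lemma PosAssoc.map {E F : Type*} [MeasurableSpace E] [Preorder E] [MeasurableSpace F] [Preorder F]
    {μ : Measure E} (h : PosAssoc μ) {φ : E → F} (hm : Measurable φ) (hφ : Monotone φ) : PosAssoc (μ.map φ) := by
  intro f g hf hg
  have c : ∀ {f : F → ℝ}, BM f → BM (fun x => f (φ x)) := fun hf =>
    ⟨hf.meas.comp hm, hf.mono.comp hφ, fun x => hf.nn _, fun x => hf.le _⟩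
  rw [integral_map hm.aemeasurable hf.meas.aestronglyMeasurable,
    integral_map hm.aemeasurable hg.meas.aestronglyMeasurable,
    integral_map (f := fun x => f x * g x) hm.aemeasurable (hf.meas.mul hg.meas).aestronglyMeasurable]
  exact h _ _ (c hf) (c hg)

lemma PosAssoc.prod {E F : Type*} [MeasurableSpace E] [Preorder E] [MeasurableSpace F] [Preorder F]
    {μ : Measure E} {ν : Measure F} [IsProbabilityMeasure μ] [IsProbabilityMeasure ν]
    (h : PosAssoc μ) (h' : PosAssoc ν) : PosAssoc (μ.prod ν) := by
  intro f g hf hg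
  rw [integral_prod _ (hf.int _), integral_prod _ (hg.int _), integral_prod _ (hf.int_mul hg _)]
  have s : ∀ {f : E × F → ℝ}, BM f → ∀ x, BM (fun y => f (x, y)) := fun hf x =>
    ⟨hf.meas.comp measurable_prodMk_left, fun a b hab => hf.mono ⟨le_rfl, hab⟩, fun _ => hf.nn _, fun _ => hf.le _⟩
  have i : ∀ {f : E × F → ℝ}, BM f → BM (fun x => ∫ y, f (x, y) ∂ν) := fun hf => by
    refine ⟨(hf.meas.stronglyMeasurable.integral_prod_right').measurable, fun a b hab => ?_, fun x => ?_, fun x => ?_⟩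
    · exact integral_mono ((s hf a).int ν) ((s hf b).int ν) fun y => hf.mono ⟨hab, le_rfl⟩
    · exact integral_nonneg fun y => hf.nn _
    · calc ∫ y, _ ∂ν ≤ ∫ y, (1:ℝ) ∂ν := integral_mono ((s hf x).int ν) (integrable_const _) fun y => hf.le _
        _ = 1 := by simp
  refine (h _ _ (i hf) (i hg)).trans ?_
  refine integral_mono ((i hf).int_mul (i hg) μ) (hf.int_mul hg _).integral_prod_left fun x => ?_
  exact h' _ _ (s hf x) (s hg x)

lemma posAssoc_fin (n : ℕ) (ν : Measure ℝ) [IsProbabilityMeasure ν] :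
    PosAssoc (Measure.pi fun _ : Fin n => ν) := by
  induction n with
  | zero =>
    intro f g hf hg
    have : ∀ f : (Fin 0 → ℝ) → ℝ, ∫ x, f x ∂(Measure.pi fun _ : Fin 0 => ν) = f default := by
      intro f
      rw [show f = fun _ => f default from funext fun x => by rw [Subsingleton.elim x default]]
      simp
    rw [this, this, this]
  | succ n ih =>
    have h1 := (posAssoc_real ν).prod ih
    have mp := (measurePreserving_piFinSuccAbove (fun _ : Fin (n+1) => ν) 0).symm
    rw [← mp.map_eq]
    refine h1.map mp.measurable ?_
    intro a b hab i
    refine Fin.cases ?_ (fun j => ?_) i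
    · simpa using hab.1
    · simpa using hab.2 j

lemma posAssoc_pi {J : Type*} [Fintype J] (ν : Measure ℝ) [IsProbabilityMeasure ν] :
    PosAssoc (Measure.pi fun _ : J => ν) := by
  let e := (Fintype.equivFin J).symm
  have mp := measurePreserving_piCongrLeft (fun _ : J => ν) e
  rw [← mp.map_eq]
  refine (posAssoc_fin _ ν).map mp.measurable ?_
  intro a b hab j
  obtain ⟨i, rfl⟩ := e.surjective j
  simpa [MeasurableEquiv.coe_piCongrLeft, Equiv.piCongrLeft_apply_apply] using hab i

lemma PosAssoc.sets {E : Type*} [MeasurableSpace E] [Preorder E] {μ : Measure E} [IsProbabilityMeasure μ]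
    (h : PosAssoc μ) {A B : Set E} (hA : MeasurableSet A) (hB : MeasurableSet B)
    (uA : IsUpperSet A) (uB : IsUpperSet B) : μ.real A * μ.real B ≤ μ.real (A ∩ B) := by
  have b : ∀ {A : Set E}, MeasurableSet A → IsUpperSet A → BM (A.indicator (fun _ => (1:ℝ))) := by
    intro A hA uA
    refine ⟨measurable_const.indicator hA, fun x y hxy => ?_, fun x => ?_, fun x => ?_⟩
    · by_cases hx : x ∈ A
      · simp [hx, uA hxy hx]
      · simp only [indicator_of_notMem hx]
        exact indicator_nonneg (fun _ _ => zero_le_one) _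
    · exact indicator_nonneg (fun _ _ => zero_le_one) _
    · exact indicator_le' (fun _ _ => le_rfl) (fun _ _ => zero_le_one) x
  have := h _ _ (b hA uA) (b hB uB)
  simp only [← Set.inter_indicator_mul, mul_one] at this
  rw [integral_indicator hA, integral_indicator hB, integral_indicator (hA.inter hB)] at this
  simpa using this
end

section
section prod
variable {Ω₁ Ω₂ ι κ : Type*} [MeasurableSpace Ω₁] [MeasurableSpace Ω₂] {μ : Measure Ω₁} {ν : Measure Ω₂}
  [IsProbabilityMeasure μ] [IsProbabilityMeasure ν] {X : ι → Ω₁ → ℝ} {Y : κ → Ω₂ → ℝ}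

lemma GF.prod (hX : GF μ X) (hY : GF ν Y) :
    GF (μ.prod ν) (Sum.elim (fun i (ω : Ω₁ × Ω₂) => X i ω.1) (fun j ω => Y j ω.2)) where
  meas := by
    rintro (i | j)
    · exact (hX.meas i).comp measurable_fst
    · exact (hY.meas j).comp measurable_snd
  mean := by
    rintro (i | j)
    · have : ∫ ω, X i ω.1 ∂(μ.prod ν) = ∫ x, X i x ∂((μ.prod ν).map Prod.fst) := by
        rw [integral_map measurable_fst.aemeasurable (hX.meas i).aestronglyMeasurable]
      simp only [Sum.elim_inl]
      rw [this]; simp [hX.mean]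
    · have : ∫ ω, Y j ω.2 ∂(μ.prod ν) = ∫ x, Y j x ∂((μ.prod ν).map Prod.snd) := by
        rw [integral_map measurable_snd.aemeasurable (hY.meas j).aestronglyMeasurable]
      simp only [Sum.elim_inr]
      rw [this]; simp [hY.mean]
  gp := ⟨fun I => by
    classical
    have m1 : Measurable (fun ω => I.toLeft.restrict (X · ω)) := measurable_pi_iff.2 fun i => hX.meas i
    have m2 : Measurable (fun ω => I.toRight.restrict (Y · ω)) := measurable_pi_iff.2 fun i => hY.meas i
    have h1 : HasGaussianLaw (fun ω : Ω₁ × Ω₂ => I.toLeft.restrict (X · ω.1)) (μ.prod ν) := ⟨by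
      have := (hX.gp.hasGaussianLaw I.toLeft).isGaussian_map
      have e : (μ.prod ν).map (fun ω : Ω₁ × Ω₂ => I.toLeft.restrict (X · ω.1)) =
        ((μ.prod ν).map Prod.fst).map (fun ω => I.toLeft.restrict (X · ω)) := by
        rw [Measure.map_map m1 measurable_fst]; rfl
      rw [e]; simpa using this⟩
    have h2 : HasGaussianLaw (fun ω : Ω₁ × Ω₂ => I.toRight.restrict (Y · ω.2)) (μ.prod ν) := ⟨by
      have := (hY.gp.hasGaussianLaw I.toRight).isGaussian_map
      have e : (μ.prod ν).map (fun ω : Ω₁ × Ω₂ => I.toRight.restrict (Y · ω.2)) =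
        ((μ.prod ν).map Prod.snd).map (fun ω => I.toRight.restrict (Y · ω)) := by
        rw [Measure.map_map m2 measurable_snd]; rfl
      rw [e]; simpa using this⟩
    have h3 := IndepFun.hasGaussianLaw h1 h2 (indepFun_prod m1 m2)
    let C : ((I.toLeft → ℝ) × (I.toRight → ℝ)) →L[ℝ] (I → ℝ) := ContinuousLinearMap.pi fun k : I =>
      match k with
      | ⟨Sum.inl i, h⟩ => (ContinuousLinearMap.proj (R := ℝ) (φ := fun _ : I.toLeft => ℝ) ⟨i, by simpa using h⟩).comp
          (ContinuousLinearMap.fst ℝ _ _)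
      | ⟨Sum.inr j, h⟩ => (ContinuousLinearMap.proj (R := ℝ) (φ := fun _ : I.toRight => ℝ) ⟨j, by simpa using h⟩).comp
          (ContinuousLinearMap.snd ℝ _ _)
    have h4 := h3.map C
    have e5 : (fun ω : Ω₁ × Ω₂ => I.restrict ((Sum.elim (fun i (ω : Ω₁ × Ω₂) => X i ω.1) (fun j ω => Y j ω.2)) · ω)) =
        fun ω : Ω₁ × Ω₂ => C (I.toLeft.restrict (X · ω.1), I.toRight.restrict (Y · ω.2)) := by
      funext ω k
      rcases k with ⟨i | j, h⟩ <;> rfl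
    rw [e5]; exact h4⟩

lemma cov_fst (hX : GF μ X) (i j : ι) :
    cov[fun ω : Ω₁ × Ω₂ => X i ω.1, fun ω => X j ω.1; μ.prod ν] = cov[X i, X j; μ] := by
  have := covariance_map_fun (μ := μ.prod ν) (Z := Prod.fst) (X := X i) (Y := X j)
    (by simpa using (hX.meas i).aestronglyMeasurable) (by simpa using (hX.meas j).aestronglyMeasurable)
    measurable_fst.aemeasurable
  rw [← this]; simp

lemma cov_snd (hY : GF ν Y) (i j : κ) :
    cov[fun ω : Ω₁ × Ω₂ => Y i ω.2, fun ω => Y j ω.2; μ.prod ν] = cov[Y i, Y j; ν] := by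
  have := covariance_map_fun (μ := μ.prod ν) (Z := Prod.snd) (X := Y i) (Y := Y j)
    (by simpa using (hY.meas i).aestronglyMeasurable) (by simpa using (hY.meas j).aestronglyMeasurable)
    measurable_snd.aemeasurable
  rw [← this]; simp

lemma cov_fst_snd (hX : GF μ X) (hY : GF ν Y) (i : ι) (j : κ) :
    cov[fun ω : Ω₁ × Ω₂ => X i ω.1, fun ω => Y j ω.2; μ.prod ν] = 0 := by
  have g := hX.prod hY
  exact (indepFun_prod (hX.meas i) (hY.meas j)).covariance_eq_zero (g.memLp (Sum.inl i)) (g.memLp (Sum.inr j))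

lemma GF.add_prod {Y : ι → Ω₂ → ℝ} (hX : GF μ X) (hY : GF ν Y) :
    GF (μ.prod ν) (fun i (ω : Ω₁ × Ω₂) => X i ω.1 + Y i ω.2) := by
  classical
  exact (hX.prod hY).lin (fun i => {Sum.inl i, Sum.inr i}) (fun _ _ => 1) (fun i ω => by simp)

lemma cov_add_prod {Y : ι → Ω₂ → ℝ} (hX : GF μ X) (hY : GF ν Y) (i j : ι) :
    cov[fun (ω : Ω₁ × Ω₂) => X i ω.1 + Y i ω.2, fun (ω : Ω₁ × Ω₂) => X j ω.1 + Y j ω.2; μ.prod ν] =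
      cov[X i, X j; μ] + cov[Y i, Y j; ν] := by
  have g := hX.prod hY
  have a1 := g.memLp (Sum.inl i)
  have a2 := g.memLp (Sum.inl j)
  have b1 := g.memLp (Sum.inr i)
  have b2 := g.memLp (Sum.inr j)
  have := covariance_add_left (Z := fun (ω : Ω₁ × Ω₂) => X j ω.1 + Y j ω.2) a1 b1 (a2.add b2)
  have e1 := covariance_add_right a1 a2 b2
  have e2 := covariance_add_right b1 a2 b2
  have e3 := cov_fst (ν := ν) hX i j
  have e4 := cov_snd (μ := μ) hY i j
  have e5 := cov_fst_snd hX hY i j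
  have e6 := cov_fst_snd hX hY j i
  rw [covariance_comm] at e6
  have f1 : cov[fun (ω : Ω₁ × Ω₂) => X i ω.1, fun (ω : Ω₁ × Ω₂) => X j ω.1 + Y j ω.2; μ.prod ν] = cov[X i, X j; μ] := by
    refine e1.trans ?_
    simp only [Sum.elim_inl, Sum.elim_inr]
    rw [e3, e5, add_zero]
  have f2 : cov[fun (ω : Ω₁ × Ω₂) => Y i ω.2, fun (ω : Ω₁ × Ω₂) => X j ω.1 + Y j ω.2; μ.prod ν] = cov[Y i, Y j; ν] := by
    refine e2.trans ?_
    simp only [Sum.elim_inl, Sum.elim_inr]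
    rw [e4, e6, zero_add]
  refine this.trans ?_
  simp only [Sum.elim_inl, Sum.elim_inr]
  rw [f1, f2]

end prod

section noise
variable {J ι : Type*} [Fintype J]

/-- white noise measure -/
def wnM (J : Type*) [Fintype J] : Measure (J → ℝ) := Measure.pi fun _ => gaussianReal 0 1

instance : IsProbabilityMeasure (wnM J) := by unfold wnM; infer_instance

lemma wn_law (j : J) : (wnM J).map (fun g => g j) = gaussianReal 0 1 :=
  (measurePreserving_eval (fun _ : J => gaussianReal 0 1) j).map_eq

lemma wn_gf : GF (wnM J) (fun j (g : J → ℝ) => g j) where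
  meas j := measurable_pi_apply j
  mean j := by
    have : ∫ g : J → ℝ, g j ∂(wnM J) = ∫ x, x ∂((wnM J).map (fun g => g j)) := by
      rw [integral_map (measurable_pi_apply j).aemeasurable (by fun_prop)]
    rw [this, wn_law, integral_id_gaussianReal]
  gp := ⟨fun I => by
    classical
    have hi : iIndepFun (fun j (g : J → ℝ) => g j) (wnM J) :=
      iIndepFun_pi (X := fun _ x => x) (fun j => aemeasurable_id)
    have h := hi.hasGaussianLaw (fun j => ⟨by rw [wn_law]; infer_instance⟩)
    exact h.map (ContinuousLinearMap.pi fun i : I => ContinuousLinearMap.proj (R := ℝ) (φ := fun _ : J => ℝ) i.1)⟩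

lemma wn_cov [DecidableEq J] (i j : J) : cov[fun g : J → ℝ => g i, fun g => g j; wnM J] = if i = j then 1 else 0 := by
  split_ifs with h
  · subst h
    rw [covariance_self (measurable_pi_apply i).aemeasurable]
    have e : Var[fun g : J → ℝ => g i; wnM J] = Var[id; (wnM J).map (fun g => g i)] := by
      rw [variance_map measurable_id.aemeasurable (measurable_pi_apply i).aemeasurable]; rfl
    rw [e, wn_law, variance_id_gaussianReal]; simp
  · have hi : iIndepFun (fun j (g : J → ℝ) => g j) (wnM J) :=
      iIndepFun_pi (X := fun _ x => x) (fun j => aemeasurable_id)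
    exact (hi.indepFun h).covariance_eq_zero (wn_gf.memLp i) (wn_gf.memLp j)

/-- linear field driven by white noise -/
def wnF (a : J → ι → ℝ) (y : ι) (g : J → ℝ) : ℝ := ∑ j, a j y * g j

lemma wnF_gf (a : J → ι → ℝ) : GF (wnM J) (wnF a) :=
  wn_gf.lin (fun _ => Finset.univ) (fun y j => a j y) (fun y g => rfl)

lemma wnF_cov (a : J → ι → ℝ) (y z : ι) : cov[wnF a y, wnF a z; wnM J] = ∑ j, a j y * a j z := by
  classical
  have := wn_gf.cov_lin (P := wnM J) Finset.univ Finset.univ (fun j => a j y) (fun j => a j z)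
  refine this.trans ?_
  refine Finset.sum_congr rfl fun i _ => ?_
  rw [Finset.sum_eq_single i]
  · rw [wn_cov]; simp
  · intro j _ hj; rw [wn_cov]; simp [hj.symm]
  · simp

lemma wnF_posAssoc {a : J → ι → ℝ} (ha : ∀ j y, 0 ≤ a j y) : PosAssoc ((wnM J).map (fun g y => wnF a y g)) := by
  refine (posAssoc_pi _).map (measurable_pi_iff.2 fun y => (wnF_gf a).meas y) ?_
  intro g g' h y
  exact Finset.sum_le_sum fun j _ => mul_le_mul_of_nonneg_left (h j) (ha j y)

end noise

/-- square-root weights -/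
def wgt (d : ℕ) : ℕ → Fin d → V d → V d → ℝ
  | 0, _, z, y => if y = z then 1 / Real.sqrt (2 * d) else 0
  | 1, i, z, y => ((if y = z then 1 else 0) + (if y = z + unitV d i then 1 else 0)) / Real.sqrt (8 * d)
  | (k + 2), i, z, y => (1 / 2) * wgt d k i z y +
        (1 / (4 * d)) * ∑ m : Fin d, (wgt d k i z (y + unitV d m) + wgt d k i z (y - unitV d m))

lemma wgt_nonneg (d : ℕ) : ∀ (k : ℕ) (i : Fin d) (z y : V d), 0 ≤ wgt d k i z y
  | 0, i, z, y => by rw [wgt]; split_ifs <;> positivity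
  | 1, i, z, y => by rw [wgt]; split_ifs <;> positivity
  | (k + 2), i, z, y => by
    rw [wgt]
    have h1 := wgt_nonneg d k i z y
    have h2 : 0 ≤ ∑ m : Fin d, (wgt d k i z (y + unitV d m) + wgt d k i z (y - unitV d m)) :=
      Finset.sum_nonneg fun m _ => add_nonneg (wgt_nonneg d k i z _) (wgt_nonneg d k i z _)
    positivity

lemma wgt_range (d : ℕ) : ∀ (k : ℕ) (i : Fin d) (z y : V d), k < dinf z y → wgt d k i z y = 0
  | 0, i, z, y, h => by rw [wgt, if_neg]; rintro rfl; simp [dinf_self] at h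
  | 1, i, z, y, h => by
    rw [wgt, if_neg, if_neg]; · simp
    · rintro rfl; have := dinf_unit_add z i; omega
    · rintro rfl; simp [dinf_self] at h
  | (k + 2), i, z, y, h => by
    rw [wgt, wgt_range d k i z y (by omega), Finset.sum_eq_zero]
    · simp
    · intro m _
      have h1 := dinf_unit_add y m
      have h2 := dinf_unit_sub y m
      have h3 := dinf_tri z (y + unitV d m) y
      have h4 := dinf_tri z (y - unitV d m) y
      rw [dinf_comm] at h1 h2
      rw [wgt_range d k i z _ (by omega), wgt_range d k i z _ (by omega), add_zero]

lemma sum_swap3 {α β γ : Type*} (I : Finset α) (Z : Finset β) (M : Finset γ) (A : α → β → ℝ) (F G : γ → α → β → ℝ) (b c : ℝ) :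
    ∑ i ∈ I, ∑ z ∈ Z, (b * A i z + c * ∑ m ∈ M, (F m i z + G m i z)) =
      b * ∑ i ∈ I, ∑ z ∈ Z, A i z + c * ∑ m ∈ M, (∑ i ∈ I, ∑ z ∈ Z, F m i z + ∑ i ∈ I, ∑ z ∈ Z, G m i z) := by
  simp_rw [Finset.sum_add_distrib, ← Finset.mul_sum, Finset.sum_add_distrib]
  congr 2
  rw [Finset.sum_comm (s := M), Finset.sum_comm (s := M)]
  congr 1 <;> exact Finset.sum_congr rfl fun i _ => Finset.sum_comm

lemma wgt_cov (d : ℕ) (hd : 0 < d) : ∀ (k : ℕ) (Z : Finset (V d)) (y y' : V d), (fbox d y k ⊆ Z) →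
    ∑ i, ∑ z ∈ Z, wgt d k i z y * wgt d k i z y' = (1/2) * lazyP d k y y'
  | 0, Z, y, y', h => by
    have hy : y ∈ Z := h (mem_fbox.2 (by simp [dinf_self]))
    have hd' : (0:ℝ) < d := by exact_mod_cast hd
    have : ∀ i : Fin d, ∑ z ∈ Z, wgt d 0 i z y * wgt d 0 i z y' = (if y = y' then 1 else 0) / (2 * d) := by
      intro i
      rw [Finset.sum_eq_single y]
      · simp only [wgt, if_true]
        by_cases hh : y' = y
        · rw [if_pos hh, if_pos hh.symm, ← pow_two, div_pow, Real.sq_sqrt (by positivity)]; norm_num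
        · rw [if_neg hh, if_neg (Ne.symm hh)]; simp
      · intro z _ hz; simp [wgt, Ne.symm hz]
      · exact fun h => absurd hy h
    simp_rw [this]
    rw [lazyP_zero]; simp
    split_ifs
    · field_simp
    · simp
  | 1, Z, y, y', h => by
    have hd' : (0:ℝ) < d := by exact_mod_cast hd
    have hy : y ∈ Z := h (mem_fbox.2 (by simp [dinf_self]))
    have hy2 : ∀ i, y - unitV d i ∈ Z := fun i => h (mem_fbox.2 (dinf_unit_sub _ _))
    have : ∀ i : Fin d, ∑ z ∈ Z, wgt d 1 i z y * wgt d 1 i z y' =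
        (2 * (if y = y' then 1 else 0) + (if y + unitV d i = y' then 1 else 0) +
          (if y - unitV d i = y' then 1 else 0)) / (8 * d) := by
      intro i
      have e : ∀ z, wgt d 1 i z y * wgt d 1 i z y' =
        ((if z = y then ((if y' = y then 1 else 0) + (if y' = y + unitV d i then 1 else 0)) else 0) +
        (if z = y - unitV d i then ((if y' = y - unitV d i then 1 else 0) + (if y' = y then 1 else 0)) else 0)) / (8 * d) := by
        intro z
        simp only [wgt]
        rw [div_mul_div_comm, ← pow_two (Real.sqrt _), Real.sq_sqrt (by positivity)]
        congr 1
        by_cases h1 : z = y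
        · subst h1
          have : z ≠ z - unitV d i := by
            intro hh; have := congrFun hh i; simp [unitV] at this; omega
          have h3 : z ≠ z + unitV d i := by
            intro hh; have := congrFun hh i; simp [unitV] at this
          simp [this, h3]
        · by_cases h2 : z = y - unitV d i
          · subst h2
            have h3 : y ≠ y - unitV d i := by
              intro hh; have := congrFun hh i; simp [unitV] at this; omega
            simp [h3, Ne.symm h3]
          · have h3 : y ≠ z + unitV d i := by rintro rfl; simp at h2
            simp [h1, h2, h3, Ne.symm h1]
      simp_rw [e]
      rw [← Finset.sum_div, Finset.sum_add_distrib, Finset.sum_ite_eq' Z y, Finset.sum_ite_eq' Z,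
        if_pos hy, if_pos (hy2 i)]
      simp_rw [eq_comm (a := y')]
      ring
    simp_rw [this]
    rw [lazyP_succ]; simp only [lazyP_zero]
    rw [← Finset.sum_div]
    simp_rw [add_assoc]
    rw [Finset.sum_add_distrib]
    simp only [Finset.sum_const, Finset.card_univ, Fintype.card_fin, nsmul_eq_mul]
    field_simp
    ring
  | (k + 2), Z, y, y', h => by
    have ih : ∀ w, dinf y w ≤ 1 → ∀ w', ∑ i, ∑ z ∈ Z, wgt d k i z w * wgt d k i z w' = (1/2) * lazyP d k w w' := by
      intro w hw w'
      refine wgt_cov d hd k Z w w' fun v hv => h ?_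
      rw [mem_fbox] at *
      have := dinf_tri y w v
      omega
    have step : ∀ w, dinf y w ≤ 1 → ∑ i, ∑ z ∈ Z, wgt d k i z w * wgt d (k+2) i z y' = (1/2) * lazyP d (k+1) w y' := by
      intro w hw
      rw [lazyP_succ']
      have e : ∀ i z, wgt d k i z w * wgt d (k+2) i z y' = (1/2) * (wgt d k i z w * wgt d k i z y') +
        (1 / (4 * d)) * ∑ m : Fin d, (wgt d k i z w * wgt d k i z (y' + unitV d m) + wgt d k i z w * wgt d k i z (y' - unitV d m)) := by
        intro i z; rw [wgt]; simp_rw [← mul_add]; rw [← Finset.mul_sum]; ring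
      simp_rw [e, sum_swap3, ih w hw, ← mul_add, ← Finset.mul_sum]
      ring
    rw [lazyP_succ]
    have e : ∀ i z, wgt d (k+2) i z y * wgt d (k+2) i z y' = (1/2) * (wgt d k i z y * wgt d (k+2) i z y') +
        (1 / (4 * d)) * ∑ m : Fin d, (wgt d k i z (y + unitV d m) * wgt d (k+2) i z y' + wgt d k i z (y - unitV d m) * wgt d (k+2) i z y') := by
        intro i z; conv_lhs => rw [wgt]
        simp_rw [← add_mul]; rw [← Finset.sum_mul]; ring
    simp_rw [e, sum_swap3, step y (by simp [dinf_self]), step _ (dinf_unit_add y _), step _ (dinf_unit_sub y _), ← mul_add, ← Finset.mul_sum]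
    ring
end

section
/-- open set of a finite configuration -/
def opn {d : ℕ} (T : Finset (V d)) (h : ℝ) (x : T → ℝ) : Set (V d) := {y | ∃ hy : y ∈ T, h ≤ x ⟨y, hy⟩}

lemma opn_mono {d : ℕ} {T : Finset (V d)} {h : ℝ} {x x' : T → ℝ} (hx : x ≤ x') : opn T h x ⊆ opn T h x' := by
  rintro y ⟨hy, h'⟩; exact ⟨hy, h'.trans (hx _)⟩

lemma meas_opn {d : ℕ} (T : Finset (V d)) (h : ℝ) (Q : Set (V d) → Prop) : MeasurableSet {x : T → ℝ | Q (opn T h x)} := by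
  have hm : Measurable (fun (x : T → ℝ) (y : T) => h ≤ x y) := by
    refine measurable_pi_iff.2 fun y => ?_
    exact measurableSet_setOf.1 (measurableSet_le measurable_const (measurable_pi_apply y))
  have hs : MeasurableSet {s : T → Prop | Q {y | ∃ hy : y ∈ T, s ⟨y, hy⟩}} := (Set.toFinite _).measurableSet
  exact hm hs

lemma gauss_Icc (m : ℝ) (v : NNReal) (hv : 1/2 ≤ (v:ℝ)) (a b : ℝ) :
    gaussianReal m v (Icc a b) ≤ ENNReal.ofReal (b - a) := by
  have hv0 : v ≠ 0 := by rintro rfl; norm_num at hv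
  rw [gaussianReal_apply m hv0]
  calc ∫⁻ x in Icc a b, gaussianPDF m v x ≤ ∫⁻ x in Icc a b, 1 := by
        refine lintegral_mono fun x => ?_
        rw [gaussianPDF, ENNReal.ofReal_le_one, gaussianPDFReal]
        have h1 : Real.exp (-(x - m) ^ 2 / (2 * v)) ≤ 1 := by
          rw [Real.exp_le_one_iff]
          exact div_nonpos_of_nonpos_of_nonneg (by nlinarith [sq_nonneg (x-m)]) (by positivity)
        have h2 : (Real.sqrt (2 * Real.pi * v))⁻¹ ≤ 1 := by
          apply inv_le_one_of_one_le₀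
          rw [Real.one_le_sqrt]
          nlinarith [Real.pi_gt_three]
        exact mul_le_one₀ h2 (Real.exp_nonneg _) h1
    _ = ENNReal.ofReal (b - a) := by simp

lemma GF.anti {Ω ι : Type*} [MeasurableSpace Ω] {P : Measure Ω} [IsProbabilityMeasure P] {X : ι → Ω → ℝ} (hX : GF P X) (i : ι)
    (hv : 1/2 ≤ Var[X i; P]) (a b : ℝ) (hab : a ≤ b) : P.real {ω | a ≤ X i ω ∧ X i ω ≤ b} ≤ b - a := by
  have h1 := gauss_Icc 0 (Var[X i; P]).toNNReal (by rw [Real.coe_toNNReal']; exact le_max_of_le_left hv) a b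
  rw [← hX.map_eval i, Measure.map_apply (hX.meas i) measurableSet_Icc] at h1
  exact ENNReal.toReal_le_of_le_ofReal (by linarith) h1

/-- noise index -/
abbrev NI (d L : ℕ) (Z : Finset (V d)) := Fin (L + 1) × Fin d × Z

def aW {d L : ℕ} (α : ℕ → ℝ) (Z : Finset (V d)) (j : NI d L Z) (y : V d) : ℝ := α j.1 * wgt d j.1 j.2.1 j.2.2 y

lemma aW_nonneg {d L : ℕ} {α : ℕ → ℝ} (ha : Adm α) (Z : Finset (V d)) (j : NI d L Z) (y : V d) : 0 ≤ aW α Z j y :=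
  mul_nonneg (ha.nn _) (wgt_nonneg _ _ _ _ _)

lemma aW_cov {d L : ℕ} (hd : 0 < d) (α : ℕ → ℝ) (Z : Finset (V d)) {y : V d} (hy : fbox d y L ⊆ Z) (y' : V d) :
    ∑ j : NI d L Z, aW α Z j y * aW α Z j y' = Kf d L α y y' := by
  rw [Fintype.sum_prod_type, Kf, ← Fin.sum_univ_eq_sum_range (fun ℓ => (α ℓ) ^ 2 * ((1/2) * lazyP d ℓ y y'))]
  refine Finset.sum_congr rfl fun ℓ _ => ?_
  rw [← wgt_cov d hd ℓ Z y y', Fintype.sum_prod_type, Finset.mul_sum]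
  · refine Finset.sum_congr rfl fun i _ => ?_
    rw [Finset.univ_eq_attach, Finset.mul_sum, ← Finset.sum_attach Z]
    refine Finset.sum_congr rfl fun z _ => ?_
    simp only [aW]; ring
  · refine fun v hv => hy ?_
    rw [mem_fbox] at *
    have := ℓ.2
    omega

section split
variable {d L : ℕ} {α : ℕ → ℝ} {Ω : Type*} [MeasurableSpace Ω] {P : Measure Ω} [IsProbabilityMeasure P] {ξ : ℕ → V d → Ω → ℝ}

/-- inner / outer weights around `x` at scale `M` -/
def aI {d L : ℕ} (α : ℕ → ℝ) (Z : Finset (V d)) (x : V d) (M : ℕ) (j : NI d L Z) (y : V d) : ℝ :=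
  if dinf x j.2.2 ≤ M then aW α Z j y else 0
def aO {d L : ℕ} (α : ℕ → ℝ) (Z : Finset (V d)) (x : V d) (M : ℕ) (j : NI d L Z) (y : V d) : ℝ :=
  if dinf x j.2.2 ≤ M then 0 else aW α Z j y

lemma aI_nonneg (ha : Adm α) (Z : Finset (V d)) (x : V d) (M : ℕ) (j : NI d L Z) (y : V d) : 0 ≤ aI α Z x M j y := by
  unfold aI; split_ifs; · exact aW_nonneg ha _ _ _
  · exact le_rfl

lemma aI_far (Z : Finset (V d)) (x : V d) (M : ℕ) (j : NI d L Z) (y : V d) (h : M + L < dinf x y) : aI α Z x M j y = 0 := by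
  unfold aI; split_ifs with h1
  · rw [aW, wgt_range, mul_zero]
    have := dinf_tri x j.2.2 y
    have := j.1.2
    omega
  · rfl

lemma aO_near (Z : Finset (V d)) (x : V d) (M : ℕ) (j : NI d L Z) (y : V d) (h : dinf x y + L ≤ M) : aO α Z x M j y = 0 := by
  unfold aO; split_ifs with h1
  · rfl
  · rw [aW, wgt_range, mul_zero]
    have := dinf_tri x y j.2.2
    have := j.1.2
    rw [dinf_comm]
    omega

lemma aIO_cov (hd : 0 < d) (Z : Finset (V d)) (x : V d) (M : ℕ) {y : V d} (hy : fbox d y L ⊆ Z) (y' : V d) :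
    ∑ j : NI d L Z, aO α Z x M j y * aO α Z x M j y' + ∑ j : NI d L Z, aI α Z x M j y * aI α Z x M j y' = Kf d L α y y' := by
  rw [← aW_cov hd α Z hy, ← Finset.sum_add_distrib]
  refine Finset.sum_congr rfl fun j _ => ?_
  unfold aI aO; split_ifs <;> ring

/-- restriction of chi to a finite set -/
def chiT (L : ℕ) (α : ℕ → ℝ) (T : Finset (V d)) (c : Cfg d) : T → ℝ := fun y => gchi L α c y

lemma chiT_meas (hξ : IsXiFamily d P ξ) (T : Finset (V d)) : Measurable (fun ω => chiT L α T (cfg ξ ω)) :=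
  measurable_pi_iff.2 fun y => (gf_gchi hξ L α).meas y

lemma law_split (hd : 0 < d) (hξ : IsXiFamily d P ξ) (T Z : Finset (V d)) (hZ : ∀ y ∈ T, fbox d y L ⊆ Z) (x : V d) (M : ℕ) :
    P.map (fun ω => chiT L α T (cfg ξ ω)) = ((wnM (NI d L Z)).prod (wnM (NI d L Z))).map
      (fun g (y : T) => wnF (aO α Z x M) y.1 g.1 + wnF (aI α Z x M) y.1 g.2) := by
  have g1 := (wnF_gf (aO (L := L) α Z x M)).comp (fun y : T => y.1)
  have g2 := (wnF_gf (aI (L := L) α Z x M)).comp (fun y : T => y.1)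
  refine GF.law_eq ((gf_gchi hξ L α).comp (fun y : T => y.1)) (g1.add_prod g2) fun i j => ?_
  have := cov_add_prod g1 g2 i j
  rw [this]; simp only [chiT]
  rw [cov_gchi' hξ, wnF_cov, wnF_cov, aIO_cov hd Z x M (hZ _ i.2)]

lemma law_wn (hd : 0 < d) (hξ : IsXiFamily d P ξ) (T Z : Finset (V d)) (hZ : ∀ y ∈ T, fbox d y L ⊆ Z) :
    P.map (fun ω => chiT L α T (cfg ξ ω)) = (wnM (NI d L Z)).map (fun g (y : T) => wnF (aW α Z) y.1 g) := by
  have g1 := (wnF_gf (aW (L := L) α Z)).comp (fun y : T => y.1)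
  refine GF.law_eq ((gf_gchi hξ L α).comp (fun y : T => y.1)) g1 fun i j => ?_
  simp only [chiT]
  rw [cov_gchi' hξ, wnF_cov, aW_cov hd α Z (hZ _ i.2)]

lemma exists_Z (T : Finset (V d)) (L : ℕ) : ∃ Z : Finset (V d), ∀ y ∈ T, fbox d y L ⊆ Z := by
  classical
  exact ⟨T.biUnion fun y => fbox d y L, fun y hy => Finset.subset_biUnion_of_mem (fun y => fbox d y L) hy⟩

lemma chiT_posAssoc (hd : 0 < d) (ha : Adm α) (hξ : IsXiFamily d P ξ) (T : Finset (V d)) : PosAssoc (P.map (fun ω => chiT L α T (cfg ξ ω))) := by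
  obtain ⟨Z, hZ⟩ := exists_Z T L
  rw [law_wn hd hξ T Z hZ]
  have : (fun (g : NI d L Z → ℝ) (y : T) => wnF (aW α Z) y.1 g) =
    fun g y => wnF (fun j (y : T) => aW α Z j y.1) y g := rfl
  rw [this]
  exact wnF_posAssoc (fun j y => aW_nonneg ha _ _ _)

/-- FKG for events of the level set inside a finite set -/
lemma fkg_chi (hd : 0 < d) (ha : Adm α) (hξ : IsXiFamily d P ξ) (T : Finset (V d)) (h : ℝ) (Q Q' : Set (V d) → Prop)
    (hQ : ∀ S S', S ⊆ S' → Q S → Q S') (hQ' : ∀ S S', S ⊆ S' → Q' S → Q' S') :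
    P.real {ω | Q (opn T h (chiT L α T (cfg ξ ω)))} * P.real {ω | Q' (opn T h (chiT L α T (cfg ξ ω)))} ≤
      P.real {ω | Q (opn T h (chiT L α T (cfg ξ ω))) ∧ Q' (opn T h (chiT L α T (cfg ξ ω)))} := by
  have hm := chiT_meas (L := L) (α := α) hξ T
  haveI := Measure.isProbabilityMeasure_map (μ := P) hm.aemeasurable
  have := (chiT_posAssoc (L := L) hd ha hξ T).sets (meas_opn T h Q) (meas_opn T h Q')
    (fun x x' hx hq => hQ _ _ (opn_mono hx) hq) (fun x x' hx hq => hQ' _ _ (opn_mono hx) hq)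
  rw [map_measureReal_apply hm (meas_opn T h Q), map_measureReal_apply hm (meas_opn T h Q'),
    map_measureReal_apply hm ((meas_opn T h Q).inter (meas_opn T h Q'))] at this
  exact this

end split
end

section
variable {d : ℕ} {S S' A A' B B' : Set (V d)}

lemma ConnIn.mono (hS : S ⊆ S') (hA : A ⊆ A') (hB : B ⊆ B') (h : ConnIn S A B) : ConnIn S' A' B' := by
  obtain ⟨n, γ, h0, hn, hs, ha⟩ := h
  exact ⟨n, γ, hA h0, hB hn, fun k hk => hS (hs k hk), ha⟩

lemma ConnIn.symm (h : ConnIn S A B) : ConnIn S B A := by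
  obtain ⟨n, γ, h0, hn, hs, ha⟩ := h
  refine ⟨n, fun k => γ (n - k), by simpa, by simpa, fun k hk => hs _ (by omega), fun k hk => ?_⟩
  have := ha (n - (k + 1)) (by omega)
  rw [show n - (k + 1) + 1 = n - k by omega] at this
  exact adj_comm this

lemma ConnIn.trans {p : V d} (h1 : ConnIn S A {p}) (h2 : ConnIn S {p} B) : ConnIn S A B := by
  obtain ⟨n, γ, h0, hn, hs, ha⟩ := h1
  obtain ⟨m, γ', h0', hm, hs', ha'⟩ := h2
  rw [mem_singleton_iff] at hn h0'
  refine ⟨n + m, fun k => if k ≤ n then γ k else γ' (k - n), by simpa, ?_, fun k hk => ?_, fun k hk => ?_⟩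
  · rcases Nat.eq_zero_or_pos m with rfl | h
    · simp only [add_zero, le_refl, if_true]; rw [hn, ← h0']; exact hm
    · simp only [if_neg (show ¬ n + m ≤ n by omega)]; simpa using hm
  · dsimp only; split_ifs with h
    · exact hs k h
    · exact hs' _ (by omega)
  · dsimp only; split_ifs with h1 h2 h2
    · exact ha k (by omega)
    · have : k = n := by omega
      subst this
      have := ha' 0 (by omega)
      rw [h0', ← hn] at this
      simpa using this
    · omega
    · have := ha' (k - n) (by omega)
      rwa [show k - n + 1 = k + 1 - n by omega] at this

lemma ConnIn.sub {n : ℕ} {γ : ℕ → V d} (hs : ∀ k, k ≤ n → γ k ∈ S) (ha : ∀ k, k < n → adj (γ k) (γ (k+1)))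
    {i j : ℕ} (hij : i ≤ j) (hj : j ≤ n) {S' : Set (V d)} (hS' : ∀ k, i ≤ k → k ≤ j → γ k ∈ S') : ConnIn S' {γ i} {γ j} :=
  ⟨j - i, fun k => γ (i + k), by simp, by simp [show i + (j - i) = j by omega], fun k hk => hS' _ (by omega) (by omega),
    fun k hk => ha (i + k) (by omega)⟩

lemma ConnIn.imp {p q : V d} (h : ConnIn S {p} {q}) (hp : p ∈ A) (hq : q ∈ B) : ConnIn S A B :=
  h.mono subset_rfl (by simpa using hp) (by simpa using hq)

lemma ConnIn.exists (h : ConnIn S A B) : ∃ p ∈ A, ∃ q ∈ B, ConnIn S {p} {q} := by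
  obtain ⟨n, γ, h0, hn, hs, ha⟩ := h
  exact ⟨_, h0, _, hn, n, γ, rfl, rfl, hs, ha⟩

lemma ConnIn.left {p : V d} (h : ConnIn S {p} B) : p ∈ S := by
  obtain ⟨n, γ, h0, hn, hs, ha⟩ := h
  rw [← mem_singleton_iff.1 h0]; exact hs 0 (by omega)

lemma ConnIn.right {p : V d} (h : ConnIn S A {p}) : p ∈ S := h.symm.left

lemma ConnIn.refl {p : V d} (h : p ∈ S) : ConnIn S {p} {p} := ⟨0, fun _ => p, rfl, rfl, fun _ _ => h, by simp⟩

lemma ConnIn.adj {p q : V d} (h : p ∈ S) (h' : q ∈ S) (ha : adj p q) : ConnIn S {p} {q} :=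
  ⟨1, fun k => if k = 0 then p else q, rfl, rfl, fun k _ => by dsimp only; split_ifs <;> assumption,
    fun k hk => by have : k = 0 := by omega
                   subst this; simpa using ha⟩

lemma ConnIn.map {f : V d → V d} (hf : ∀ x y, GFFperc.adj x y → GFFperc.adj (f x) (f y)) (h : ConnIn S A B) (hS : ∀ x ∈ S, f x ∈ S')
    (hA : ∀ x ∈ A, f x ∈ A') (hB : ∀ x ∈ B, f x ∈ B') : ConnIn S' A' B' := by
  obtain ⟨n, γ, h0, hn, hs, ha⟩ := h
  exact ⟨n, fun k => f (γ k), hA _ h0, hB _ hn, fun k hk => hS _ (hs k hk), fun k hk => hf _ _ (ha k hk)⟩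

/-- first exit from a box -/
lemma ConnIn.exit (x : V d) (n : ℕ) (h : ConnIn S A B) (hA : ∀ y ∈ A, dinf x y ≤ n) (hB : ∀ y ∈ B, n ≤ dinf x y) :
    ConnIn (S ∩ {y | dinf x y ≤ n}) A {y | dinf x y = n} := by
  classical
  obtain ⟨m, γ, h0, hm, hs, ha⟩ := h
  have hex : ∃ k, n ≤ dinf x (γ k) := ⟨m, hB _ hm⟩
  let k := Nat.find hex
  have hk : n ≤ dinf x (γ k) := Nat.find_spec hex
  have hlt : ∀ j < k, dinf x (γ j) < n := fun j hj => not_le.1 (Nat.find_min hex hj)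
  have hkm : k ≤ m := Nat.find_min' hex (hB _ hm)
  have hke : dinf x (γ k) = n := by
    rcases Nat.eq_zero_or_pos k with hz | hp
    · have := hA _ h0; rw [hz] at hk ⊢; omega
    · have h1 := ha (k - 1) (by omega)
      rw [show k - 1 + 1 = k by omega] at h1
      have h2 := adj_dinf h1
      have h3 := hlt (k-1) (by omega)
      have h4 := dinf_tri x (γ (k-1)) (γ k)
      omega
  refine ⟨k, γ, h0, hke, fun j hj => ⟨hs j (by omega), ?_⟩, fun j hj => ha j (by omega)⟩
  rcases Nat.lt_or_eq_of_le hj with h | h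
  · exact (hlt j h).le
  · subst h; exact hke.le

/-- connection event from `B_r` to `∂B_R` -/
def Crs (d r R : ℕ) (S : Set (V d)) : Prop := ConnIn S (box d r) (bdry d R)

lemma Crs.mono {r R : ℕ} (h : S ⊆ S') (hc : Crs d r R S) : Crs d r R S' := ConnIn.mono h subset_rfl subset_rfl hc

lemma Crs.trunc {r R : ℕ} (hd : 0 < d) (hrR : r ≤ R) (h : Crs d r R S) : Crs d r R (S ∩ {y | dinf 0 y ≤ R}) := by
  refine (ConnIn.exit 0 R h (fun y hy => ?_) (fun y hy => ?_)).mono subset_rfl subset_rfl fun y hy => ?_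
  · have := mem_box.1 hy; omega
  · exact ((mem_bdry hd).1 hy).ge
  · exact (mem_bdry hd).2 hy

lemma Crs.inter_iff {r R : ℕ} (hd : 0 < d) (hrR : r ≤ R) {T : Set (V d)} (hT : ∀ y, dinf 0 y ≤ R → y ∈ T) :
    Crs d r R (S ∩ T) ↔ Crs d r R S := by
  refine ⟨Crs.mono inter_subset_left, fun h => (h.trunc hd hrR).mono ?_⟩
  exact inter_subset_inter_right _ fun y hy => hT y hy

/-- pivotality -/
def PivS (d r R : ℕ) (y : V d) (S : Set (V d)) : Prop := Crs d r R (S ∪ {y}) ∧ ¬ Crs d r R (S \ {y})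

lemma PivS.dinf_le {r R : ℕ} (hd : 0 < d) (hrR : r ≤ R) {y : V d} (h : PivS d r R y S) : dinf 0 y ≤ R := by
  by_contra hc
  refine h.2 ((h.1.trunc hd hrR).mono ?_)
  rintro z ⟨hz | hz, hz'⟩
  · exact ⟨hz, fun e => hc (by rw [← mem_singleton_iff.1 e]; exact hz')⟩
  · exact absurd (by rw [← mem_singleton_iff.1 hz]; exact hz') hc

lemma PivS.inter_iff {r R : ℕ} (hd : 0 < d) (hrR : r ≤ R) {T : Set (V d)} (hT : ∀ y, dinf 0 y ≤ R → y ∈ T) {y : V d} :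
    PivS d r R y (S ∩ T) ↔ PivS d r R y S := by
  unfold PivS
  have e2 : (S ∩ T) \ {y} = (S \ {y}) ∩ T := by ext z; simp; tauto
  have e1 : Crs d r R (S ∩ T ∪ {y}) ↔ Crs d r R (S ∪ {y}) := by
    rw [← Crs.inter_iff (S := S ∩ T ∪ {y}) hd hrR hT, ← Crs.inter_iff (S := S ∪ {y}) hd hrR hT]
    have : (S ∩ T ∪ {y}) ∩ T = (S ∪ {y}) ∩ T := by ext z; simp; tauto
    rw [this]
  rw [e1, e2, Crs.inter_iff hd hrR hT]

/-- arms -/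
lemma arms {r R : ℕ} {X : Set (V d)} (h : Crs d r R (S ∪ X)) :
    Crs d r R S ∨ ∃ z₁ ∈ X, ∃ z₂ ∈ X, ConnIn (S ∪ {z₁}) (box d r) {z₁} ∧ ConnIn (S ∪ {z₂}) {z₂} (bdry d R) := by
  classical
  obtain ⟨n, γ, h0, hn, hs, ha⟩ := h
  by_cases hX : ∃ k, k ≤ n ∧ γ k ∈ X
  · right
    let i := Nat.find hX
    have hi : i ≤ n ∧ γ i ∈ X := Nat.find_spec hX
    have hmin : ∀ j < i, j ≤ n → γ j ∉ X := fun j hj hjn hx => Nat.find_min hX hj ⟨hjn, hx⟩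
    have hX2 : ∃ k, k ≤ n ∧ γ (n - k) ∈ X := ⟨n - i, by omega, by rw [show n - (n - i) = i by omega]; exact hi.2⟩
    let k := Nat.find hX2
    have hk : k ≤ n ∧ γ (n - k) ∈ X := Nat.find_spec hX2
    have hmin2 : ∀ j < k, j ≤ n → γ (n - j) ∉ X := fun j hj hjn hx => Nat.find_min hX2 hj ⟨hjn, hx⟩
    refine ⟨γ i, hi.2, γ (n - k), hk.2, ?_, ?_⟩
    · refine (ConnIn.sub hs ha (Nat.zero_le i) hi.1 (S' := S ∪ {γ i}) fun j _ hj => ?_).imp h0 rfl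
      rcases Nat.lt_or_eq_of_le hj with h | h
      · exact Or.inl ((hs j (by omega)).resolve_right (hmin j h (by omega)))
      · rw [h]; exact Or.inr rfl
    · refine (ConnIn.sub hs ha (Nat.sub_le n k) le_rfl (S' := S ∪ {γ (n - k)}) fun j hj1 hj => ?_).imp rfl hn
      rcases Nat.lt_or_eq_of_le hj1 with h | h
      · refine Or.inl ((hs j (by omega)).resolve_right ?_)
        have := hmin2 (n - j) (by omega) (by omega)
        rwa [show n - (n - j) = j by omega] at this
      · rw [← h]; exact Or.inr rfl
  · left
    push Not at hX
    exact ⟨n, γ, h0, hn, fun k hk => (hs k hk).resolve_right (hX k hk), ha⟩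

lemma arms_glue {r R : ℕ} {z₁ z₂ : V d} (h1 : ConnIn (S ∪ {z₁}) (box d r) {z₁}) (h2 : ConnIn (S ∪ {z₂}) {z₂} (bdry d R))
    (h3 : ConnIn S {z₁} {z₂}) : Crs d r R S := by
  have e1 : S ∪ {z₁} = S := by have := h3.left; ext z; simp; rintro rfl; exact this
  have e2 : S ∪ {z₂} = S := by have := h3.right; ext z; simp; rintro rfl; exact this
  rw [e1] at h1; rw [e2] at h2
  exact (h1.trans h3).trans h2

lemma block {r R n m : ℕ} (hd : 0 < d) {x : V d} (hR : r + 2 * n < R) (hm : m ≤ n) (hD : ¬ Crs d r R (S \ {y | dinf x y ≤ m}))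
    (hE : ¬ ConnIn (S ∩ {y | dinf x y ≤ n}) {y | dinf x y ≤ m} {y | dinf x y = n}) : ¬ Crs d r R S := by
  rintro ⟨N, γ, h0, hn, hs, ha⟩
  by_cases hX : ∃ k, k ≤ N ∧ dinf x (γ k) ≤ m
  · obtain ⟨k, hk, hkm⟩ := hX
    apply hE
    have e0 := mem_box.1 h0
    have e1 := (mem_bdry hd).1 hn
    have hcase : n < dinf x (γ 0) ∨ n < dinf x (γ N) := by
      by_contra hc
      push Not at hc
      have t1 := dinf_tri 0 (γ 0) (γ N)
      have t2 := dinf_tri (γ 0) x (γ N)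
      have t3 := dinf_comm (γ 0) x
      omega
    rcases hcase with hc | hc
    · have := (ConnIn.sub hs ha (Nat.zero_le k) hk (S' := S) fun j _ hj => hs j (by omega)).symm
      exact (this.exit x n (by simp; omega) (by simp; omega)).mono subset_rfl (by simpa using hkm) subset_rfl
    · have := (ConnIn.sub hs ha hk le_rfl (S' := S) fun j _ hj => hs j (by omega))
      exact (this.exit x n (by simp; omega) (by simp; omega)).mono subset_rfl (by simpa using hkm) subset_rfl
  · push Not at hX
    exact hD ⟨N, γ, h0, hn, fun k hk => ⟨hs k hk, by simpa using hX k hk⟩, ha⟩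
end

section
section up
variable {d L : ℕ} {α : ℕ → ℝ} {Ω : Type*} [MeasurableSpace Ω] {P : Measure Ω} [IsProbabilityMeasure P] {ξ : ℕ → V d → Ω → ℝ}

/-- conditioned field on `T` -/
def vhat (L : ℕ) (α : ℕ → ℝ) (T : Finset (V d)) (h : ℝ) (y : V d) (c : Cfg d) : T → ℝ :=
  fun z => gchi L α c z - Kf d L α z y / Kf d L α y y * (gchi L α c y - h)

/-- conditional pivotality probability -/
def qh (P : Measure Ω) (ξ : ℕ → V d → Ω → ℝ) (L : ℕ) (α : ℕ → ℝ) (T : Finset (V d)) (h : ℝ) (Q : Set (V d) → Prop) (y : V d) : ℝ :=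
  P.real {ω | Q (opn T h (vhat L α T h y (cfg ξ ω)) ∪ {y}) ∧ ¬ Q (opn T h (vhat L α T h y (cfg ξ ω)) \ {y})}

lemma up_indep (ha : Adm α) (hξ : IsXiFamily d P ξ) (T : Finset (V d)) (h : ℝ) (y : V d) {I : Set ℝ} (hI : MeasurableSet I)
    {G : Set (T → ℝ)} (hG : MeasurableSet G) :
    P.real {ω | gchi L α (cfg ξ ω) y ∈ I ∧ vhat L α T h y (cfg ξ ω) ∈ G} =
      P.real {ω | gchi L α (cfg ξ ω) y ∈ I} * P.real {ω | vhat L α T h y (cfg ξ ω) ∈ G} := by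
  classical
  have hK : 0 < Kf d L α y y := by have := Kf_diag (L := L) ha y; linarith
  let X : Unit → Ω → ℝ := fun _ ω => gchi L α (cfg ξ ω) y
  let Y : T → Ω → ℝ := fun z ω => gchi L α (cfg ξ ω) z - Kf d L α z y / Kf d L α y y * gchi L α (cfg ξ ω) y
  have hgf : GF P (Sum.elim X Y) := by
    have g := (gf_gchi hξ L α).comp (Sum.elim (fun _ : Unit => y) (fun z : T => z.1))
    refine g.lin (fun k => Sum.elim (fun _ => {Sum.inl ()}) (fun z => {Sum.inr z, Sum.inl ()}) k)
      (fun (k : Unit ⊕ T) j => Sum.elim (fun _ : Unit => (1:ℝ)) (fun z : T => Sum.elim (fun _ => - (Kf d L α z y / Kf d L α y y)) (fun _ => 1) j) k) ?_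
    rintro (u | z) ω
    · simp [X]
    · simp [Y]; ring
  have hc : ∀ i j, cov[X i, Y j; P] = 0 := by
    intro i j
    have m0 := (gf_gchi hξ L α).memLp y
    have m1 := (gf_gchi hξ L α).memLp j.1
    have := covariance_fun_sub_right m0 m1 (m0.const_mul (Kf d L α j y / Kf d L α y y))
    refine this.trans ?_
    rw [covariance_const_mul_right, cov_gchi' hξ, cov_gchi' hξ, Kf_symm y j]
    field_simp; ring
  have hind := hgf.indep hc
  have hm : Measurable (fun (v : T → ℝ) (z : T) => v z + Kf d L α z y / Kf d L α y y * h) := by fun_prop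
  have e : ∀ ω, vhat L α T h y (cfg ξ ω) = fun z => Y z ω + Kf d L α z y / Kf d L α y y * h := by
    intro ω; funext z; simp only [vhat, Y]; ring
  have hm2 : Measurable (fun (f : Unit → ℝ) => f ()) := measurable_pi_apply ()
  have := hind.measure_inter_preimage_eq_mul _ _ (hm2 hI) (hm hG)
  have r := congrArg ENNReal.toReal this
  rw [ENNReal.toReal_mul] at r
  simp_rw [e]
  exact r

lemma vhat_var (ha : Adm α) (hξ : IsXiFamily d P ξ) {y z : V d} (hyz : y ≠ z) (a b : ℝ) (hab : a ≤ b) (k : ℝ) :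
    P.real {ω | a ≤ gchi L α (cfg ξ ω) z - k * gchi L α (cfg ξ ω) y ∧ gchi L α (cfg ξ ω) z - k * gchi L α (cfg ξ ω) y ≤ b} ≤ b - a := by
  classical
  let Y : Unit → Ω → ℝ := fun _ ω => gchi L α (cfg ξ ω) z - k * gchi L α (cfg ξ ω) y
  have g : GF P Y := (gf_gchi hξ L α).lin (fun _ => {z, y}) (fun _ i => if i = z then 1 else -k) (by
    intro u ω; rw [Finset.sum_pair (Ne.symm hyz)]; simp [Y, hyz]; ring)
  have m0 := (gf_gchi hξ L α).memLp y
  have m1 := (gf_gchi hξ L α).memLp z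
  refine g.anti () ?_ a b hab
  have := Kf_nondeg (L := L) hξ ha hyz k
  refine this.trans (le_of_eq ?_)
  rw [← covariance_self (g.meas ()).aemeasurable]
  have e1 := covariance_fun_sub_left m1 (m0.const_mul k) (g.memLp ())
  have e2 := covariance_fun_sub_right m1 m1 (m0.const_mul k)
  have e3 := covariance_fun_sub_right m0 m1 (m0.const_mul k)
  rw [covariance_const_mul_right, cov_gchi' hξ, cov_gchi' hξ] at e2 e3
  rw [covariance_const_mul_left] at e1
  refine Eq.trans ?_ e1.symm
  refine Eq.trans ?_ (congrArg₂ (fun u v => u - k * v) e2.symm e3.symm)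
  rw [Kf_symm y z]; ring

lemma upcross (ha : Adm α) (hξ : IsXiFamily d P ξ) (T T' : Finset (V d)) (hT : T' ⊆ T) (h s : ℝ) (hs : 0 < s)
    (Q : Set (V d) → Prop) (hQ : ∀ S S', S ⊆ S' → Q S → Q S') :
    P.real {ω | ¬ Q (opn T h (chiT L α T (cfg ξ ω))) ∧
        Q (opn T h (fun y => chiT L α T (cfg ξ ω) y + (if y.1 ∈ T' then s else 0)))} ≤
      s * ∑ y ∈ T', qh P ξ L α T h Q y + s ^ 2 * (T'.card * (T.card * (2 * (1 + 2 * (L + 1))))) := by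
  classical
  set κ : ℝ := 1 + 2 * (L + 1) with hκ
  let I : V d → Set Ω := fun y => {ω | gchi L α (cfg ξ ω) y ∈ Icc (h - s) h}
  let Gp : V d → Set (T → ℝ) := fun y => {v | Q (opn T h v ∪ {y}) ∧ ¬ Q (opn T h v \ {y})}
  let Gz : T → Set (T → ℝ) := fun z => {v | v z ∈ Icc (h - κ * s) (h + κ * s)}
  have hGp : ∀ y, MeasurableSet (Gp y) := fun y => meas_opn T h (fun S => Q (S ∪ {y}) ∧ ¬ Q (S \ {y}))
  have hGz : ∀ z, MeasurableSet (Gz z) := fun z => (measurable_pi_apply z) measurableSet_Icc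
  have hsub : {ω | ¬ Q (opn T h (chiT L α T (cfg ξ ω))) ∧
        Q (opn T h (fun y => chiT L α T (cfg ξ ω) y + (if y.1 ∈ T' then s else 0)))} ⊆
      ⋃ y ∈ T', ({ω | gchi L α (cfg ξ ω) y ∈ Icc (h - s) h ∧ vhat L α T h y (cfg ξ ω) ∈ Gp y} ∪
        ⋃ z ∈ Finset.univ.filter (fun z : T => z.1 ≠ y), {ω | gchi L α (cfg ξ ω) y ∈ Icc (h - s) h ∧ vhat L α T h y (cfg ξ ω) ∈ Gz z}) := by
    rintro ω ⟨h1, h2⟩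
    set x := chiT L α T (cfg ξ ω) with hx
    set x' : T → ℝ := fun y => x y + (if y.1 ∈ T' then s else 0) with hx'
    have hex : ∃ y, y ∈ opn T h x' ∧ y ∉ opn T h x := by
      by_contra hc; push Not at hc
      exact h1 (hQ _ _ hc h2)
    obtain ⟨y, ⟨hyT, hy1⟩, hy2⟩ := hex
    have hy3 : x ⟨y, hyT⟩ < h := by by_contra hc; exact hy2 ⟨hyT, not_lt.1 hc⟩
    have hyT' : y ∈ T' := by
      by_contra hc; simp only [hx', hc, if_false, add_zero] at hy1; linarith
    simp only [hx', hyT', if_true] at hy1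
    have hyI : gchi L α (cfg ξ ω) y ∈ Icc (h - s) h := ⟨by change h - s ≤ x ⟨y, hyT⟩; linarith, hy3.le⟩
    refine mem_biUnion hyT' ?_
    by_cases hz : ∃ z : T, z.1 ≠ y ∧ vhat L α T h y (cfg ξ ω) ∈ Gz z
    · obtain ⟨z, hzy, hz⟩ := hz
      exact Or.inr (mem_biUnion (x := z) (by simpa using hzy) ⟨hyI, hz⟩)
    · left
      push Not at hz
      refine ⟨hyI, ?_⟩
      have hK := Kf_diag (L := L) ha y
      have key : ∀ z : T, z.1 ≠ y → ((h ≤ x z ↔ h ≤ vhat L α T h y (cfg ξ ω) z) ∧ (h ≤ x' z ↔ h ≤ vhat L α T h y (cfg ξ ω) z)) := by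
        intro z hzy
        have hz1 := hz z hzy
        have k0 : 0 ≤ Kf d L α z y / Kf d L α y y := div_nonneg (Kf_nonneg _ _) (by linarith)
        have k1 : Kf d L α z y / Kf d L α y y ≤ 2 * (L + 1) := by
          rw [div_le_iff₀ (by linarith)]
          have := Kf_le (L := L) ha z.1 y
          nlinarith
        have e : vhat L α T h y (cfg ξ ω) z = x z - Kf d L α z y / Kf d L α y y * (gchi L α (cfg ξ ω) y - h) := rfl
        set k := Kf d L α z y / Kf d L α y y
        have b1 : 0 ≤ k * (h - gchi L α (cfg ξ ω) y) := mul_nonneg k0 (by linarith [hyI.2])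
        have b2 : k * (h - gchi L α (cfg ξ ω) y) ≤ 2 * (L + 1) * s := mul_le_mul k1 (by linarith [hyI.1]) (by linarith [hyI.2]) (by positivity)
        have b3 : κ * s = s + 2 * (L + 1) * s := by rw [hκ]; ring
        have b4 : vhat L α T h y (cfg ξ ω) z < h - κ * s ∨ h + κ * s < vhat L α T h y (cfg ξ ω) z := by
          by_contra hc; push Not at hc; exact hz1 ⟨hc.1, hc.2⟩
        have b5 : x z ≤ x' z ∧ x' z ≤ x z + s := by simp only [hx']; split_ifs <;> constructor <;> linarith
        have b6 : 0 ≤ 2 * ((L:ℝ) + 1) * s := by positivity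
        rcases b4 with b4 | b4
        · constructor <;> constructor <;> intro <;> linarith [b5.1, b5.2]
        · constructor <;> constructor <;> intro <;> linarith [b5.1, b5.2]
      constructor
      · refine hQ _ _ ?_ h2
        rintro z ⟨hzT, hz'⟩
        by_cases hzy : z = y
        · exact Or.inr hzy
        · exact Or.inl ⟨hzT, (key ⟨z, hzT⟩ hzy).2.1 hz'⟩
      · refine fun hq => h1 (hQ _ _ ?_ hq)
        rintro z ⟨⟨hzT, hz'⟩, hzy⟩
        exact ⟨hzT, (key ⟨z, hzT⟩ hzy).1.2 hz'⟩
  have hI1 : ∀ y, P.real {ω | gchi L α (cfg ξ ω) y ∈ Icc (h - s) h} ≤ s := by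
    intro y
    have := (gf_gchi hξ L α).anti y (by rw [← covariance_self ((gf_gchi hξ L α).meas y).aemeasurable, cov_gchi' hξ]; exact Kf_diag ha y) (h - s) h (by linarith)
    simpa using this
  have hone : ∀ y ∈ T', P.real ({ω | gchi L α (cfg ξ ω) y ∈ Icc (h - s) h ∧ vhat L α T h y (cfg ξ ω) ∈ Gp y} ∪
        ⋃ z ∈ Finset.univ.filter (fun z : T => z.1 ≠ y), {ω | gchi L α (cfg ξ ω) y ∈ Icc (h - s) h ∧ vhat L α T h y (cfg ξ ω) ∈ Gz z}) ≤
        s * qh P ξ L α T h Q y + s ^ 2 * (T.card * (2 * κ)) := by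
    intro y _
    refine (measureReal_union_le _ _).trans (add_le_add ?_ ?_)
    · rw [up_indep ha hξ T h y measurableSet_Icc (hGp y)]
      exact mul_le_mul (hI1 y) le_rfl measureReal_nonneg hs.le
    · refine (measureReal_biUnion_finset_le _ _).trans ?_
      calc _ ≤ ∑ z ∈ Finset.univ.filter (fun z : T => z.1 ≠ y), s * (2 * κ * s) := by
            refine Finset.sum_le_sum fun z hz => ?_
            rw [up_indep ha hξ T h y measurableSet_Icc (hGz z)]
            refine mul_le_mul (hI1 y) ?_ measureReal_nonneg hs.le
            set k := Kf d L α z y / Kf d L α y y with hk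
            have hκ0 : 0 ≤ κ * s := by rw [hκ]; positivity
            have := vhat_var (L := L) ha hξ (y := y) (z := z.1) (by simpa using (Finset.mem_filter.1 hz).2.symm)
              (h - κ * s - k * h) (h + κ * s - k * h) (by linarith) k
            refine le_trans (le_of_eq ?_) (this.trans (by linarith))
            congr 1; ext ω
            simp only [Gz, mem_ofPred_eq, vhat, mem_Icc, ← hk]
            constructor <;> rintro ⟨a, b⟩ <;> constructor <;> linarith
        _ = ((Finset.univ.filter (fun z : T => z.1 ≠ y)).card : ℝ) * (s * (2 * κ * s)) := by rw [Finset.sum_const, nsmul_eq_mul]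
        _ ≤ (T.card : ℝ) * (s * (2 * κ * s)) := by
            refine mul_le_mul_of_nonneg_right ?_ (by rw [hκ]; positivity)
            have := Finset.card_filter_le (Finset.univ : Finset T) (fun z : T => z.1 ≠ y)
            rw [Finset.card_univ, Fintype.card_coe] at this
            exact_mod_cast this
        _ = _ := by ring
  calc _ ≤ _ := measureReal_mono hsub (measure_ne_top _ _)
    _ ≤ _ := measureReal_biUnion_finset_le _ _
    _ ≤ ∑ y ∈ T', (s * qh P ξ L α T h Q y + s ^ 2 * (T.card * (2 * κ))) := Finset.sum_le_sum hone
    _ = _ := by rw [Finset.sum_add_distrib, ← Finset.mul_sum, Finset.sum_const, nsmul_eq_mul]; ring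

end up
end

section
instance wn_gauss {J : Type*} [Fintype J] : IsGaussian (wnM J) := by
  have hi : iIndepFun (fun j (g : J → ℝ) => g j) (wnM J) :=
    iIndepFun_pi (X := fun _ x => x) (fun j => aemeasurable_id)
  have h := (hi.hasGaussianLaw (fun j => ⟨by rw [wn_law]; infer_instance⟩)).isGaussian_map
  have e : (fun (ω : J → ℝ) j => ω j) = id := rfl
  rw [e, Measure.map_id] at h
  exact h

lemma wn_rot {J : Type*} [Fintype J] (θ : ℝ) :
    MeasurePreserving (ContinuousLinearMap.rotation (E := J → ℝ) θ) ((wnM J).prod (wnM J)) ((wnM J).prod (wnM J)) := by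
  classical
  refine ⟨(ContinuousLinearMap.rotation (E := J → ℝ) θ).continuous.measurable, ?_⟩
  refine IsGaussian.map_rotation_eq_self_of_forall_strongDual_eq_zero (fun L => ?_) θ
  rw [integral_congr_ae (ae_of_all _ fun x => lin_dual L x)]
  rw [integral_finset_sum _ (fun i _ => (wn_gf.integrable i).const_mul _)]
  exact Finset.sum_eq_zero fun i _ => by rw [integral_const_mul, wn_gf.mean, mul_zero]

lemma prod_real {A B : Type*} [MeasurableSpace A] [MeasurableSpace B] (μ : Measure A) (ν : Measure B) [IsProbabilityMeasure μ]
    [IsProbabilityMeasure ν] {s : Set (A × B)} (hs : MeasurableSet s) :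
    (μ.prod ν).real s = ∫ a, ν.real (Prod.mk a ⁻¹' s) ∂μ := by
  rw [measureReal_def, Measure.prod_apply hs]
  exact (integral_toReal (measurable_measure_prodMk_left hs).aemeasurable (ae_of_all _ fun a => measure_lt_top _ _)).symm

lemma lim_aux {a b c : ℝ} (h : ∀ n : ℕ, 1 ≤ n → a ≤ b + c / n) : a ≤ b := by
  have ht : Tendsto (fun n : ℕ => b + c / n) atTop (nhds (b + 0)) :=
    tendsto_const_nhds.add (tendsto_const_div_atTop_nhds_zero_nat c)
  rw [add_zero] at ht
  exact ge_of_tendsto ht (eventually_atTop.2 ⟨1, fun n hn => h n hn⟩)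

section sens
variable {d L : ℕ} {α : ℕ → ℝ} {Ω : Type*} [MeasurableSpace Ω] {P : Measure Ω} [IsProbabilityMeasure P] {ξ : ℕ → V d → Ω → ℝ}

/-- split field -/
def XX (L : ℕ) (α : ℕ → ℝ) (T Z : Finset (V d)) (x : V d) (M : ℕ) (g g' : NI d L Z → ℝ) : T → ℝ :=
  fun y => wnF (aO α Z x M) y.1 g + wnF (aI α Z x M) y.1 g'

lemma wnF_meas {J ι : Type*} [Fintype J] (a : J → ι → ℝ) (y : ι) : Measurable (wnF a y) := (wnF_gf a).meas y

lemma XX_meas (T Z : Finset (V d)) (x : V d) (M : ℕ) :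
    Measurable (fun g : (NI d L Z → ℝ) × (NI d L Z → ℝ) => XX L α T Z x M g.1 g.2) :=
  measurable_pi_iff.2 fun y => ((wnF_meas _ _).comp measurable_fst).add ((wnF_meas _ _).comp measurable_snd)

lemma wnF_lin {J ι : Type*} [Fintype J] (a : J → ι → ℝ) (y : ι) (c c' : ℝ) (g g' : J → ℝ) :
    wnF a y (c • g + c' • g') = c * wnF a y g + c' * wnF a y g' := by
  simp only [wnF, Finset.mul_sum, ← Finset.sum_add_distrib]
  exact Finset.sum_congr rfl fun j _ => by simp; ring

lemma aI_var (hd : 0 < d) (ha : Adm α) (Z : Finset (V d)) (x : V d) (M : ℕ) {y : V d} (hy : fbox d y L ⊆ Z) :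
    Var[wnF (aI (L := L) α Z x M) y; wnM (NI d L Z)] ≤ L + 1 := by
  rw [← covariance_self (wnF_meas _ _).aemeasurable, wnF_cov]
  have h1 := aIO_cov (L := L) (α := α) hd Z x M hy y
  have h2 := Kf_le (L := L) ha y y
  have h3 : 0 ≤ ∑ j : NI d L Z, aO α Z x M j y * aO α Z x M j y := Finset.sum_nonneg fun j _ => mul_self_nonneg _
  linarith

lemma GF.sq_int {Ω ι : Type*} [MeasurableSpace Ω] {P : Measure Ω} [IsProbabilityMeasure P] {X : ι → Ω → ℝ} (hX : GF P X) (i : ι) :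
    Integrable (fun ω => X i ω ^ 2) P ∧ ∫ ω, X i ω ^ 2 ∂P = Var[X i; P] := by
  refine ⟨(hX.memLp i).integrable_sq, ?_⟩
  rw [variance_eq_integral (hX.meas i).aemeasurable, hX.mean i]; simp

end sens

section core
variable {J ι : Type} [Fintype J] [Fintype ι]

lemma core1 (F : (J → ℝ) → (J → ℝ) → ι → ℝ) (hF : Measurable (fun g : (J → ℝ) × (J → ℝ) => F g.1 g.2)) (A : Set (ι → ℝ)) (hA : MeasurableSet A) :
    ∫ g, (wnM J).real {g' | F g g' ∈ A} * (1 - (wnM J).real {g' | F g g' ∈ A}) ∂(wnM J) =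
      ((wnM J).prod ((wnM J).prod (wnM J))).real {g | F g.1 g.2.1 ∉ A ∧ F g.1 g.2.2 ∈ A} := by
  have hm : MeasurableSet {g : (J → ℝ) × ((J → ℝ) × (J → ℝ)) | F g.1 g.2.1 ∉ A ∧ F g.1 g.2.2 ∈ A} := by
    refine MeasurableSet.inter (MeasurableSet.compl ?_) ?_
    · exact (hF.comp (measurable_fst.prodMk (measurable_fst.comp measurable_snd))) hA
    · exact (hF.comp (measurable_fst.prodMk (measurable_snd.comp measurable_snd))) hA
  rw [prod_real _ _ hm]
  refine integral_congr_ae (ae_of_all _ fun g => ?_)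
  have hs : MeasurableSet {g' | F g g' ∈ A} := (hF.comp (measurable_const.prodMk measurable_id)) hA
  have : Prod.mk g ⁻¹' {g : (J → ℝ) × ((J → ℝ) × (J → ℝ)) | F g.1 g.2.1 ∉ A ∧ F g.1 g.2.2 ∈ A} = {g' | F g g' ∈ A}ᶜ ×ˢ {g' | F g g' ∈ A} := by
    ext ⟨a, b⟩; exact Iff.rfl
  dsimp only
  rw [this, measureReal_prod_prod, probReal_compl_eq_one_sub hs, mul_comm]

lemma core2 (F : (J → ℝ) → (J → ℝ) → ι → ℝ) (hF : Measurable (fun g : (J → ℝ) × (J → ℝ) => F g.1 g.2)) (A : Set (ι → ℝ)) (hA : MeasurableSet A)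
    (n : ℕ) (δ : ℝ) (hnδ : n * δ = Real.pi / 2) :
    ((wnM J).prod ((wnM J).prod (wnM J))).real {g | F g.1 g.2.1 ∉ A ∧ F g.1 g.2.2 ∈ A} ≤
    n * ((wnM J).prod ((wnM J).prod (wnM J))).real {g | F g.1 g.2.1 ∉ A ∧ F g.1 (Real.cos δ • g.2.1 + Real.sin δ • g.2.2) ∈ A} := by
  have hE2m : MeasurableSet {g : (J → ℝ) × ((J → ℝ) × (J → ℝ)) | F g.1 g.2.1 ∉ A ∧ F g.1 (Real.cos δ • g.2.1 + Real.sin δ • g.2.2) ∈ A} := by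
    refine MeasurableSet.inter (MeasurableSet.compl ?_) ?_
    · exact (hF.comp (measurable_fst.prodMk (measurable_fst.comp measurable_snd))) hA
    · refine (hF.comp (measurable_fst.prodMk (?_ : Measurable fun g : (J → ℝ) × ((J → ℝ) × (J → ℝ)) => Real.cos δ • g.2.1 + Real.sin δ • g.2.2))) hA
      fun_prop
  have hRt : ∀ θ, MeasurePreserving (Prod.map id (ContinuousLinearMap.rotation (E := J → ℝ) θ)) ((wnM J).prod ((wnM J).prod (wnM J))) ((wnM J).prod ((wnM J).prod (wnM J))) := fun θ =>
      (MeasurePreserving.id (wnM J)).prod (wn_rot θ)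
  have hsub : {g : (J → ℝ) × ((J → ℝ) × (J → ℝ)) | F g.1 g.2.1 ∉ A ∧ F g.1 g.2.2 ∈ A} ⊆ ⋃ k ∈ Finset.range n,
      (Prod.map id (ContinuousLinearMap.rotation (E := J → ℝ) (k * δ))) ⁻¹' {g : (J → ℝ) × ((J → ℝ) × (J → ℝ)) | F g.1 g.2.1 ∉ A ∧ F g.1 (Real.cos δ • g.2.1 + Real.sin δ • g.2.2) ∈ A} := by
      rintro ⟨g1, g2, g3⟩ ⟨h1, h2⟩
      let B : ℕ → Prop := fun k => F g1 (Real.cos (k * δ) • g2 + Real.sin (k * δ) • g3) ∈ A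
      have hB0 : ¬ B 0 := by simpa [B] using h1
      have hBn : B n := by simp only [B, hnδ, Real.cos_pi_div_two, Real.sin_pi_div_two]; simpa using h2
      obtain ⟨k, hk, hkB, hkB'⟩ : ∃ k < n, ¬ B k ∧ B (k+1) := by
        by_contra hc; push Not at hc
        have : ∀ k ≤ n, ¬ B k := by
          intro k; induction k with
          | zero => exact fun _ => hB0
          | succ k ih => exact fun hk => hc k (by omega) (ih (by omega))
        exact this n le_rfl hBn
      refine mem_biUnion (x := k) (Finset.mem_range.2 hk) ⟨hkB, ?_⟩
      simp only [Prod.map, ContinuousLinearMap.rotation_apply, id]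
      convert hkB' using 2
      push_cast
      rw [add_mul, one_mul, Real.cos_add, Real.sin_add]
      ext j; simp; ring
  refine (measureReal_mono hsub (measure_ne_top _ _)).trans ((measureReal_biUnion_finset_le _ _).trans (le_of_eq ?_))
  rw [Finset.sum_congr rfl (g := fun _ => ((wnM J).prod ((wnM J).prod (wnM J))).real {g | F g.1 g.2.1 ∉ A ∧ F g.1 (Real.cos δ • g.2.1 + Real.sin δ • g.2.2) ∈ A}), Finset.sum_const, Finset.card_range, nsmul_eq_mul]
  intro k _
  rw [measureReal_def, (hRt _).measure_preimage hE2m.nullMeasurableSet]; rfl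

/-- random shift size -/
def DD (v : ι → (J → ℝ) → ℝ) (g : J → ℝ) : ℝ := 1 + ∑ y, |v y g|

lemma DD_one (v : ι → (J → ℝ) → ℝ) (g : J → ℝ) : 1 ≤ DD v g := by
  have : 0 ≤ ∑ y, |v y g| := Finset.sum_nonneg fun y _ => abs_nonneg _
  simp only [DD]; linarith

lemma core3 (o v : ι → (J → ℝ) → ℝ) (hv : GF (wnM J) v) (ho : ∀ y, Measurable (o y)) (A : Set (ι → ℝ)) (hA : MeasurableSet A)
    (hAm : ∀ z z', z ≤ z' → z ∈ A → z' ∈ A) (hlin : ∀ y c c' g g', v y (c • g + c' • g') = c * v y g + c' * v y g')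
    (I : ι → Prop) [DecidablePred I] (hI : ∀ y, ¬ I y → ∀ g, v y g = 0) (δ : ℝ) (hδ0 : 0 < δ) :
    ((wnM J).prod ((wnM J).prod (wnM J))).real {g | (fun y => o y g.1 + v y g.2.1) ∉ A ∧ (fun y => o y g.1 + v y (Real.cos δ • g.2.1 + Real.sin δ • g.2.2)) ∈ A} ≤
    ((((wnM J).prod (wnM J)).prod (wnM J)).real (⋃ y : ι, {g | 2 / δ ≤ |v y g.1.2|})) +
     ((((wnM J).prod (wnM J)).prod (wnM J)).real {g | (fun y => o y g.1.1 + v y g.1.2) ∉ A ∧ (fun y => o y g.1.1 + v y g.1.2 + (if I y then δ * DD v g.2 else 0)) ∈ A}) := by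
  have hvm := hv.meas
  have hE2m : MeasurableSet {g : (J → ℝ) × ((J → ℝ) × (J → ℝ)) | (fun y => o y g.1 + v y g.2.1) ∉ A ∧ (fun y => o y g.1 + v y (Real.cos δ • g.2.1 + Real.sin δ • g.2.2)) ∈ A} := by
    refine MeasurableSet.inter (MeasurableSet.compl ?_) ?_
    · exact (measurable_pi_iff.2 fun y => ((ho y).comp measurable_fst).add ((hvm y).comp (measurable_fst.comp measurable_snd)) : Measurable fun g : (J → ℝ) × ((J → ℝ) × (J → ℝ)) => fun y => o y g.1 + v y g.2.1) hA
    · refine (measurable_pi_iff.2 fun y => ((ho y).comp measurable_fst).add ((hvm y).comp ?_) : Measurable fun g : (J → ℝ) × ((J → ℝ) × (J → ℝ)) => fun y => o y g.1 + v y (Real.cos δ • g.2.1 + Real.sin δ • g.2.2)) hA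
      fun_prop
  have hpa := measurePreserving_prodAssoc (wnM J) (wnM J) (wnM J)
  rw [measureReal_def, ← hpa.measure_preimage hE2m.nullMeasurableSet, ← measureReal_def]
  refine (measureReal_mono ?_ (measure_ne_top _ _)).trans (measureReal_union_le _ _)
  rintro ⟨⟨g1, g2⟩, g3⟩ ⟨h1, h2⟩
  change (fun y => o y g1 + v y g2) ∉ A at h1
  change (fun y => o y g1 + v y (Real.cos δ • g2 + Real.sin δ • g3)) ∈ A at h2
  by_cases hb : ∃ y, 2 / δ ≤ |v y g2|
  · exact Or.inl (mem_iUnion.2 hb)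
  · right
    push Not at hb
    refine ⟨h1, hAm _ _ ?_ h2⟩
    intro y
    simp only [hlin]
    split_ifs with hy
    · have c1 := Real.one_sub_sq_div_two_le_cos (x := δ)
      have c2 := Real.cos_le_one δ
      have c4 : |Real.sin δ| ≤ δ := by
        have := @Real.abs_sin_le_abs δ
        rwa [abs_of_pos hδ0] at this
      have d1 : Real.sin δ * v y g3 ≤ δ * |v y g3| := by
        calc _ ≤ |Real.sin δ * v y g3| := le_abs_self _
          _ = |Real.sin δ| * |v y g3| := abs_mul _ _
          _ ≤ _ := mul_le_mul_of_nonneg_right c4 (abs_nonneg _)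
      have d2 : (Real.cos δ - 1) * v y g2 ≤ δ := by
        calc (Real.cos δ - 1) * v y g2 = (1 - Real.cos δ) * (- v y g2) := by ring
          _ ≤ (1 - Real.cos δ) * |v y g2| := mul_le_mul_of_nonneg_left (neg_le_abs _) (by linarith)
          _ ≤ (δ ^ 2 / 2) * (2 / δ) := mul_le_mul (by linarith) (hb y).le (abs_nonneg _) (by positivity)
          _ = δ := by field_simp
      have d3 : δ * |v y g3| ≤ δ * ∑ y, |v y g3| :=
        mul_le_mul_of_nonneg_left (Finset.single_le_sum (f := fun y => |v y g3|) (fun _ _ => abs_nonneg _) (Finset.mem_univ y)) hδ0.le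
      simp only [DD]
      nlinarith
    · rw [hI y hy, hI y hy]; simp

lemma core4 (v : ι → (J → ℝ) → ℝ) (hv : GF (wnM J) v) (δ : ℝ) (hδ0 : 0 < δ) :
    ((((wnM J).prod (wnM J)).prod (wnM J)).real (⋃ y : ι, {g | 2 / δ ≤ |v y g.1.2|})) ≤ δ ^ 2 * ∑ y, Var[v y; wnM J] / 4 := by
  have : (⋃ y : ι, {g : ((J → ℝ) × (J → ℝ)) × (J → ℝ) | 2 / δ ≤ |v y g.1.2|}) = ⋃ y ∈ (Finset.univ : Finset ι), {g | 2 / δ ≤ |v y g.1.2|} := by simp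
  rw [this]
  refine (measureReal_biUnion_finset_le _ _).trans ?_
  rw [Finset.mul_sum]
  refine Finset.sum_le_sum fun y _ => ?_
  have h1 := meas_ge_le_variance_div_sq (hv.memLp y) (c := 2 / δ) (by positivity)
  rw [hv.mean y] at h1
  simp only [sub_zero] at h1
  have h2 : (((wnM J).prod (wnM J)).prod (wnM J)) {g | 2 / δ ≤ |v y g.1.2|} = (wnM J) {g | 2 / δ ≤ |v y g|} := by
    have hms : MeasurableSet {g | 2 / δ ≤ |v y g|} := measurableSet_le measurable_const (hv.meas y).abs
    have hp : MeasurePreserving (fun g : ((J → ℝ) × (J → ℝ)) × (J → ℝ) => g.1.2) (((wnM J).prod (wnM J)).prod (wnM J)) (wnM J) :=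
      (measurePreserving_snd (μ := (wnM J)) (ν := (wnM J))).comp (measurePreserving_fst (μ := (wnM J).prod (wnM J)) (ν := (wnM J)))
    exact hp.measure_preimage hms.nullMeasurableSet
  rw [measureReal_def, h2]
  refine ENNReal.toReal_le_of_le_ofReal (by have := variance_nonneg (v y) (wnM J); positivity) (h1.trans (ENNReal.ofReal_le_ofReal (le_of_eq ?_)))
  field_simp; ring

lemma DD_memLp (v : ι → (J → ℝ) → ℝ) (hv : GF (wnM J) v) : MemLp (DD v) 2 (wnM J) := by
  have h1 : MemLp (fun g => ∑ y, |v y g|) 2 (wnM J) := memLp_finset_sum _ fun y _ => (hv.memLp y).abs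
  have h2 : MemLp (fun _ : J → ℝ => (1:ℝ)) 2 (wnM J) := memLp_const 1
  exact h2.add h1

lemma core5 (o v : ι → (J → ℝ) → ℝ) (hv : GF (wnM J) v) (ho : ∀ y, Measurable (o y)) (A : Set (ι → ℝ)) (hA : MeasurableSet A)
    (I : ι → Prop) [DecidablePred I] (Sq C2 : ℝ) (δ : ℝ) (hδ0 : 0 < δ)
    (hup : ∀ s, 0 < s → ((wnM J).prod (wnM J)).real {p | (fun y => o y p.1 + v y p.2) ∉ A ∧ (fun y => o y p.1 + v y p.2 + (if I y then s else 0)) ∈ A} ≤ s * Sq + s ^ 2 * C2) :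
    Integrable (fun g => DD v g ^ 2) (wnM J) ∧ 
     ((((wnM J).prod (wnM J)).prod (wnM J)).real {g | (fun y => o y g.1.1 + v y g.1.2) ∉ A ∧ (fun y => o y g.1.1 + v y g.1.2 + (if I y then δ * DD v g.2 else 0)) ∈ A}) ≤
      δ * Sq * ∫ g, DD v g ∂(wnM J) + δ ^ 2 * C2 * ∫ g, DD v g ^ 2 ∂(wnM J) := by
  have hDm : Measurable (DD v) := measurable_const.add (Finset.measurable_sum _ fun y _ => (hv.meas y).abs)
  have hDL : MemLp (DD v) 2 (wnM J) := DD_memLp v hv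
  have hDi : Integrable (DD v) (wnM J) := hDL.integrable (by norm_num)
  have hD2i : Integrable (fun g => DD v g ^ 2) (wnM J) := hDL.integrable_sq
  refine ⟨hD2i, ?_⟩
  have hm1 : Measurable fun g : ((J → ℝ) × (J → ℝ)) × (J → ℝ) => fun y => o y g.1.1 + v y g.1.2 :=
    measurable_pi_iff.2 fun y => ((ho y).comp (measurable_fst.comp measurable_fst)).add ((hv.meas y).comp (measurable_snd.comp measurable_fst))
  have hE3m : MeasurableSet {g : ((J → ℝ) × (J → ℝ)) × (J → ℝ) | (fun y => o y g.1.1 + v y g.1.2) ∉ A ∧ (fun y => o y g.1.1 + v y g.1.2 + (if I y then δ * DD v g.2 else 0)) ∈ A} := by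
      refine MeasurableSet.inter (MeasurableSet.compl ?_) ?_
      · exact hm1 hA
      · refine (?_ : Measurable fun g : ((J → ℝ) × (J → ℝ)) × (J → ℝ) => fun y => o y g.1.1 + v y g.1.2 + (if I y then δ * DD v g.2 else 0)) hA
        refine measurable_pi_iff.2 fun y => ?_
        refine ((measurable_pi_apply y).comp hm1).add ?_
        split_ifs
        · exact (hDm.comp measurable_snd).const_mul _
        · exact measurable_const
  have hsw : MeasurePreserving Prod.swap ((wnM J).prod ((wnM J).prod (wnM J))) (((wnM J).prod (wnM J)).prod (wnM J)) := Measure.measurePreserving_swap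
  rw [measureReal_def, ← hsw.measure_preimage hE3m.nullMeasurableSet, ← measureReal_def, prod_real _ _ (hsw.measurable hE3m),
    ← integral_const_mul, ← integral_const_mul, ← integral_add (hDi.const_mul _) (hD2i.const_mul _)]
  refine integral_mono_of_nonneg (ae_of_all _ fun g => measureReal_nonneg) ((hDi.const_mul _).add (hD2i.const_mul _)) (ae_of_all _ fun g => ?_)
  dsimp only
  have hs0 : 0 < δ * DD v g := mul_pos hδ0 (by linarith [DD_one v g])
  have es : Prod.mk g ⁻¹' (Prod.swap ⁻¹' {g : ((J → ℝ) × (J → ℝ)) × (J → ℝ) | (fun y => o y g.1.1 + v y g.1.2) ∉ A ∧ (fun y => o y g.1.1 + v y g.1.2 + (if I y then δ * DD v g.2 else 0)) ∈ A}) =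
      {p | (fun y => o y p.1 + v y p.2) ∉ A ∧ (fun y => o y p.1 + v y p.2 + (if I y then δ * DD v g else 0)) ∈ A} := by
    ext p; exact Iff.rfl
  rw [es]
  have := hup _ hs0
  linarith [this]

lemma core (o v : ι → (J → ℝ) → ℝ) (hv : GF (wnM J) v) (ho : ∀ y, Measurable (o y)) (A : Set (ι → ℝ)) (hA : MeasurableSet A)
    (hAm : ∀ z z', z ≤ z' → z ∈ A → z' ∈ A) (hlin : ∀ y c c' g g', v y (c • g + c' • g') = c * v y g + c' * v y g')
    (I : ι → Prop) [DecidablePred I] (hI : ∀ y, ¬ I y → ∀ g, v y g = 0) (Sq C2 W : ℝ) (hSq : 0 ≤ Sq) (hC2 : 0 ≤ C2)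
    (hED : ∫ g, DD v g ∂(wnM J) ≤ W)
    (hup : ∀ s, 0 < s → ((wnM J).prod (wnM J)).real {p | (fun y => o y p.1 + v y p.2) ∉ A ∧ (fun y => o y p.1 + v y p.2 + (if I y then s else 0)) ∈ A} ≤ s * Sq + s ^ 2 * C2) :
    ∫ g, (wnM J).real {g' | (fun y => o y g + v y g') ∈ A} * (1 - (wnM J).real {g' | (fun y => o y g + v y g') ∈ A}) ∂(wnM J) ≤ 2 * W * Sq := by
  have hF : Measurable (fun g : (J → ℝ) × (J → ℝ) => fun y => o y g.1 + v y g.2) :=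
    measurable_pi_iff.2 fun y => ((ho y).comp measurable_fst).add ((hv.meas y).comp measurable_snd)
  rw [core1 (fun g g' y => o y g + v y g') hF A hA]
  refine lim_aux (c := 4 * (∑ y, Var[v y; wnM J] / 4 + C2 * ∫ g, DD v g ^ 2 ∂(wnM J))) fun n hn => ?_
  have hn' : (0:ℝ) < n := by exact_mod_cast hn
  obtain ⟨δ, hδ⟩ : ∃ δ : ℝ, δ = Real.pi / (2 * n) := ⟨_, rfl⟩
  have hδ0 : 0 < δ := by rw [hδ]; have := Real.pi_pos; positivity
  have hnδ : n * δ = Real.pi / 2 := by rw [hδ]; field_simp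
  have s1 := core2 (fun g g' y => o y g + v y g') hF A hA n δ hnδ
  have s2 := core3 o v hv ho A hA hAm hlin I hI δ hδ0
  have s3 := core4 v hv δ hδ0
  have s4 := (core5 o v hv ho A hA I Sq C2 δ hδ0 hup).2
  have hI2 : 0 ≤ ∫ g, DD v g ^ 2 ∂(wnM J) := integral_nonneg fun g => sq_nonneg _
  have hC10 : 0 ≤ ∑ y, Var[v y; wnM J] / 4 := Finset.sum_nonneg fun y _ => by have := variance_nonneg (v y) (wnM J); positivity
  have hW : 0 ≤ W := le_trans (integral_nonneg fun g => zero_le_one.trans (DD_one v g)) hED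
  have t1 : δ * Sq * ∫ g, DD v g ∂(wnM J) ≤ δ * Sq * W := mul_le_mul_of_nonneg_left hED (by positivity)
  generalize (∫ g, DD v g ^ 2 ∂(wnM J)) = I2 at *
  generalize (∑ y, Var[v y; wnM J] / 4) = C1 at *
  refine s1.trans ((mul_le_mul_of_nonneg_left (s2.trans (add_le_add s3 (s4.trans (add_le_add_left t1 _)))) hn'.le).trans ?_)
  have pi4 := Real.pi_le_four
  have t3 : n * (δ ^ 2 * C1 + (δ * Sq * W + δ ^ 2 * C2 * I2)) = (Real.pi / 2) * (Sq * W) + (Real.pi / 2) ^ 2 * (C1 + C2 * I2) / n := by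
    rw [← hnδ]; field_simp; ring
  rw [t3]
  have pp := Real.pi_pos
  refine add_le_add ?_ ?_
  · have : 0 ≤ Sq * W := by positivity
    nlinarith
  · refine div_le_div_of_nonneg_right (mul_le_mul_of_nonneg_right ?_ (by positivity)) hn'.le
    nlinarith
end core

section sens
variable {d L : ℕ} {α : ℕ → ℝ} {Ω : Type*} [MeasurableSpace Ω] {P : Measure Ω} [IsProbabilityMeasure P] {ξ : ℕ → V d → Ω → ℝ}

lemma sens_D (hd : 0 < d) (ha : Adm α) (T Z : Finset (V d)) (hZ : ∀ y ∈ T, fbox d y L ⊆ Z)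
    (x : V d) (M : ℕ) (T' : Finset (V d)) (hT : T' ⊆ T) (hT' : ∀ y ∈ T, y ∉ T' → M + L < dinf x y) :
    ∫ g, DD (fun (y : T) => wnF (aI (L := L) α Z x M) y.1) g ∂(wnM (NI d L Z)) ≤ 1 + T'.card * (L + 1) := by
  have vgf : GF (wnM (NI d L Z)) (fun y : V d => wnF (aI (L := L) α Z x M) y) := wnF_gf _
  have i1 : Integrable (fun g => ∑ y : T, |wnF (aI (L := L) α Z x M) y.1 g|) (wnM (NI d L Z)) := integrable_finset_sum _ fun y _ => (vgf.integrable y.1).abs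
  simp only [DD]
  rw [integral_add (integrable_const _) i1, integral_finset_sum _ fun (y : T) _ => (vgf.integrable y.1).abs]
  simp only [integral_const, probReal_univ, smul_eq_mul, mul_one]
  refine add_le_add_right ?_ 1
  rw [Finset.sum_coe_sort T (fun y => ∫ g, |wnF (aI (L := L) α Z x M) y g| ∂(wnM (NI d L Z)))]
  have z0 : ∀ y ∈ T, y ∉ T' → ∫ g, |wnF (aI (L := L) α Z x M) y g| ∂(wnM (NI d L Z)) = 0 := by
    intro y hy hy'
    have : ∀ g, wnF (aI (L := L) α Z x M) y g = 0 := fun g => Finset.sum_eq_zero fun j _ => by rw [aI_far _ _ _ _ _ (hT' y hy hy'), zero_mul]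
    simp [this]
  rw [← Finset.sum_subset hT (fun y hy hy' => z0 y hy hy')]
  calc _ ≤ ∑ y ∈ T', ((L:ℝ) + 1) := by
        refine Finset.sum_le_sum fun y hy => ?_
        have hv := aI_var (L := L) (α := α) hd ha Z x M (hZ y (hT hy))
        have hs := vgf.sq_int y
        calc ∫ g, |wnF (aI (L := L) α Z x M) y g| ∂(wnM (NI d L Z)) ≤ ∫ g, (1 + wnF (aI (L := L) α Z x M) y g ^ 2) / 2 ∂(wnM (NI d L Z)) := by
              refine integral_mono (vgf.integrable y).abs (((integrable_const _).add hs.1).div_const _) fun g => ?_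
              dsimp only
              nlinarith [sq_nonneg (|wnF (aI (L := L) α Z x M) y g| - 1), sq_abs (wnF (aI (L := L) α Z x M) y g)]
          _ = (1 + Var[wnF (aI (L := L) α Z x M) y; (wnM (NI d L Z))]) / 2 := by
              rw [integral_div, integral_add (integrable_const _) hs.1, hs.2]; simp
          _ ≤ L + 1 := by
              have : (0:ℝ) ≤ L := Nat.cast_nonneg _
              linarith
    _ = _ := by rw [Finset.sum_const, nsmul_eq_mul]

lemma sens_up (hd : 0 < d) (ha : Adm α) (hξ : IsXiFamily d P ξ) (T Z : Finset (V d)) (hZ : ∀ y ∈ T, fbox d y L ⊆ Z)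
    (x : V d) (M : ℕ) (T' : Finset (V d)) (hT : T' ⊆ T) 
    (h : ℝ) (Q : Set (V d) → Prop) (hQ : ∀ S S', S ⊆ S' → Q S → Q S') (s : ℝ) (hs : 0 < s) :
    ((wnM (NI d L Z)).prod (wnM (NI d L Z))).real {p | XX L α T Z x M p.1 p.2 ∉ {z | Q (opn T h z)} ∧ (fun y => XX L α T Z x M p.1 p.2 y + (if y.1 ∈ T' then s else 0)) ∈ {z | Q (opn T h z)}} ≤
     s * (∑ y ∈ T', qh P ξ L α T h Q y) + s ^ 2 * (T'.card * (T.card * (2 * (1 + 2 * (L + 1))))) := by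
  have hA : MeasurableSet {z | Q (opn T h z)} := meas_opn T h Q
  have hu := upcross (L := L) ha hξ T T' hT h s hs Q hQ
  have hG : MeasurableSet {z : T → ℝ | z ∉ {z | Q (opn T h z)} ∧ (fun y => z y + (if y.1 ∈ T' then s else 0)) ∈ {z | Q (opn T h z)}} := by
    refine MeasurableSet.inter hA.compl ?_
    refine (?_ : Measurable fun z : T → ℝ => fun y : T => z y + (if y.1 ∈ T' then s else 0)) hA
    exact measurable_pi_iff.2 fun y => (measurable_pi_apply y).add_const _
  have hl := law_split (L := L) (α := α) hd hξ T Z hZ x M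
  change Measure.map _ P = Measure.map (fun g : (NI d L Z → ℝ) × (NI d L Z → ℝ) => XX L α T Z x M g.1 g.2) _ at hl
  have r := congrArg (fun μ : Measure (T → ℝ) => μ.real {z : T → ℝ | z ∉ {z | Q (opn T h z)} ∧ (fun y => z y + (if y.1 ∈ T' then s else 0)) ∈ {z | Q (opn T h z)}}) hl
  rw [map_measureReal_apply (chiT_meas hξ T) hG, map_measureReal_apply (XX_meas T Z x M) hG] at r
  exact r.symm.le.trans hu

lemma sens (hd : 0 < d) (ha : Adm α) (hξ : IsXiFamily d P ξ) (T Z : Finset (V d)) (hZ : ∀ y ∈ T, fbox d y L ⊆ Z)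
    (x : V d) (M : ℕ) (T' : Finset (V d)) (hT : T' ⊆ T) (hT' : ∀ y ∈ T, y ∉ T' → M + L < dinf x y)
    (h : ℝ) (Q : Set (V d) → Prop) (hQ : ∀ S S', S ⊆ S' → Q S → Q S') :
    ∫ g, (wnM (NI d L Z)).real {g' | Q (opn T h (XX L α T Z x M g g'))} *
        (1 - (wnM (NI d L Z)).real {g' | Q (opn T h (XX L α T Z x M g g'))}) ∂(wnM (NI d L Z)) ≤
      2 * (1 + T'.card * (L + 1)) * ∑ y ∈ T', qh P ξ L α T h Q y := by
  classical
  refine core (fun (y : T) g => wnF (aO α Z x M) y.1 g) (fun (y : T) g => wnF (aI α Z x M) y.1 g)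
    ((wnF_gf (aI (L := L) α Z x M)).comp (fun y : T => y.1)) (fun y => wnF_meas _ _) {z | Q (opn T h z)} (meas_opn T h Q)
    (fun z z' hz hq => hQ _ _ (opn_mono hz) hq) (fun y c c' g g' => wnF_lin _ _ _ _ _ _) (fun y => y.1 ∈ T') ?_ _ 
    (T'.card * (T.card * (2 * (1 + 2 * (L + 1))))) _ (Finset.sum_nonneg fun y _ => measureReal_nonneg) (by positivity)
    (sens_D hd ha T Z hZ x M T' hT hT') (fun s hs => sens_up hd ha hξ T Z hZ x M T' hT h Q hQ s hs)
  intro y hy g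
  exact Finset.sum_eq_zero fun j _ => by rw [aI_far _ _ _ _ _ (hT' y.1 y.2 hy), zero_mul]
end sens
end

section
section kk
variable {d L : ℕ} {α : ℕ → ℝ} {Ω : Type*} [MeasurableSpace Ω] {P : Measure Ω} [IsProbabilityMeasure P] {ξ : ℕ → V d → Ω → ℝ}

abbrev mon (Q : Set (V d) → Prop) : Prop := ∀ S S', S ⊆ S' → Q S → Q S'

lemma XX_ms (T Z : Finset (V d)) (x : V d) (M : ℕ) (g : NI d L Z → ℝ) (h : ℝ) (Q : Set (V d) → Prop) :
    MeasurableSet {g' | Q (opn T h (XX L α T Z x M g g'))} :=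
  ((XX_meas T Z x M).comp (measurable_const.prodMk measurable_id)) (meas_opn T h Q)

lemma fkgX (ha : Adm α) (T Z : Finset (V d)) (x : V d) (M : ℕ) (g : NI d L Z → ℝ) (h : ℝ) (Q Q' : Set (V d) → Prop) (hQ : mon Q) (hQ' : mon Q') :
    (wnM (NI d L Z)).real {g' | Q (opn T h (XX L α T Z x M g g'))} * (wnM (NI d L Z)).real {g' | Q' (opn T h (XX L α T Z x M g g'))} ≤
     (wnM (NI d L Z)).real {g' | Q (opn T h (XX L α T Z x M g g')) ∧ Q' (opn T h (XX L α T Z x M g g'))} := by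
  have hm : ∀ Q : Set (V d) → Prop, mon Q → IsUpperSet {g' | Q (opn T h (XX L α T Z x M g g'))} := by
    intro Q hQ g1 g2 h12 hq
    refine hQ _ _ (opn_mono fun y => ?_) hq
    refine add_le_add_right ?_ _
    exact Finset.sum_le_sum fun j _ => mul_le_mul_of_nonneg_left (h12 j) (aI_nonneg ha _ _ _ _ _)
  exact (posAssoc_pi _).sets (XX_ms T Z x M g h Q) (XX_ms T Z x M g h Q') (hm Q hQ) (hm Q' hQ')

lemma fkgX_neg (ha : Adm α) (T Z : Finset (V d)) (x : V d) (M : ℕ) (g : NI d L Z → ℝ) (h : ℝ) (Q Q' : Set (V d) → Prop) (hQ : mon Q) (hQ' : mon Q') :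
    (wnM (NI d L Z)).real {g' | ¬ Q (opn T h (XX L α T Z x M g g'))} * (wnM (NI d L Z)).real {g' | ¬ Q' (opn T h (XX L α T Z x M g g'))} ≤
     (wnM (NI d L Z)).real {g' | ¬ Q (opn T h (XX L α T Z x M g g')) ∧ ¬ Q' (opn T h (XX L α T Z x M g g'))} := by
  have h0 := fkgX ha T Z x M g h Q Q' hQ hQ'
  have c : ∀ Q : Set (V d) → Prop, (wnM (NI d L Z)).real {g' | ¬ Q (opn T h (XX L α T Z x M g g'))} = 1 - (wnM (NI d L Z)).real {g' | Q (opn T h (XX L α T Z x M g g'))} :=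
    fun Q => probReal_compl_eq_one_sub (XX_ms T Z x M g h Q)
  have e : {g' | ¬ Q (opn T h (XX L α T Z x M g g')) ∧ ¬ Q' (opn T h (XX L α T Z x M g g'))} =
      {g' | ¬ (fun S => Q S ∨ Q' S) (opn T h (XX L α T Z x M g g'))} := by ext; simp
  rw [e, c, c]
  refine le_trans ?_ (c (fun S => Q S ∨ Q' S)).ge
  have hu := measureReal_union_add_inter (μ := wnM (NI d L Z)) (s := {g' | Q (opn T h (XX L α T Z x M g g'))}) (XX_ms T Z x M g h Q')
  change (wnM (NI d L Z)).real {g' | (fun S => Q S ∨ Q' S) (opn T h (XX L α T Z x M g g'))} + 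
    (wnM (NI d L Z)).real {g' | Q (opn T h (XX L α T Z x M g g')) ∧ Q' (opn T h (XX L α T Z x M g g'))} = _ at hu
  nlinarith

lemma split_int (hd : 0 < d) (hξ : IsXiFamily d P ξ) (T Z : Finset (V d)) (hZ : ∀ y ∈ T, fbox d y L ⊆ Z) (x : V d) (M : ℕ) (h : ℝ) (Q : Set (V d) → Prop) :
    P.real {ω | Q (opn T h (chiT L α T (cfg ξ ω)))} =
     ∫ g, (wnM (NI d L Z)).real {g' | Q (opn T h (XX L α T Z x M g g'))} ∂(wnM (NI d L Z)) := by
  have hl := law_split (L := L) (α := α) hd hξ T Z hZ x M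
  change Measure.map _ P = Measure.map (fun g : (NI d L Z → ℝ) × (NI d L Z → ℝ) => XX L α T Z x M g.1 g.2) _ at hl
  have r := congrArg (fun μ : Measure (T → ℝ) => μ.real {z | Q (opn T h z)}) hl
  rw [map_measureReal_apply (chiT_meas hξ T) (meas_opn T h Q), map_measureReal_apply (XX_meas T Z x M) (meas_opn T h Q), prod_real _ _ (XX_meas T Z x M (meas_opn T h Q))] at r
  exact r

lemma local_eq (hd : 0 < d) (hξ : IsXiFamily d P ξ) (T Z : Finset (V d)) (hZ : ∀ y ∈ T, fbox d y L ⊆ Z) (x : V d) (M k : ℕ) (hk : k + L ≤ M) (h : ℝ) (Q : Set (V d) → Prop)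
    (g : NI d L Z → ℝ) :
    (wnM (NI d L Z)).real {g' | Q (opn T h (XX L α T Z x M g g') ∩ {y | dinf x y ≤ k})} =
    P.real {ω | Q (opn T h (chiT L α T (cfg ξ ω)) ∩ {y | dinf x y ≤ k})} := by
  have e0 := split_int (L := L) (α := α) hd hξ T Z hZ x M h (fun S => Q (S ∩ {y | dinf x y ≤ k}))
  rw [e0]
  have : ∀ g1 g', opn T h (XX L α T Z x M g1 g') ∩ {y | dinf x y ≤ k} = opn T h (XX L α T Z x M g g') ∩ {y | dinf x y ≤ k} := by
    have z : ∀ g1 y, dinf x y ≤ k → wnF (aO (L := L) α Z x M) y g1 = 0 := fun g1 y hy =>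
      Finset.sum_eq_zero fun j _ => by rw [aO_near _ _ _ _ _ (by omega), zero_mul]
    intro g1 g'
    ext y
    simp only [opn, XX, mem_inter_iff, mem_setOf_eq]
    constructor <;> rintro ⟨⟨h1, h2⟩, h3⟩ <;> refine ⟨⟨h1, ?_⟩, h3⟩ <;> rw [z _ y h3] at h2 ⊢ <;> exact h2
  simp only [this]
  simp

lemma mon_crs (r R : ℕ) : mon (Crs d r R) := fun S S' h hc => hc.mono h

lemma fixg (hd : 0 < d) (ha : Adm α) (hξ : IsXiFamily d P ξ) (T Z : Finset (V d)) (hZ : ∀ y ∈ T, fbox d y L ⊆ Z)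
    (x : V d) (M m n ρ r R : ℕ) (hn : n + L ≤ M) (hρ : ρ + L ≤ M) (hmn : m ≤ n) (hR : r + 2 * n < R) (h τ η : ℝ) (hτ0 : 0 < τ) (hη0 : 0 < η) (hη1 : η ≤ 1)
    (hτ : ∀ z₁ ∈ fbox d x m, ∀ z₂ ∈ fbox d x m, τ ≤ P.real {ω | ConnIn (opn T h (chiT L α T (cfg ξ ω)) ∩ {y | dinf x y ≤ ρ}) {z₁} {z₂}})
    (hη : η ≤ P.real {ω | ¬ ConnIn (opn T h (chiT L α T (cfg ξ ω)) ∩ {y | dinf x y ≤ n}) {y | dinf x y ≤ m} {y | dinf x y = n}})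
    (g : NI d L Z → ℝ) :
    (wnM (NI d L Z)).real {g' | Crs d r R (opn T h (XX L α T Z x M g g') ∪ {y | dinf x y ≤ m}) ∧ ¬ Crs d r R (opn T h (XX L α T Z x M g g') \ {y | dinf x y ≤ m})} ≤
    2 * ((1 + ((fbox d x m).card : ℝ) ^ 2 / τ) / η) * ((wnM (NI d L Z)).real {g' | Crs d r R (opn T h (XX L α T Z x M g g'))} *
      (1 - (wnM (NI d L Z)).real {g' | Crs d r R (opn T h (XX L α T Z x M g g'))})) := by
  classical
  set μ := wnM (NI d L Z) with hμ
  set p := μ.real {g' | Crs d r R (opn T h (XX L α T Z x M g g'))} with hp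
  have p0 : 0 ≤ p := measureReal_nonneg
  have p1 : p ≤ 1 := measureReal_le_one
  set N : ℝ := ((fbox d x m).card : ℝ) with hN
  set a := μ.real {g' | Crs d r R (opn T h (XX L α T Z x M g g') ∪ {y | dinf x y ≤ m}) ∧ ¬ Crs d r R (opn T h (XX L α T Z x M g g') \ {y | dinf x y ≤ m})} with ha'
  have hc : a ≤ p * (1 + N ^ 2 / τ) := by
    let Ar : V d → V d → Set (V d) → Prop := fun z₁ z₂ S => ConnIn (S ∪ {z₁}) (box d r) {z₁} ∧ ConnIn (S ∪ {z₂}) {z₂} (bdry d R)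
    have mA : ∀ z₁ z₂, mon (Ar z₁ z₂) := fun z₁ z₂ S S' hS hq =>
      ⟨hq.1.mono (union_subset_union_left _ hS) subset_rfl subset_rfl, hq.2.mono (union_subset_union_left _ hS) subset_rfl subset_rfl⟩
    have s1 : a ≤ p + ∑ z ∈ fbox d x m ×ˢ fbox d x m, μ.real {g' | Ar z.1 z.2 (opn T h (XX L α T Z x M g g'))} := by
      refine (measureReal_mono ?_ (measure_ne_top _ _)).trans ((measureReal_union_le _ _).trans (add_le_add_right (measureReal_biUnion_finset_le _ _) _))
      rintro g' ⟨h1, -⟩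
      rcases arms h1 with h1 | ⟨z₁, hz₁, z₂, hz₂, h1⟩
      · exact Or.inl h1
      · exact Or.inr (mem_biUnion (x := (z₁, z₂)) (by simpa [mem_fbox] using ⟨hz₁, hz₂⟩) h1)
    have s2 : ∀ z ∈ fbox d x m ×ˢ fbox d x m, μ.real {g' | Ar z.1 z.2 (opn T h (XX L α T Z x M g g'))} ≤ p / τ := by
      rintro ⟨z₁, z₂⟩ hz
      rw [Finset.mem_product] at hz
      have f := fkgX ha T Z x M g h (Ar z₁ z₂) (fun S => ConnIn (S ∩ {y | dinf x y ≤ ρ}) {z₁} {z₂}) (mA z₁ z₂)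
        (fun S S' hS hq => hq.mono (inter_subset_inter_left _ hS) subset_rfl subset_rfl)
      have l := local_eq (L := L) (α := α) hd hξ T Z hZ x M ρ hρ h (fun S => ConnIn S {z₁} {z₂}) g
      rw [l] at f
      rw [le_div_iff₀ hτ0]
      refine (mul_le_mul_of_nonneg_left (hτ z₁ hz.1 z₂ hz.2) measureReal_nonneg).trans (f.trans (measureReal_mono ?_ (measure_ne_top _ _)))
      rintro g' ⟨⟨h1, h2⟩, h3⟩
      exact arms_glue h1 h2 (h3.mono inter_subset_left subset_rfl subset_rfl)
    refine s1.trans ((add_le_add_right (Finset.sum_le_sum s2) _).trans (le_of_eq ?_))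
    rw [Finset.sum_const, Finset.card_product, nsmul_eq_mul]
    push_cast; rw [← hN]; ring
  have he : a ≤ (1 - p) / η := by
    rw [le_div_iff₀ hη0]
    have f := fkgX_neg ha T Z x M g h (fun S => Crs d r R (S \ {y | dinf x y ≤ m})) (fun S => ConnIn (S ∩ {y | dinf x y ≤ n}) {y | dinf x y ≤ m} {y | dinf x y = n})
      (fun S S' hS hq => hq.mono (diff_subset_diff_left hS)) (fun S S' hS hq => hq.mono (inter_subset_inter_left _ hS) subset_rfl subset_rfl)
    have l := local_eq (L := L) (α := α) hd hξ T Z hZ x M n hn h (fun S => ¬ ConnIn S {y | dinf x y ≤ m} {y | dinf x y = n}) g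
    rw [l] at f
    have : 1 - p = μ.real {g' | ¬ Crs d r R (opn T h (XX L α T Z x M g g'))} := (probReal_compl_eq_one_sub (XX_ms T Z x M g h (Crs d r R))).symm
    rw [this]
    calc a * η ≤ μ.real {g' | ¬ Crs d r R (opn T h (XX L α T Z x M g g') \ {y | dinf x y ≤ m})} * _ :=
          mul_le_mul (measureReal_mono (fun g' h1 => h1.2) (measure_ne_top _ _)) hη hη0.le measureReal_nonneg
      _ ≤ _ := f
      _ ≤ _ := measureReal_mono (fun g' h1 => block hd hR hmn h1.1 h1.2) (measure_ne_top _ _)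
  set K := 1 + N ^ 2 / τ with hK
  have K1 : 1 ≤ K := by rw [hK]; have : 0 ≤ N ^ 2 / τ := by positivity
                        linarith
  have a0 : 0 ≤ a := measureReal_nonneg
  rw [le_div_iff₀ hη0] at he
  have : 2 * (K / η) * (p * (1 - p)) = (2 * K * p * (1 - p)) / η := by ring
  rw [this, le_div_iff₀ hη0]
  rcases le_total p (1/2) with hh | hh
  · have : a * η ≤ a := mul_le_of_le_one_right a0 hη1
    have : 0 ≤ p * K := by positivity
    nlinarith
  · have h1 : 0 ≤ 1 - p := by linarith
    have : 1 ≤ 2 * K * p := by nlinarith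
    nlinarith

lemma cp_bound (hd : 0 < d) (ha : Adm α) (hξ : IsXiFamily d P ξ) (T : Finset (V d)) 
    (x : V d) (M m n ρ r R : ℕ) (T' : Finset (V d)) (hT : T' ⊆ T) (hT' : ∀ y ∈ T, y ∉ T' → M + L < dinf x y)
    (hn : n + L ≤ M) (hρ : ρ + L ≤ M) (hmn : m ≤ n) (hR : r + 2 * n < R) (h τ η : ℝ) (hτ0 : 0 < τ) (hη0 : 0 < η) (hη1 : η ≤ 1)
    (hτ : ∀ z₁ ∈ fbox d x m, ∀ z₂ ∈ fbox d x m, τ ≤ P.real {ω | ConnIn (opn T h (chiT L α T (cfg ξ ω)) ∩ {y | dinf x y ≤ ρ}) {z₁} {z₂}})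
    (hη : η ≤ P.real {ω | ¬ ConnIn (opn T h (chiT L α T (cfg ξ ω)) ∩ {y | dinf x y ≤ n}) {y | dinf x y ≤ m} {y | dinf x y = n}}) :
    P.real {ω | Crs d r R (opn T h (chiT L α T (cfg ξ ω)) ∪ {y | dinf x y ≤ m}) ∧ ¬ Crs d r R (opn T h (chiT L α T (cfg ξ ω)) \ {y | dinf x y ≤ m})} ≤
    2 * ((1 + ((fbox d x m).card : ℝ) ^ 2 / τ) / η) * (2 * (1 + T'.card * (L + 1)) * ∑ y ∈ T', qh P ξ L α T h (Crs d r R) y) := by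
  obtain ⟨Z, hZ⟩ := exists_Z T L
  have e0 := split_int (L := L) (α := α) hd hξ T Z hZ x M h (fun S => Crs d r R (S ∪ {y | dinf x y ≤ m}) ∧ ¬ Crs d r R (S \ {y | dinf x y ≤ m}))
  rw [e0]
  have hs := sens (L := L) (α := α) hd ha hξ T Z hZ x M T' hT hT' h (Crs d r R) (mon_crs r R)
  refine le_trans ?_ (mul_le_mul_of_nonneg_left hs (by positivity))
  rw [← integral_const_mul]
  have hmeas : Measurable (fun g => (wnM (NI d L Z)).real {g' | Crs d r R (opn T h (XX L α T Z x M g g'))}) :=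
    (measurable_measure_prodMk_left (ν := wnM (NI d L Z)) (XX_meas T Z x M (meas_opn T h (Crs d r R)))).ennreal_toReal
  refine integral_mono_of_nonneg (ae_of_all _ fun g => measureReal_nonneg) ?_ (ae_of_all _ fun g => fixg hd ha hξ T Z hZ x M m n ρ r R hn hρ hmn hR h τ η hτ0 hη0 hη1 hτ hη g)
  refine Integrable.const_mul ?_ _
  refine Integrable.of_bound (hmeas.mul (measurable_const.sub hmeas)).aestronglyMeasurable 1 (ae_of_all _ fun g => ?_)
  have h0 : 0 ≤ (wnM (NI d L Z)).real {g' | Crs d r R (opn T h (XX L α T Z x M g g'))} := measureReal_nonneg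
  have h1 : (wnM (NI d L Z)).real {g' | Crs d r R (opn T h (XX L α T Z x M g g'))} ≤ 1 := measureReal_le_one
  rw [Real.norm_eq_abs, abs_le]
  constructor <;> nlinarith

end kk
end

section
variable {d L : ℕ} {α : ℕ → ℝ} {Ω : Type*} [MeasurableSpace Ω] {P : Measure Ω} [IsProbabilityMeasure P] {ξ : ℕ → V d → Ω → ℝ}

/-- the open set -/
def SS (L : ℕ) (α : ℕ → ℝ) (h : ℝ) (c : Cfg d) : Set (V d) := {y | h ≤ gchi L α c y}

lemma opn_SS (T : Finset (V d)) (h : ℝ) (c : Cfg d) : opn T h (chiT L α T c) = SS L α h c ∩ T := by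
  ext y; simp only [opn, chiT, SS, mem_ofPred_eq, mem_inter_iff, Finset.mem_coe, exists_prop, and_comm]

structure LSym (g : V d → V d) : Prop where
  adj : ∀ x y, GFFperc.adj x y → GFFperc.adj (g x) (g y)
  dinf : ∀ x y, GFFperc.dinf (g x) (g y) = GFFperc.dinf x y
  laz : ∀ k x y, lazyP d k (g x) (g y) = lazyP d k x y

lemma LSym.add (z : V d) : LSym (fun x => x + z) :=
  ⟨fun x y h => adj_add z h, fun x y => dinf_add x y z, fun k x y => lazyP_add d k x y z⟩

def sgp (π : Equiv.Perm (Fin d)) (s : Fin d → ℤ) (hs : ∀ i, s i * s i = 1) : V d ≃+ V d where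
  toFun x i := s i * x (π i)
  invFun y i := s (π.symm i) * y (π.symm i)
  left_inv x := by ext i; simp [← mul_assoc, hs]
  right_inv x := by ext i; simp [← mul_assoc, hs]
  map_add' x y := by ext i; simp [mul_add]

lemma sgp_sym (π : Equiv.Perm (Fin d)) (s : Fin d → ℤ) (hs : ∀ i, s i * s i = 1) : LSym (sgp π s hs) := by
  have hn : ∀ i, (s i).natAbs = 1 := fun i => by
    have := congrArg Int.natAbs (hs i); rw [Int.natAbs_mul] at this; simpa using Nat.eq_one_of_mul_eq_one_right this
  have key : ∀ x y : V d, ∀ i, (sgp π s hs x i - sgp π s hs y i).natAbs = (x (π i) - y (π i)).natAbs := fun x y i => by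
    show (s i * x (π i) - s i * y (π i)).natAbs = _
    rw [← mul_sub, Int.natAbs_mul, hn, one_mul]
  refine ⟨fun x y h => ?_, fun x y => ?_, fun k x y => lazyP_equiv d k _ (fun F => ?_) x y⟩
  · unfold GFFperc.adj at *; simp only [key]; rw [← h]; exact Equiv.sum_comp π (fun i => (x i - y i).natAbs)
  · refine le_antisymm ((dinf_le_iff _ _ _).2 fun i => ?_) ((dinf_le_iff _ _ _).2 fun i => ?_)
    · rw [key]; exact natAbs_le_dinf x y _
    · have := natAbs_le_dinf (sgp π s hs x) (sgp π s hs y) (π.symm i); rw [key] at this; simpa using this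
  · rw [← Equiv.sum_comp π.symm (fun i => F (unitV d i) + F (- unitV d i))]
    refine Finset.sum_congr rfl fun i _ => ?_
    have : sgp π s hs (unitV d i) = s (π.symm i) • unitV d (π.symm i) := by
      ext j; show s j * unitV d i (π j) = s (π.symm i) * unitV d (π.symm i) j
      simp only [unitV]
      by_cases h : π j = i
      · subst h; simp
      · rw [if_neg h, if_neg (fun h' => h (by rw [h']; simp))]; simp
    rw [this]
    rcases Int.natAbs_eq_iff.1 (hn (π.symm i)) with h | h
    · rw [h]; simp
    · rw [h]; simp [add_comm]

lemma law_inv (hξ : IsXiFamily d P ξ) {g : V d → V d} (hg : LSym g) (T : Finset (V d)) (h : ℝ) (Q : Set (V d) → Prop) :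
    P.real {ω | Q (SS L α h (cfg ξ ω) ∩ T)} = P.real {ω | Q ({y | h ≤ gchi L α (cfg ξ ω) (g y)} ∩ T)} := by
  have g0 := gf_gchi hξ L α
  have e := GF.law_eq (g0.comp (fun y : T => y.1)) (g0.comp (fun y : T => g y.1)) (fun i j => by
    rw [cov_gchi' hξ, cov_gchi' hξ]; simp only [Kf, hg.laz])
  have m1 : Measurable (fun ω (y : T) => gchi L α (cfg ξ ω) y.1) := measurable_pi_iff.2 fun y => g0.meas _
  have m2 : Measurable (fun ω (y : T) => gchi L α (cfg ξ ω) (g y.1)) := measurable_pi_iff.2 fun y => g0.meas _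
  have e' := congrArg (fun μ => μ.real {x | Q (opn T h x)}) e
  rw [map_measureReal_apply m1 (meas_opn T h Q), map_measureReal_apply m2 (meas_opn T h Q)] at e'
  convert e' using 3 <;>
  · ext ω; simp only [mem_preimage, mem_ofPred_eq]
    refine iff_of_eq (congrArg Q ?_)
    ext y; simp only [opn, SS, mem_ofPred_eq, mem_inter_iff, Finset.mem_coe, exists_prop, and_comm]

lemma fkgS (hd : 0 < d) (ha : Adm α) (hξ : IsXiFamily d P ξ) (T : Finset (V d)) (h : ℝ) (Q Q' : Set (V d) → Prop)
    (hQ : mon Q) (hQ' : mon Q') :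
    P.real {ω | Q (SS L α h (cfg ξ ω) ∩ T)} * P.real {ω | Q' (SS L α h (cfg ξ ω) ∩ T)} ≤
      P.real {ω | Q (SS L α h (cfg ξ ω) ∩ T) ∧ Q' (SS L α h (cfg ξ ω) ∩ T)} := by
  have := fkg_chi (L := L) hd ha hξ T h Q Q' hQ hQ'
  simpa only [opn_SS] using this

/-- two point connectivity in a box around the first point -/
def cn (P : Measure Ω) (ξ : ℕ → V d → Ω → ℝ) (L : ℕ) (α : ℕ → ℝ) (h : ℝ) (p q : V d) (ρ : ℕ) : ℝ :=
  P.real {ω | ConnIn (SS L α h (cfg ξ ω) ∩ {y | dinf p y ≤ ρ}) {p} {q}}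

lemma coe_fbox (x : V d) (n : ℕ) : ((fbox d x n : Finset (V d)) : Set (V d)) = {y | dinf x y ≤ n} := by
  ext y; simp [mem_fbox]

lemma cn_sym (hξ : IsXiFamily d P ξ) {g : V d → V d} (hg : LSym g) (h : ℝ) (p q : V d) (ρ : ℕ) :
    cn P ξ L α h p q ρ ≤ cn P ξ L α h (g p) (g q) ρ := by
  unfold cn
  rw [← coe_fbox, law_inv hξ hg _ _ (fun S => ConnIn S {p} {q})]
  refine measureReal_mono (fun ω hω => ?_) (measure_ne_top _ _)
  refine ConnIn.map (f := g) hg.adj hω ?_ ?_ ?_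
  · rintro x ⟨h1, h2⟩; rw [coe_fbox] at h2; exact ⟨h1, by simpa [hg.dinf] using h2⟩
  · rintro x rfl; rfl
  · rintro x rfl; rfl

lemma cn_mono (h : ℝ) (p q : V d) {ρ ρ' : ℕ} (hρ : ρ ≤ ρ') : cn P ξ L α h p q ρ ≤ cn P ξ L α h p q ρ' :=
  measureReal_mono (fun ω hω => hω.mono (inter_subset_inter_right _ fun y hy => le_trans hy hρ) subset_rfl subset_rfl) (measure_ne_top _ _)

lemma ConnIn_mon (A B : Set (V d)) : mon (fun S => ConnIn S A B) := fun S S' hS h => h.mono hS subset_rfl subset_rfl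

lemma cn_glue (hd : 0 < d) (ha : Adm α) (hξ : IsXiFamily d P ξ) (h : ℝ) {v w : V d} {ρ ρ' ρ'' : ℕ} {b b' : ℝ} (hb' : 0 ≤ b')
    (h1 : b ≤ cn P ξ L α h 0 v ρ) (h2 : b' ≤ cn P ξ L α h 0 w ρ') (hr : ρ ≤ ρ'') (hr' : dinf 0 v + ρ' ≤ ρ'') :
    b * b' ≤ cn P ξ L α h 0 (v + w) ρ'' := by
  have h3 := h2.trans (cn_sym hξ (LSym.add v) h 0 w ρ')
  simp only [zero_add] at h3
  rw [add_comm w v] at h3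
  refine (mul_le_mul h1 h3 hb' measureReal_nonneg).trans ?_
  have f := fkgS (L := L) hd ha hξ (fbox d 0 ρ'') h (fun S => ConnIn (S ∩ {y | dinf 0 y ≤ ρ}) {0} {v}) (fun S => ConnIn (S ∩ {y | dinf v y ≤ ρ'}) {v} {v + w})
    (fun S S' hS hc => hc.mono (inter_subset_inter_left _ hS) subset_rfl subset_rfl) (fun S S' hS hc => hc.mono (inter_subset_inter_left _ hS) subset_rfl subset_rfl)
  rw [coe_fbox] at f
  refine le_trans (mul_le_mul ?_ ?_ measureReal_nonneg measureReal_nonneg) (f.trans ?_)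
  · refine measureReal_mono (fun ω hω => hω.mono (fun y hy => ⟨⟨hy.1, le_trans hy.2 hr⟩, hy.2⟩) subset_rfl subset_rfl) (measure_ne_top _ _)
  · refine measureReal_mono (fun ω hω => hω.mono (fun y hy => ⟨⟨hy.1, ?_⟩, hy.2⟩) subset_rfl subset_rfl) (measure_ne_top _ _)
    have := dinf_tri 0 v y; have := hy.2; simp only [mem_ofPred_eq] at *; omega
  · refine measureReal_mono (fun ω hω => ?_) (measure_ne_top _ _)
    exact (hω.1.mono inter_subset_left subset_rfl subset_rfl).trans (hω.2.mono inter_subset_left subset_rfl subset_rfl)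

/-- axis connections -/
def AX (P : Measure Ω) (ξ : ℕ → V d → Ω → ℝ) (L : ℕ) (α : ℕ → ℝ) (h : ℝ) (s ρ : ℕ) (b : ℝ) : Prop :=
  ∀ (i : Fin d) (z : ℤ), z.natAbs = s → b ≤ cn P ξ L α h 0 (Pi.single i z) ρ

lemma AX_of (hξ : IsXiFamily d P ξ) (h : ℝ) {s ρ : ℕ} {b : ℝ} {i : Fin d} {z : ℤ} (hz : z.natAbs = s)
    (hb : b ≤ cn P ξ L α h 0 (Pi.single i z) ρ) : AX P ξ L α h s ρ b := by
  intro j z' hz'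
  obtain ⟨e, he, hez⟩ : ∃ e : ℤ, e * e = 1 ∧ z' = e * z := by
    rcases Int.natAbs_eq_natAbs_iff.1 (hz'.trans hz.symm) with h | h
    · exact ⟨1, by simp, by simp [h]⟩
    · exact ⟨-1, by simp, by simp [h]⟩
  have := hb.trans (cn_sym hξ (sgp_sym (Equiv.swap i j) (fun _ => e) (fun _ => he)) h 0 (Pi.single i z) ρ)
  rw [map_zero] at this
  have e1 : (Pi.single j z' : V d) = sgp (Equiv.swap i j) (fun _ => e) (fun _ => he) (Pi.single i z) := by
   ext k; show _ = e * (Pi.single i z : V d) (Equiv.swap i j k)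
   by_cases hk : k = j
   · subst hk; simp [hez]
   · rw [Pi.single_eq_of_ne hk, Pi.single_eq_of_ne, mul_zero]
     intro h'; exact hk (by have := congrArg (Equiv.swap i j) h'; simpa using this)
  rw [e1]; exact this

lemma dinf_single (i : Fin d) (z : ℤ) : dinf 0 (Pi.single i z : V d) ≤ z.natAbs := by
  rw [dinf_le_iff]; intro j
  by_cases hj : j = i
  · subst hj; simp
  · simp [Pi.single_eq_of_ne hj]

lemma AX_add (hd : 0 < d) (ha : Adm α) (hξ : IsXiFamily d P ξ) (h : ℝ) {s s' ρ ρ' ρ'' : ℕ} {b b' : ℝ} (hb' : 0 ≤ b')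
    (h1 : AX P ξ L α h s ρ b) (h2 : AX P ξ L α h s' ρ' b') (hr : ρ ≤ ρ'') (hr' : s + ρ' ≤ ρ'') : AX P ξ L α h (s + s') ρ'' (b * b') := by
  have i : Fin d := ⟨0, hd⟩
  refine AX_of (i := i) (z := (s:ℤ) + s') hξ h (by omega) ?_
  rw [Pi.single_add]
  exact cn_glue hd ha hξ h hb' (h1 i s (by simp)) (h2 i s' (by simp)) hr (by have := dinf_single i (s:ℤ); simp at this; omega)

lemma AX_ind (hd : 0 < d) (ha : Adm α) (hξ : IsXiFamily d P ξ) (h b : ℝ) (hb : 0 < b) (hb1 : b ≤ 1) (W : ℕ)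
    (h0 : AX P ξ L α h 0 1 b) (h1 : AX P ξ L α h 1 1 b)
    (hm : ∀ m, 1 ≤ m → 2 * m ≤ W → ∃ l, 2 * m ≤ l ∧ l ≤ 6 * m ∧ AX P ξ L α h l (6 * m) b) :
    ∀ k s, s ≤ W → 5 ^ k * s < 6 ^ (k + 1) → AX P ξ L α h s (s + 1) (b ^ (k + 6)) := by
  have hsmall : ∀ s, AX P ξ L α h s (s + 1) (b ^ (s + 1)) := by
    intro s; induction s with
    | zero => simpa using h0
    | succ s ih => rw [pow_succ']; have := AX_add (ρ := 1) (ρ' := s + 1) (ρ'' := 1 + s + 1) hd ha hξ h (by positivity) h1 ih (by omega) (by omega); rwa [Nat.add_comm 1 s] at this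
  have hs6 : ∀ k s, s < 6 → AX P ξ L α h s (s + 1) (b ^ (k + 6)) := fun k s hs i z hz =>
    (pow_le_pow_of_le_one hb.le hb1 (by omega)).trans (hsmall s i z hz)
  intro k; induction k with
  | zero => intro s _ hs; exact hs6 0 s (by omega)
  | succ k ih =>
    intro s hW hs
    by_cases h6 : s < 6
    · exact hs6 _ s h6
    obtain ⟨l, hl1, hl2, hl⟩ := hm (s / 6) (by omega) (by omega)
    have h65 : 6 * (s - l) ≤ 5 * s := by omega
    have hk : 5 ^ k * (s - l) < 6 ^ (k + 1) := by
      have e1 : 5 ^ k * (6 * (s - l)) ≤ 5 ^ k * (5 * s) := Nat.mul_le_mul_left _ h65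
      rw [pow_succ 5 k, pow_succ 6 (k+1)] at hs
      nlinarith
    have := AX_add (ρ'' := s + 1) hd ha hξ h (by positivity) hl (ih (s - l) (by omega) hk) (by omega) (by omega)
    rw [show l + (s - l) = s by omega, ← pow_succ'] at this
    exact this

lemma cn_chain (hd : 0 < d) (ha : Adm α) (hξ : IsXiFamily d P ξ) (h B : ℝ) (hB : 0 < B) (D : ℕ)
    (hA : ∀ s ≤ D, AX P ξ L α h s (s + 1) B) (w : V d) (hw : ∀ i, (w i).natAbs ≤ D) :
    B ^ (d + 1) ≤ cn P ξ L α h 0 w (2 * D + 1) := by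
  have key : ∀ I : Finset (Fin d), B ^ (I.card + 1) ≤ cn P ξ L α h 0 (fun i => if i ∈ I then w i else 0) (2 * D + 1) := by
    intro I; induction I using Finset.induction_on with
    | empty =>
      have := hA 0 (by omega) ⟨0, hd⟩ 0 rfl
      rw [Pi.single_zero] at this
      have := this.trans (cn_mono (ρ' := 2 * D + 1) h _ _ (by omega))
      simpa [Pi.zero_def] using this
    | insert a I ha' ih =>
      rw [Finset.card_insert_of_notMem ha', pow_succ]
      have := cn_glue (ρ'' := 2 * D + 1) hd ha hξ h hB.le ih (hA _ (hw a) a (w a) rfl) le_rfl (by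
        have : dinf (0 : V d) (fun i => if i ∈ I then w i else 0) ≤ D := by
          rw [dinf_le_iff]; intro i; have := hw i; simp only [Pi.zero_apply, zero_sub, Int.natAbs_neg]; split_ifs <;> simp [this]
        have := hw a; omega)
      convert this using 2
      ext i
      by_cases hi : i = a
      · subst hi; simp [ha']
      · simp [hi, Pi.single_eq_of_ne hi]
  have := key Finset.univ
  simpa using this
end

section
variable {d L : ℕ} {α : ℕ → ℝ} {Ω : Type*} [MeasurableSpace Ω] {P : Measure Ω} [IsProbabilityMeasure P] {ξ : ℕ → V d → Ω → ℝ}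

lemma pigeon {ι : Type*} (I : Finset ι) (E : Set Ω) (F : ι → Set Ω) (hE : E ⊆ ⋃ i ∈ I, F i) {c : ℝ} (hc : 0 < c) (h : c ≤ P.real E)
    {N : ℝ} (hN : (I.card : ℝ) ≤ N) (hN0 : 0 < N) : ∃ i ∈ I, c / N ≤ P.real (F i) := by
  by_contra hcon
  push Not at hcon
  have h1 : P.real E ≤ ∑ i ∈ I, P.real (F i) := (measureReal_mono hE (measure_ne_top _ _)).trans (measureReal_biUnion_finset_le _ _)
  have hI : I.Nonempty := by
    rw [Finset.nonempty_iff_ne_empty]; rintro rfl; simp at h1; linarith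
  have h2 : ∑ i ∈ I, P.real (F i) < ∑ i ∈ I, c / N := Finset.sum_lt_sum_of_nonempty hI hcon
  rw [Finset.sum_const, nsmul_eq_mul] at h2
  have : (I.card : ℝ) * (c / N) ≤ c := by
    rw [mul_div_assoc', div_le_iff₀ hN0]; nlinarith
  linarith

lemma AX01 (hd : 0 < d) (ha : Adm α) (hξ : IsXiFamily d P ξ) (h c : ℝ) (hc : 0 < c)
    (h1 : c ≤ P.real {ω | ConnIn (SS L α h (cfg ξ ω)) (box d ((1 : ℕ) : ℝ)) (bdry d ((1 : ℕ) : ℝ))}) :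
    c / 3 ^ d ≤ cn P ξ L α h 0 0 0 ∧ AX P ξ L α h 1 1 ((c / 3 ^ d) ^ 2) := by
  obtain ⟨y, -, hy⟩ := pigeon (fbox d 0 1) _ (fun y => {ω | y ∈ SS L α h (cfg ξ ω)}) (fun ω hω => by
    obtain ⟨p, hp, q, hq, hpq⟩ := ConnIn.exists hω
    exact mem_biUnion (mem_fbox.2 (mem_box.1 hp)) hpq.left) hc h1 (N := 3 ^ d) (by rw [card_fbox]; simp) (by positivity)
  have e : ∀ y : V d, c / 3 ^ d ≤ P.real {ω | y ∈ SS L α h (cfg ξ ω)} := by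
    intro z
    have l := law_inv (L := L) (α := α) hξ (LSym.add (z - y)) {y} h (fun S => y ∈ S)
    simp at l
    refine hy.trans (l.le.trans (le_of_eq ?_)); rfl
  refine ⟨(e 0).trans (measureReal_mono (fun ω hω => ConnIn.refl ⟨hω, ?_⟩) (measure_ne_top _ _)), ?_⟩
  · simp [dinf_self]
  intro i z hz
  have f := fkgS (L := L) hd ha hξ {0, Pi.single i z} h (fun S => (0 : V d) ∈ S) (fun S => (Pi.single i z : V d) ∈ S) (fun S S' hS hh => hS hh) (fun S S' hS hh => hS hh)
  simp only [Finset.coe_insert, Finset.coe_singleton, mem_inter_iff, Set.mem_insert_iff, Set.mem_singleton_iff, true_or, or_true, and_true] at f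
  rw [pow_two]
  refine (mul_le_mul (e 0) (e _) (by positivity) measureReal_nonneg).trans (f.trans (measureReal_mono (fun ω hω => ?_) (measure_ne_top _ _)))
  have hs := dinf_single i z
  refine ConnIn.adj ⟨hω.1, by simp [dinf_self]⟩ ⟨hω.2, by simp only [mem_ofPred_eq]; omega⟩ ?_
  unfold adj
  rw [Finset.sum_eq_single i]
  · simp [hz]
  · intro j _ hj; simp [Pi.single_eq_of_ne hj]
  · simp

lemma AXm (hd : 0 < d) (ha : Adm α) (hξ : IsXiFamily d P ξ) (h c : ℝ) (hc : 0 < c) (m : ℕ) (hm : 1 ≤ m)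
    (h1 : c ≤ P.real {ω | ConnIn (SS L α h (cfg ξ ω)) (box d (m : ℝ)) (bdry d ((2 * m : ℕ) : ℝ))}) :
    ∃ l, 2 * m ≤ l ∧ l ≤ 6 * m ∧ AX P ξ L α h l (6 * m) ((c / (4 * m + 1) ^ (2 * d)) ^ 2) := by
  obtain ⟨⟨w, v⟩, hi, hy⟩ := pigeon (fbox d 0 m ×ˢ (fbox d 0 (2 * m)).filter (fun v => dinf 0 v = 2 * m)) _
    (fun p => {ω | ConnIn (SS L α h (cfg ξ ω) ∩ {y | dinf 0 y ≤ 2 * m}) {p.1} {p.2}}) (fun ω hω => by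
    have := ConnIn.exit 0 (2 * m) hω (fun y hy => by have := mem_box.1 hy; omega) (fun y hy => ((mem_bdry hd).1 hy).ge)
    obtain ⟨p, hp, q, hq, hpq⟩ := ConnIn.exists this
    refine mem_biUnion (x := (p, q)) ?_ hpq
    simp only [Finset.coe_product, Finset.coe_filter, mem_prod, Finset.mem_coe, mem_fbox, mem_ofPred_eq]
    exact ⟨mem_box.1 hp, le_of_eq hq, hq⟩) hc h1 (N := (4 * m + 1) ^ (2 * d)) (by
    have e : (fbox d 0 m ×ˢ (fbox d 0 (2 * m)).filter (fun v => dinf 0 v = 2 * m)).card ≤ (4 * m + 1) ^ (2 * d) := by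
      rw [Finset.card_product, two_mul d, pow_add]
      refine Nat.mul_le_mul ?_ ((Finset.card_filter_le _ _).trans ?_) <;> rw [card_fbox] <;> exact Nat.pow_le_pow_left (by omega) _
    exact_mod_cast e) (by positivity)
  simp only [Finset.mem_product, Finset.mem_filter, mem_fbox] at hi
  obtain ⟨hw, -, hv⟩ := hi
  have hwn : ∀ i, (w i).natAbs ≤ m := fun i => by have := (dinf_le_iff _ _ _).1 hw i; simpa using this
  have hvn : ∀ i, (v i).natAbs ≤ 2 * m := fun i => by have := (dinf_le_iff _ _ _).1 hv.le i; simpa using this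
  obtain ⟨j, hj⟩ : ∃ j, (v j).natAbs = 2 * m := by
    by_contra hcon; push Not at hcon
    have : dinf 0 v ≤ 2 * m - 1 := (dinf_le_iff _ _ _).2 fun i => by
      have := hvn i; have := hcon i; simp; omega
    omega
  have c1 : c / (4 * m + 1) ^ (2 * d) ≤ cn P ξ L α h 0 (v - w) (3 * m) := by
    have e : c / (4 * m + 1) ^ (2 * d) ≤ cn P ξ L α h w v (3 * m) := by
      refine hy.trans (measureReal_mono (fun ω hω => hω.mono (fun y hy => ⟨hy.1, ?_⟩) subset_rfl subset_rfl) (measure_ne_top _ _))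
      have := dinf_tri w 0 y; have := dinf_comm w 0; have := hy.2; simp only [mem_ofPred_eq] at *; omega
    have := e.trans (cn_sym hξ (LSym.add (-w)) h w v (3 * m))
    simpa [sub_eq_add_neg] using this
  set u := v - w with hu
  have hun : ∀ i, (u i).natAbs ≤ 3 * m := fun i => by have := hwn i; have := hvn i; simp only [hu, Pi.sub_apply]; omega
  have huj : m ≤ (u j).natAbs := by have := hwn j; simp only [hu, Pi.sub_apply]; omega
  have hs : ∀ i, (fun i => if i = j then (1:ℤ) else -1) i * (fun i => if i = j then (1:ℤ) else -1) i = 1 := fun i => by dsimp only; split_ifs <;> simp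
  have c2 := c1.trans (cn_sym hξ (sgp_sym (Equiv.refl _) (fun i => if i = j then 1 else -1) hs) h 0 u (3 * m))
  rw [map_zero] at c2
  have c3 := cn_glue (ρ'' := 6 * m) hd ha hξ h (by positivity) c1 c2 (by omega) (by
    have : dinf 0 u ≤ 3 * m := (dinf_le_iff _ _ _).2 fun i => by simpa using hun i
    omega)
  have e : u + sgp (Equiv.refl _) (fun i => if i = j then 1 else -1) hs u = Pi.single j (2 * u j) := by
    ext i; show u i + (if i = j then 1 else -1) * u i = _
    by_cases hij : i = j
    · subst hij; simp; ring
    · simp [hij, Pi.single_eq_of_ne hij]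
  rw [e, ← pow_two] at c3
  refine ⟨(2 * u j).natAbs, ?_, ?_, AX_of hξ h rfl c3⟩
  · omega
  · have := hun j; omega

lemma tau_bound (hd : 0 < d) (ha : Adm α) (hξ : IsXiFamily d P ξ) (h c : ℝ) (hc : 0 < c) (W k : ℕ) (hW : 2 ≤ W) (hk : 5 ^ k * W < 6 ^ (k + 1))
    (hyp : ∀ n : ℕ, 1 ≤ n → n ≤ W → c ≤ P.real {ω | ConnIn (SS L α h (cfg ξ ω)) (box d (((n + 1) / 2 : ℕ) : ℝ)) (bdry d (n : ℝ))})
    (p q : V d) (hpq : dinf p q ≤ W) :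
    (((c / (2 * W + 1) ^ (2 * d)) ^ 2) ^ (k + 6)) ^ (d + 1) ≤ cn P ξ L α h p q (2 * W + 1) := by
  have hc1 : c ≤ 1 := (hyp 1 le_rfl (by omega)).trans measureReal_le_one
  have hWr : (2:ℝ) ≤ W := by exact_mod_cast hW
  have hb0 : 0 < c / (2 * W + 1) ^ (2 * d) := by positivity
  have hb1 : c / (2 * W + 1) ^ (2 * d) ≤ 1 := by
    rw [div_le_one (by positivity)]; exact hc1.trans (one_le_pow₀ (by linarith))
  have h01 := AX01 hd ha hξ h c hc (hyp 1 le_rfl (by omega))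
  have h3 : c / (2 * W + 1) ^ (2 * d) ≤ c / 3 ^ d := by
    refine div_le_div_of_nonneg_left hc.le (by positivity) ?_
    rw [two_mul d, pow_add]
    have a1 : (3:ℝ) ^ d ≤ (2 * W + 1) ^ d := pow_le_pow_left₀ (by norm_num) (by linarith) _
    have a2 : (1:ℝ) ≤ (2 * W + 1) ^ d := one_le_pow₀ (by linarith)
    nlinarith [pow_pos (show (0:ℝ) < 3 by norm_num) d]
  have hsq : (c / (2 * W + 1) ^ (2 * d)) ^ 2 ≤ c / (2 * W + 1) ^ (2 * d) := by nlinarith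
  have ind := AX_ind (L := L) (W := W) hd ha hξ h ((c / (2 * W + 1) ^ (2 * d)) ^ 2) (by positivity) (pow_le_one₀ hb0.le hb1)
    (fun i z hz => by
      rw [Int.natAbs_eq_zero.1 hz, Pi.single_zero]
      exact (hsq.trans h3).trans (h01.1.trans (cn_mono h _ _ (by omega))))
    (fun i z hz => (pow_le_pow_left₀ hb0.le h3 2).trans (h01.2 i z hz))
    (fun m hm hmW => by
      obtain ⟨l, l1, l2, l3⟩ := AXm hd ha hξ h c hc m hm (by have := hyp (2 * m) (by omega) hmW; rwa [show (2 * m + 1) / 2 = m by omega] at this)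
      refine ⟨l, l1, l2, fun i z hz => le_trans (pow_le_pow_left₀ hb0.le ?_ 2) (l3 i z hz)⟩
      have : (2 * m : ℝ) ≤ W := by exact_mod_cast hmW
      exact div_le_div_of_nonneg_left hc.le (by positivity) (pow_le_pow_left₀ (by positivity) (by linarith) _)) k
  have hch := cn_chain (D := W) hd ha hξ h _ (by positivity) (fun s hs => ind s hs (lt_of_le_of_lt (Nat.mul_le_mul_left _ hs) hk)) (q - p)
    (fun i => by have := (dinf_le_iff _ _ _).1 hpq i; simp only [Pi.sub_apply]; omega)
  have := hch.trans (cn_sym hξ (LSym.add p) h 0 (q - p) _)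
  simpa using this
end

section
variable {d L : ℕ} {α β : ℕ → ℝ} {Ω : Type*} [MeasurableSpace Ω] {P : Measure Ω} [IsProbabilityMeasure P] {ξ : ℕ → V d → Ω → ℝ}

def Psi (L : ℕ) (α β : ℕ → ℝ) (h κ : ℝ) (x : V d) (c : Cfg d) : ℝ := gchi L β c x - κ * (gchi L α c x - h)

def pr2 (L : ℕ) (α β : ℕ → ℝ) (x : V d) (c : Cfg d) : Bool → ℝ := fun b => gchi L (cond b α β) c x

lemma pr2_meas (hξ : IsXiFamily d P ξ) (x : V d) : Measurable (fun ω => pr2 L α β x (cfg ξ ω)) :=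
  measurable_pi_iff.2 fun b => (gf_gchi hξ L _).meas x

lemma psi_law (hξ : IsXiFamily d P ξ) (h κ : ℝ) (x : V d) {f : ℝ → ℝ} (hf : Measurable f) :
    IdentDistrib (fun ω => f (Psi L α β h κ x (cfg ξ ω))) (fun ω => f (Psi L α β h κ 0 (cfg ξ ω))) P P := by
  have e := GF.law_eq ((gf_gchi2 hξ L).comp (fun b : Bool => ((cond b α β : ℕ → ℝ), x))) ((gf_gchi2 hξ L).comp (fun b : Bool => ((cond b α β : ℕ → ℝ), (0 : V d)))) (fun i j => by
    simp only [cov_gchi hξ]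
    refine Finset.sum_congr rfl fun ℓ _ => ?_
    have := lazyP_add d ℓ (0 : V d) 0 x
    rw [← this, zero_add])
  have i : IdentDistrib (fun ω => pr2 L α β x (cfg ξ ω)) (fun ω => pr2 L α β 0 (cfg ξ ω)) P P :=
    ⟨(pr2_meas hξ x).aemeasurable, (pr2_meas hξ 0).aemeasurable, e⟩
  exact i.comp (u := fun v : Bool → ℝ => f (v false - κ * (v true - h))) (by fun_prop)

def CP (d r R m : ℕ) (x : V d) (S : Set (V d)) : Prop := Crs d r R (S ∪ {y | dinf x y ≤ m}) ∧ ¬ Crs d r R (S \ {y | dinf x y ≤ m})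

lemma CP_inter (hd : 0 < d) {r R m : ℕ} (hrR : r ≤ R) {x : V d} {T : Set (V d)} (hT : ∀ y, dinf 0 y ≤ R → m < dinf x y → y ∈ T) (S : Set (V d)) :
    CP d r R m x (S ∩ T) ↔ CP d r R m x S := by
  unfold CP
  rw [← Crs.inter_iff (S := S ∩ T ∪ _) hd hrR (T := {y | dinf 0 y ≤ R}) (fun y h => h), ← Crs.inter_iff (S := S ∪ _) hd hrR (T := {y | dinf 0 y ≤ R}) (fun y h => h),
    ← Crs.inter_iff (S := (S ∩ T) \ _) hd hrR (T := {y | dinf 0 y ≤ R}) (fun y h => h), ← Crs.inter_iff (S := S \ _) hd hrR (T := {y | dinf 0 y ≤ R}) (fun y h => h)]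
  have e1 : (S ∩ T ∪ {y | dinf x y ≤ m}) ∩ {y | dinf 0 y ≤ R} = (S ∪ {y | dinf x y ≤ m}) ∩ {y | dinf 0 y ≤ R} := by
    ext y; simp only [mem_inter_iff, mem_union, mem_ofPred_eq]
    have := hT y
    by_cases h : dinf x y ≤ m
    · simp [h]
    · have := fun h' => this h' (by omega); tauto
  have e2 : ((S ∩ T) \ {y | dinf x y ≤ m}) ∩ {y | dinf 0 y ≤ R} = (S \ {y | dinf x y ≤ m}) ∩ {y | dinf 0 y ≤ R} := by
    ext y; simp only [mem_inter_iff, mem_diff, mem_ofPred_eq]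
    have := hT y
    by_cases h : dinf x y ≤ m
    · simp [h]
    · have := fun h' => this h' (by omega); tauto
  rw [e1, e2]

lemma psi_indep (hξ : IsXiFamily d P ξ) (x : V d) (T : Finset (V d)) (hT : ∀ y ∈ T, L < dinf x y) :
    IndepFun (fun ω => pr2 L α β x (cfg ξ ω)) (fun ω => chiT L α T (cfg ξ ω)) P := by
  have g := (gf_gchi2 hξ L).comp (fun s : Bool ⊕ T => Sum.elim (fun b => ((cond b α β : ℕ → ℝ), x)) (fun y => (α, y.1)) s)
  have g' : GF P (Sum.elim (fun (b : Bool) ω => gchi L (cond b α β) (cfg ξ ω) x) (fun (y : T) ω => gchi L α (cfg ξ ω) y.1)) := by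
    convert g using 1
    funext s; rcases s with b | y <;> rfl
  refine g'.indep fun b y => ?_
  rw [cov_gchi hξ]
  refine Finset.sum_eq_zero fun ℓ hl => ?_
  have := hT y.1 y.2
  rw [lazyP_range _ _ _ _ (by simp at hl; omega)]; simp

lemma term_bound (hd : 0 < d) (hξ : IsXiFamily d P ξ) (h κ : ℝ) (x : V d) {f : ℝ → ℝ} (hf : Measurable f) (hf0 : ∀ s, 0 ≤ f s)
    (hi : Integrable (fun ω => f (Psi L α β h κ 0 (cfg ξ ω))) P) {r R : ℕ} (hrR : r ≤ R) (F : Ω → ℝ)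
    (hF : ∀ ω, F ω ≤ {ω | CP d r R L x (SS L α h (cfg ξ ω))}.indicator (fun ω => f (Psi L α β h κ x (cfg ξ ω))) ω) (hF0 : ∀ ω, 0 ≤ F ω) :
    ∫ ω, F ω ∂P ≤ (∫ ω, f (Psi L α β h κ 0 (cfg ξ ω)) ∂P) * P.real {ω | CP d r R L x (SS L α h (cfg ξ ω))} := by
  classical
  set T := (fbox d 0 R).filter (fun y => L < dinf x y) with hTdef
  have hT : ∀ y, dinf 0 y ≤ R → L < dinf x y → y ∈ (T : Set (V d)) := fun y h1 h2 => by simp [hTdef, mem_fbox, h1, h2]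
  have hG := meas_opn T h (CP d r R L x)
  have hE : {ω | CP d r R L x (SS L α h (cfg ξ ω))} = (fun ω => chiT L α T (cfg ξ ω)) ⁻¹' {v | CP d r R L x (opn T h v)} := by
    ext ω; simp only [mem_preimage, mem_ofPred_eq, opn_SS]; exact (CP_inter hd hrR hT _).symm
  have hEm : MeasurableSet {ω | CP d r R L x (SS L α h (cfg ξ ω))} := by rw [hE]; exact chiT_meas hξ T hG
  have hix := (psi_law (L := L) (α := α) (β := β) hξ h κ x hf).integrable_iff.2 hi
  have hgm : Measurable (fun v => {v | CP d r R L x (opn T h v)}.indicator (fun _ => (1:ℝ)) v) := measurable_const.indicator hG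
  have ind := (psi_indep (α := α) (β := β) hξ x T (fun y hy => (Finset.mem_filter.1 hy).2)).comp (φ := fun v : Bool → ℝ => f (v false - κ * (v true - h)))
    (ψ := fun v => {v | CP d r R L x (opn T h v)}.indicator (fun _ => (1:ℝ)) v) (by fun_prop) hgm
  have hm := ind.integral_fun_mul_eq_mul_integral hix.1 (hgm.comp (chiT_meas hξ T)).aestronglyMeasurable
  have e2 : ∀ ω, ((fun v => {v | CP d r R L x (opn T h v)}.indicator (fun _ => (1:ℝ)) v) ∘ fun ω => chiT L α T (cfg ξ ω)) ω = {ω | CP d r R L x (SS L α h (cfg ξ ω))}.indicator (fun _ => 1) ω := by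
    intro ω; rw [hE]; rfl
  have e3 : ∫ ω, ((fun v => {v | CP d r R L x (opn T h v)}.indicator (fun _ => (1:ℝ)) v) ∘ fun ω => chiT L α T (cfg ξ ω)) ω ∂P = P.real {ω | CP d r R L x (SS L α h (cfg ξ ω))} := by
    rw [integral_congr_ae (Filter.Eventually.of_forall e2), integral_indicator_const _ hEm]; simp
  rw [e3] at hm
  have e4 := (psi_law (L := L) (α := α) (β := β) hξ h κ x hf).integral_eq
  rw [← e4]
  refine (integral_mono_of_nonneg (Filter.Eventually.of_forall hF0) (hix.indicator hEm) (Filter.Eventually.of_forall hF)).trans (le_of_eq (Eq.trans ?_ hm))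
  refine integral_congr_ae (Filter.Eventually.of_forall fun ω => ?_)
  simp only [e2]
  by_cases hω : CP d r R L x (SS L α h (cfg ξ ω))
  · rw [indicator_of_mem (s := {ω | CP d r R L x (SS L α h (cfg ξ ω))}) hω, indicator_of_mem (s := {ω | CP d r R L x (SS L α h (cfg ξ ω))}) hω, mul_one]; rfl
  · rw [indicator_of_notMem (s := {ω | CP d r R L x (SS L α h (cfg ξ ω))}) hω, indicator_of_notMem (s := {ω | CP d r R L x (SS L α h (cfg ξ ω))}) hω, mul_zero]

/-- blocking estimate, translated -/
lemma eta_bound (hξ : IsXiFamily d P ξ) (h η : ℝ) (x : V d) (m n : ℕ) (T : Finset (V d))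
    (h0 : η ≤ P.real {ω | ¬ ConnIn (SS L α h (cfg ξ ω)) {y | dinf 0 y ≤ m} {y | dinf 0 y = n}}) :
    η ≤ P.real {ω | ¬ ConnIn (opn T h (chiT L α T (cfg ξ ω)) ∩ {y | dinf x y ≤ n}) {y | dinf x y ≤ m} {y | dinf x y = n}} := by
  have l := law_inv (L := L) (α := α) hξ (LSym.add x) (fbox d 0 n) h (fun S => ¬ ConnIn S {y | dinf 0 y ≤ m} {y | dinf 0 y = n})
  have h1 : η ≤ P.real {ω | ¬ ConnIn (SS L α h (cfg ξ ω) ∩ (fbox d 0 n : Finset (V d))) {y | dinf 0 y ≤ m} {y | dinf 0 y = n}} :=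
    h0.trans (measureReal_mono (fun ω hω hc => hω (ConnIn.mono inter_subset_left subset_rfl subset_rfl hc)) (measure_ne_top _ _))
  refine h1.trans (l.le.trans (measureReal_mono (fun ω hω hc => hω ?_) (measure_ne_top _ _)))
  have hz : ∀ y, dinf 0 (y + -x) = dinf x y := fun y => by have := dinf_add 0 (y + -x) x; simpa using this.symm
  refine ConnIn.map (f := fun y => y + -x) (fun _ _ => adj_add _) hc ?_ ?_ ?_
  · rintro y ⟨hy, hy'⟩; rw [opn_SS] at hy
    refine ⟨?_, by rw [coe_fbox]; simpa [hz] using hy'⟩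
    have := hy.1; simpa [SS] using this
  · intro y hy; simpa [hz] using hy
  · intro y hy; simpa [hz] using hy

lemma qh_eq {ℓ₀ L₀ : ℕ} {t : ℝ} (hd : 0 < d) (h1 : 1 ≤ ℓ₀) (h : ℝ) {r R R' : ℕ} (hrR : r ≤ R) (hR : R ≤ R') (y : V d) :
    qh P ξ (Lsc ℓ₀ L₀ ⌈t⌉₊) (alphaT ℓ₀ L₀ t) (fbox d 0 R') h (Crs d r R) y =
      (P {ω | shiftCfg d ℓ₀ L₀ t y h (cfg ξ ω) ∈ PivSet d ℓ₀ L₀ t h r R y}).toReal := by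
  have e : ∀ c : Cfg d, opn (fbox d 0 R') h (vhat (Lsc ℓ₀ L₀ ⌈t⌉₊) (alphaT ℓ₀ L₀ t) (fbox d 0 R') h y c) =
      {z | h ≤ chiFun d ℓ₀ L₀ t (shiftCfg d ℓ₀ L₀ t y h c) z} ∩ (fbox d 0 R' : Finset (V d)) := by
    intro c; ext z
    simp only [opn, vhat, chiFun_eq h1, gchi_shift h1, Kf, pow_two, mem_ofPred_eq, mem_inter_iff, Finset.mem_coe, exists_prop, and_comm]
  unfold qh
  rw [measureReal_def]
  congr 2
  ext ω
  simp only [mem_ofPred_eq, e]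
  exact PivS.inter_iff hd hrR (T := (fbox d 0 R' : Finset (V d))) (fun y hy => by simp [mem_fbox]; omega)

lemma piv_CP {ℓ₀ L₀ : ℕ} {t : ℝ} (h1 : 1 ≤ ℓ₀) (h : ℝ) {r R : ℕ} (x : V d) (c : Cfg d)
    (hc : shiftCfg d ℓ₀ L₀ t x h c ∈ PivSet d ℓ₀ L₀ t h r R x) : CP d r R (Lsc ℓ₀ L₀ ⌈t⌉₊) x (SS (Lsc ℓ₀ L₀ ⌈t⌉₊) (alphaT ℓ₀ L₀ t) h c) := by
  have e : ∀ z, Lsc ℓ₀ L₀ ⌈t⌉₊ < dinf x z → chiFun d ℓ₀ L₀ t (shiftCfg d ℓ₀ L₀ t x h c) z = gchi (Lsc ℓ₀ L₀ ⌈t⌉₊) (alphaT ℓ₀ L₀ t) c z := by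
    intro z hz
    rw [chiFun_eq h1, gchi_shift h1, Finset.sum_eq_zero, zero_div, zero_mul, sub_zero]
    intro ℓ hl; rw [lazyP_range _ _ _ _ (by rw [dinf_comm]; simp at hl; omega)]; simp
  refine ⟨Crs.mono ?_ hc.1, fun hh => hc.2 (Crs.mono ?_ hh)⟩
  · rintro z (hz | rfl)
    · by_cases hx : dinf x z ≤ Lsc ℓ₀ L₀ ⌈t⌉₊
      · right; exact hx
      · left; rw [mem_ofPred_eq, e z (by omega)] at hz; exact hz
    · right; simp [dinf_self]
  · rintro z ⟨hz, hx⟩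
    have hx' : Lsc ℓ₀ L₀ ⌈t⌉₊ < dinf x z := by simpa using hx
    refine ⟨by rw [mem_ofPred_eq, e z hx']; exact hz, ?_⟩
    rintro rfl; simp [dinf_self] at hx'
end

section
variable {d L : ℕ} {α β : ℕ → ℝ} {Ω : Type*} [MeasurableSpace Ω] {P : Measure Ω} [IsProbabilityMeasure P] {ξ : ℕ → V d → Ω → ℝ}

lemma CP_one (hd : 0 < d) (ha : Adm α) (hξ : IsXiFamily d P ξ) (h c : ℝ) (hc : 0 < c) (hL : 1 ≤ L) (k n₀ r R : ℕ) (hk : 5 ^ k * (2 * L) < 6 ^ (k + 1))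
    (hn₀ : L ≤ n₀) (hr : 2 * r ≤ R) (hR : 4 * n₀ < R) 
    (hyp : ∀ n : ℕ, 1 ≤ n → n ≤ 2 * L → c ≤ P.real {ω | ConnIn (SS L α h (cfg ξ ω)) (box d (((n + 1) / 2 : ℕ) : ℝ)) (bdry d (n : ℝ))})
    (hyp2 : c / n₀ ^ d ≤ P.real {ω | ¬ ConnIn (SS L α h (cfg ξ ω)) {y | dinf 0 y ≤ L} {y | dinf 0 y = n₀}}) (x : V d) (hx : x ∈ fbox d 0 R) :
    P.real {ω | CP d r R L x (SS L α h (cfg ξ ω))} ≤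
      2 * ((1 + (((2 * L + 1) ^ d : ℕ) : ℝ) ^ 2 / (((c / (2 * (2 * L : ℕ) + 1) ^ (2 * d)) ^ 2) ^ (k + 6)) ^ (d + 1)) / (c / n₀ ^ d)) *
      (2 * (1 + ((20 * n₀) ^ d : ℕ) * (L + 1)) * ∑ y ∈ fbox d x (n₀ + 7 * L + 1), qh P ξ L α (fbox d 0 (R + 20 * n₀)) h (Crs d r R) y) := by
  have hx0 : dinf 0 x ≤ R := mem_fbox.1 hx
  have hn0r : (1:ℝ) ≤ n₀ := by exact_mod_cast hL.trans hn₀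
  have hb := fun z₁ z₂ hz => tau_bound (L := L) (α := α) hd ha hξ h c hc (2 * L) k (by omega) hk hyp z₁ z₂ hz
  have hsub : fbox d x (n₀ + 7 * L + 1) ⊆ fbox d 0 (R + 20 * n₀) := fun y hy => by
    rw [mem_fbox] at hy ⊢; have := dinf_tri 0 x y; omega
  have hη1 : c / (n₀:ℝ) ^ d ≤ 1 := hyp2.trans measureReal_le_one
  have hcp := cp_bound (L := L) (α := α) (P := P) (ξ := ξ) hd ha hξ (fbox d 0 (R + 20 * n₀)) x (n₀ + 6 * L + 1) L n₀ (5 * L + 1) r R (fbox d x (n₀ + 7 * L + 1)) hsub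
    (fun y _ hy => by rw [mem_fbox] at hy; omega) (by omega) (by omega) hn₀ (by omega) h ((((c / (2 * (2 * L : ℕ) + 1) ^ (2 * d)) ^ 2) ^ (k + 6)) ^ (d + 1)) (c / n₀ ^ d) (by positivity) (by positivity) hη1
    (fun z₁ h₁ z₂ h₂ => by
      rw [mem_fbox] at h₁ h₂
      refine (hb z₁ z₂ (by have := dinf_tri z₁ x z₂; rw [dinf_comm z₁ x] at this; omega)).trans ?_
      refine measureReal_mono (fun ω hω => ?_) (measure_ne_top _ _)
      refine ConnIn.mono ?_ subset_rfl subset_rfl hω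
      rintro y ⟨hy, hy'⟩
      have hy2 : dinf x y ≤ 5 * L + 1 := by have := dinf_tri x z₁ y; have h3 : dinf z₁ y ≤ 2 * (2 * L) + 1 := hy'; omega
      rw [opn_SS]
      refine ⟨⟨hy, ?_⟩, hy2⟩
      simp only [Finset.mem_coe, mem_fbox]; have := dinf_tri 0 x y; omega)
    (eta_bound hξ h _ x L n₀ _ hyp2)
  have e : {ω | CP d r R L x (SS L α h (cfg ξ ω))} = {ω | Crs d r R (opn (fbox d 0 (R + 20 * n₀)) h (chiT L α (fbox d 0 (R + 20 * n₀)) (cfg ξ ω)) ∪ {y | dinf x y ≤ L}) ∧ ¬ Crs d r R (opn (fbox d 0 (R + 20 * n₀)) h (chiT L α (fbox d 0 (R + 20 * n₀)) (cfg ξ ω)) \ {y | dinf x y ≤ L})} := by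
    ext ω; simp only [mem_ofPred_eq, opn_SS]
    exact (CP_inter hd (by omega : r ≤ R) (T := (fbox d 0 (R + 20 * n₀) : Finset (V d))) (fun y h _ => by simp [mem_fbox]; omega) _).symm
  rw [e]
  refine hcp.trans ?_
  rw [card_fbox, card_fbox]
  gcongr
  · exact Finset.sum_nonneg fun y _ => measureReal_nonneg
  · omega

lemma A_le (c l n N : ℝ) (hc : 0 < c) (hc1 : c ≤ 1) (d k : ℕ) (hd : 1 ≤ d) (hLr : 1 ≤ l) (hLn : l ≤ n) (hN' : N = 20 * n) :
    2 * ((1 + ((2 * l + 1) ^ d) ^ 2 / (((c / (2 * (2 * l) + 1) ^ (2 * d)) ^ 2) ^ (k + 6)) ^ (d + 1)) / (c / n ^ d)) *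
      (2 * (1 + N ^ d * (l + 1))) * N ^ d ≤ (N ^ (2 * d) / c) ^ (2 * (k + 6) * (d + 1) + 4) := by
  have hN20 : 20 ≤ N := by rw [hN']; linarith
  have hN1 : 1 ≤ N := by linarith
  have hl0 : 0 < l := by linarith
  have hn0 : 0 < n := by linarith
  obtain ⟨Y, hY⟩ : ∃ Y, Y = N ^ (2 * d) / c := ⟨_, rfl⟩
  rw [← hY]
  have hY1 : 1 ≤ Y := by rw [hY, one_le_div hc]; exact hc1.trans (one_le_pow₀ hN1)
  have h1 : 1 / (((c / (2 * (2 * l) + 1) ^ (2 * d)) ^ 2) ^ (k + 6)) ^ (d + 1) ≤ Y ^ (2 * (k + 6) * (d + 1)) := by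
    rw [← pow_mul, ← pow_mul, one_div, ← inv_pow, inv_div, mul_assoc 2]
    refine pow_le_pow_left₀ (by positivity) ?_ _
    rw [hY]; gcongr; rw [hN']; nlinarith
  have hX1 : 1 ≤ Y ^ (2 * (k + 6) * (d + 1)) := one_le_pow₀ hY1
  rw [pow_add Y]
  have hτ : 0 < (((c / (2 * (2 * l) + 1) ^ (2 * d)) ^ 2) ^ (k + 6)) ^ (d + 1) := by positivity
  generalize (((c / (2 * (2 * l) + 1) ^ (2 * d)) ^ 2) ^ (k + 6)) ^ (d + 1) = τ at *
  generalize Y ^ (2 * (k + 6) * (d + 1)) = X at *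
  have h2 : ((2 * l + 1) ^ d) ^ 2 ≤ N ^ (2 * d) := by
    rw [← pow_mul, mul_comm d 2]; refine pow_le_pow_left₀ (by positivity) (by rw [hN']; linarith) _
  have hp : 1 ≤ N ^ (2 * d) := one_le_pow₀ hN1
  have h3 : 1 + ((2 * l + 1) ^ d) ^ 2 / τ ≤ 2 * (N ^ (2 * d) * X) := by
    rw [div_eq_mul_one_div]
    have : ((2 * l + 1) ^ d) ^ 2 * (1 / τ) ≤ N ^ (2 * d) * X := mul_le_mul h2 h1 (by positivity) (by positivity)
    nlinarith
  have h4 : 1 / (c / n ^ d) ≤ N ^ d / c := by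
    rw [one_div, inv_div]; gcongr; rw [hN']; linarith
  have h5 : 2 * (1 + N ^ d * (l + 1)) ≤ 4 * N ^ (d+1) := by
    have : N ^ d * (l+1) ≤ N ^ (d+1) := by rw [pow_succ]; gcongr; rw [hN']; linarith
    have : 1 ≤ N ^ (d+1) := one_le_pow₀ hN1
    linarith
  rw [div_eq_mul_one_div (1 + _)]
  have h6 : ∀ a b c a' b' c' : ℝ, 0 ≤ a → 0 ≤ b → 0 ≤ c → a ≤ a' → b ≤ b' → c ≤ c' → 2 * (a * b) * c ≤ 2 * (a' * b') * c' := by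
    intro a b c a' b' c' ha hb hc h h' h''; gcongr
    · have := ha.trans h; have := hb.trans h'; positivity
    · exact ha.trans h
  have hN0 : 0 < N := by linarith
  calc _ ≤ 2 * (2 * (N ^ (2 * d) * X) * (N ^ d / c)) * (4 * N ^ (d+1)) * N ^ d := by
        refine mul_le_mul_of_nonneg_right ?_ (by positivity)
        exact h6 _ _ _ _ _ _ (by positivity) (by positivity) (by positivity) h3 h4 h5
    _ = X * ((16 * N ^ (5 * d + 1)) / c) := by
        rw [show 5 * d + 1 = 2 * d + d + (d + 1) + d by ring, pow_add, pow_add, pow_add]; ring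
    _ ≤ X * Y ^ 4 := by
        refine mul_le_mul_of_nonneg_left ?_ (by linarith)
        rw [hY, div_pow]
        refine div_le_div₀ (by positivity) ?_ (by positivity) ?_
        · rw [← pow_mul]
          calc 16 * N ^ (5 * d + 1) ≤ N * N ^ (5 * d + 1) := by gcongr; linarith
            _ = N ^ (5 * d + 2) := by ring
            _ ≤ _ := pow_le_pow_right₀ hN1 (by omega)
        · exact pow_le_of_le_one hc.le hc1 (by norm_num)

lemma CP_sum (hd : 0 < d) (ha : Adm α) (hξ : IsXiFamily d P ξ) (h c : ℝ) (hc : 0 < c) (hL : 1 ≤ L) (k n₀ r R : ℕ) (hk : 5 ^ k * (2 * L) < 6 ^ (k + 1))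
    (hn₀ : L ≤ n₀) (hr : 2 * r ≤ R) (hR : 4 * n₀ < R) 
    (hyp : ∀ n : ℕ, 1 ≤ n → n ≤ 2 * L → c ≤ P.real {ω | ConnIn (SS L α h (cfg ξ ω)) (box d (((n + 1) / 2 : ℕ) : ℝ)) (bdry d (n : ℝ))})
    (hyp2 : c / n₀ ^ d ≤ P.real {ω | ¬ ConnIn (SS L α h (cfg ξ ω)) {y | dinf 0 y ≤ L} {y | dinf 0 y = n₀}}) :
    ∑ x ∈ fbox d 0 R, P.real {ω | CP d r R L x (SS L α h (cfg ξ ω))} ≤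
      (((20 * n₀ : ℕ) : ℝ) ^ (2 * d) / c) ^ (2 * (k + 6) * (d + 1) + 4) * ∑ y ∈ fbox d 0 (R + 20 * n₀), qh P ξ L α (fbox d 0 (R + 20 * n₀)) h (Crs d r R) y := by
  classical
  have hc1 : c ≤ 1 := (hyp 1 le_rfl (by omega)).trans measureReal_le_one
  have hq : ∀ y, 0 ≤ qh P ξ L α (fbox d 0 (R + 20 * n₀)) h (Crs d r R) y := fun y => measureReal_nonneg
  have h0 := Finset.sum_le_sum fun x hx => CP_one (L := L) (α := α) (P := P) (ξ := ξ) hd ha hξ h c hc hL k n₀ r R hk hn₀ hr hR hyp hyp2 x hx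
  refine h0.trans ?_
  rw [← Finset.mul_sum, ← Finset.mul_sum]
  have h1 : ∑ x ∈ fbox d 0 R, ∑ y ∈ fbox d x (n₀ + 7 * L + 1), qh P ξ L α (fbox d 0 (R + 20 * n₀)) h (Crs d r R) y ≤
      (20 * n₀) ^ d * ∑ y ∈ fbox d 0 (R + 20 * n₀), qh P ξ L α (fbox d 0 (R + 20 * n₀)) h (Crs d r R) y := by
    rw [Finset.sum_comm' (t' := fbox d 0 (R + 20 * n₀)) (s' := fun y => (fbox d 0 R).filter (fun x => dinf x y ≤ n₀ + 7 * L + 1)), Finset.mul_sum]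
    · refine Finset.sum_le_sum fun y hy => ?_
      rw [Finset.sum_const, nsmul_eq_mul]
      refine mul_le_mul_of_nonneg_right ?_ (hq y)
      have h3 : ((fbox d 0 R).filter (fun x => dinf x y ≤ n₀ + 7 * L + 1)).card ≤ (fbox d y (n₀ + 7 * L + 1)).card :=
        Finset.card_le_card fun x hx => by rw [mem_fbox, dinf_comm]; exact (Finset.mem_filter.1 hx).2
      rw [card_fbox] at h3
      have h4 : (2 * (n₀ + 7 * L + 1) + 1) ^ d ≤ (20 * n₀) ^ d := Nat.pow_le_pow_left (by omega) _
      exact_mod_cast h3.trans h4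
    · intro x y
      simp only [mem_fbox, Finset.mem_filter]
      constructor
      · rintro ⟨a, b⟩; have := dinf_tri 0 x y; refine ⟨⟨a, b⟩, by omega⟩
      · rintro ⟨⟨a, b⟩, _⟩; exact ⟨a, b⟩
  have hLr : (1:ℝ) ≤ L := by exact_mod_cast hL
  have hLn : (L:ℝ) ≤ n₀ := by exact_mod_cast hn₀
  have h2 := A_le c L n₀ (20 * n₀) hc hc1 d k hd hLr hLn rfl
  have hB := Finset.sum_nonneg fun y (_ : y ∈ fbox d 0 (R + 20 * n₀)) => hq y
  generalize (∑ y ∈ fbox d 0 (R + 20 * n₀), qh P ξ L α (fbox d 0 (R + 20 * n₀)) h (Crs d r R) y) = B at *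
  push_cast
  refine le_trans ?_ (mul_le_mul_of_nonneg_right h2 hB)
  have hτ : 0 < ((((c / (2 * (2 * (L:ℝ)) + 1) ^ (2 * d)) ^ 2) ^ (k + 6)) ^ (d + 1)) := by positivity
  generalize ((((c / (2 * (2 * (L:ℝ)) + 1) ^ (2 * d)) ^ 2) ^ (k + 6)) ^ (d + 1)) = τ at *
  rw [mul_assoc _ _ B, mul_assoc _ (2 * _) (_ * B)]
  have hn : (0:ℝ) < n₀ := by linarith
  gcongr
end

section
variable {d L : ℕ} {α β : ℕ → ℝ} {Ω : Type*} [MeasurableSpace Ω] {P : Measure Ω} [IsProbabilityMeasure P] {ξ : ℕ → V d → Ω → ℝ}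

def kap (d ℓ₀ L₀ : ℕ) (t : ℝ) : ℝ := (∑ ℓ ∈ Finset.range (Lsc ℓ₀ L₀ ⌈t⌉₊ + 1), betaT ℓ₀ L₀ t ℓ * alphaT ℓ₀ L₀ t ℓ * ((1/2) * lazyP d ℓ 0 0)) /
        Kf d (Lsc ℓ₀ L₀ ⌈t⌉₊) (alphaT ℓ₀ L₀ t) 0 0

lemma psi_shift {ℓ₀ L₀ : ℕ} {t : ℝ} (h1 : 1 ≤ ℓ₀) (h : ℝ) (x : V d) (c : Cfg d) :
    psiFun d ℓ₀ L₀ t (shiftCfg d ℓ₀ L₀ t x h c) x = Psi (Lsc ℓ₀ L₀ ⌈t⌉₊) (alphaT ℓ₀ L₀ t) (betaT ℓ₀ L₀ t) h (kap d ℓ₀ L₀ t) x c := by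
  have e : ∀ ℓ, lazyP d ℓ x x = lazyP d ℓ 0 0 := fun ℓ => by have := lazyP_add d ℓ 0 0 x; simpa using this
  have e' : Kf d (Lsc ℓ₀ L₀ ⌈t⌉₊) (alphaT ℓ₀ L₀ t) x x = Kf d (Lsc ℓ₀ L₀ ⌈t⌉₊) (alphaT ℓ₀ L₀ t) 0 0 := by
    have := Kf_add (d := d) (L := Lsc ℓ₀ L₀ ⌈t⌉₊) (α := alphaT ℓ₀ L₀ t) 0 0 x; simpa using this
  rw [psiFun_eq h1, gchi_shift h1, Psi, kap, e']
  simp only [e]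

lemma piv_out {ℓ₀ L₀ : ℕ} {t h : ℝ} (hd : 0 < d) {r R : ℕ} (hrR : r ≤ R) {x : V d} (hx : x ∉ fbox d 0 R) (c : Cfg d) : c ∉ PivSet d ℓ₀ L₀ t h r R x := fun hc =>
  hx (mem_fbox.2 (PivS.dinf_le (S := {y | h ≤ chiFun d ℓ₀ L₀ t c y}) hd hrR hc))

lemma n0_ex {t : ℝ} (ht : 1 ≤ t) : ∃ n₀ : ℕ, 1000 ^ ⌈t⌉₊ ≤ n₀ ∧ ((1000 ^ ⌈t⌉₊ : ℕ) : ℝ) ≤ ufn n₀ ∧ 20 * (n₀ : ℝ) ≤ Real.exp (2748 * t ^ 3) := by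
  set L : ℕ := 1000 ^ ⌈t⌉₊ with hL
  have hc1 : 1 ≤ ⌈t⌉₊ := Nat.one_le_iff_ne_zero.2 (by positivity)
  have hLr : ((L:ℕ):ℝ) = 1000 ^ ⌈t⌉₊ := by push_cast [hL]; rfl
  have hL1 : (1000:ℝ) ≤ L := by rw [hLr]; exact le_self_pow₀ (by norm_num) (by omega)
  have hc2 : (⌈t⌉₊ : ℝ) ≤ 2 * t := by have := Nat.ceil_lt_add_one (by linarith : 0 ≤ t); linarith
  have hl7 : Real.log 1000 ≤ 7 := by
    rw [Real.log_le_iff_le_exp (by norm_num)]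
    have := Real.exp_one_gt_d9
    calc (1000:ℝ) ≤ 2.7 ^ 7 := by norm_num
      _ ≤ Real.exp 1 ^ 7 := by gcongr; linarith
      _ = _ := by rw [← Real.exp_nat_mul]; norm_num
  have hlog : Real.log L ≤ 14 * t := by
    rw [hLr, Real.log_pow]
    have := Real.log_nonneg (by norm_num : (1:ℝ) ≤ 1000)
    nlinarith
  have hlog1 : 1 ≤ Real.log L := by
    rw [Real.le_log_iff_exp_le (by linarith)]; have := Real.exp_one_lt_d9; linarith
  have hn0 : Real.exp (Real.log L ^ 3) ≤ (⌈Real.exp (Real.log L ^ 3)⌉₊ : ℝ) := Nat.le_ceil _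
  have hLle : (L:ℝ) ≤ Real.exp (Real.log L ^ 3) := by
    conv_lhs => rw [← Real.exp_log (by linarith : (0:ℝ) < L)]
    exact Real.exp_le_exp.2 (le_self_pow₀ hlog1 (by norm_num))
  refine ⟨⌈Real.exp (Real.log L ^ 3)⌉₊, ?_, ?_, ?_⟩
  · exact_mod_cast hLle.trans hn0
  · unfold ufn
    conv_lhs => rw [← Real.exp_log (by linarith : (0:ℝ) < L)]
    apply Real.exp_le_exp.2
    calc Real.log L = (Real.log L ^ 3) ^ ((1:ℝ)/3) := by
          rw [← Real.rpow_natCast, ← Real.rpow_mul (by linarith)]; norm_num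
      _ ≤ _ := by
          refine Real.rpow_le_rpow (by positivity) ?_ (by norm_num)
          rw [Real.le_log_iff_exp_le (lt_of_lt_of_le (Real.exp_pos _) hn0)]; exact hn0
  · have h1 := Nat.ceil_lt_add_one (Real.exp_pos (Real.log L ^ 3)).le
    have h2 : Real.exp (Real.log L ^ 3) ≤ Real.exp (2744 * t ^ 3) := by
      apply Real.exp_le_exp.2
      calc Real.log L ^ 3 ≤ (14 * t) ^ 3 := by gcongr
        _ = _ := by ring
    have h3 : 1 ≤ Real.exp (2744 * t ^ 3) := Real.one_le_exp (by positivity)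
    have h4 : 40 ≤ Real.exp (4 * t ^ 3) := by
      have := Real.exp_one_gt_d9
      have h5 : (1:ℝ) ≤ t ^ 3 := one_le_pow₀ ht
      calc (40:ℝ) ≤ 2.7 ^ 4 := by norm_num
        _ ≤ Real.exp 1 ^ 4 := by gcongr; linarith
        _ = Real.exp 4 := by rw [← Real.exp_nat_mul]; norm_num
        _ ≤ _ := Real.exp_le_exp.2 (by linarith)
    rw [show 2748 * t ^ 3 = 4 * t ^ 3 + 2744 * t ^ 3 by ring, Real.exp_add]
    nlinarith

lemma hk_pow (j : ℕ) : 5 ^ (38 * j) * (2 * 1000 ^ j) < 6 ^ (38 * j + 1) := by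
  rw [pow_mul, pow_succ 6, pow_mul 6]
  have : (5 ^ 38 * 1000) ^ j ≤ (6 ^ 38) ^ j := Nat.pow_le_pow_left (by norm_num) j
  rw [mul_pow] at this
  have h2 : 0 < (6 ^ 38) ^ j := by positivity
  nlinarith

/-- numerical constant -/
def Cf (d : ℕ) (c : ℝ) : ℝ := (5496 * d + |Real.log c|) * (164 * (d + 1) + 4) + 2748 * d + 2749

lemma Cnum {c t N : ℝ} (hc : 0 < c) (hc1 : c ≤ 1) (ht : 1 ≤ t) (hN : 1 ≤ N) (hN2 : N ≤ Real.exp (2748 * t ^ 3)) (d : ℕ) :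
    (N ^ (2 * d) / c) ^ (2 * (38 * ⌈t⌉₊ + 6) * (d + 1) + 4) ≤ Real.exp (Cf d c * t ^ 18) := by
  have hc2 : (⌈t⌉₊ : ℝ) ≤ 2 * t := by have := Nat.ceil_lt_add_one (by linarith : 0 ≤ t); linarith
  have h3 : (1:ℝ) ≤ t ^ 3 := one_le_pow₀ ht
  have h1 : N ^ (2 * d) / c ≤ Real.exp ((5496 * d + |Real.log c|) * t ^ 3) := by
    rw [div_le_iff₀ hc]
    have e : c = Real.exp (-|Real.log c|) := by rw [abs_of_nonpos (Real.log_nonpos hc.le hc1), neg_neg, Real.exp_log hc]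
    calc N ^ (2 * d) ≤ Real.exp (2748 * t ^ 3) ^ (2 * d) := by gcongr
      _ = Real.exp (5496 * d * t ^ 3) := by rw [← Real.exp_nat_mul]; push_cast; ring_nf
      _ ≤ Real.exp ((5496 * d + |Real.log c|) * t ^ 3 + -|Real.log c|) := by
          apply Real.exp_le_exp.2; nlinarith [abs_nonneg (Real.log c)]
      _ = Real.exp ((5496 * d + |Real.log c|) * t ^ 3) * Real.exp (-|Real.log c|) := Real.exp_add _ _
      _ = _ := by rw [← e]
  refine (pow_le_pow_left₀ (by positivity) h1 _).trans ?_
  rw [← Real.exp_nat_mul]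
  apply Real.exp_le_exp.2
  push_cast
  have hA : 0 ≤ 5496 * (d:ℝ) + |Real.log c| := by positivity
  have hdd : (0:ℝ) ≤ d := by positivity
  have h2 : 2 * (38 * (⌈t⌉₊:ℝ) + 6) * (d + 1) + 4 ≤ (164 * (d + 1) + 4) * t := by nlinarith
  have h4 : t ^ 4 ≤ t ^ 18 := pow_le_pow_right₀ ht (by norm_num)
  have hB : 0 ≤ (5496 * (d:ℝ) + |Real.log c|) * (164 * (d + 1) + 4) := by positivity
  calc _ ≤ (164 * (d + 1) + 4) * t * ((5496 * d + |Real.log c|) * t ^ 3) := by gcongr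
    _ = (5496 * d + |Real.log c|) * (164 * (d + 1) + 4) * t ^ 4 := by ring
    _ ≤ (5496 * d + |Real.log c|) * (164 * (d + 1) + 4) * t ^ 18 := by gcongr
    _ ≤ _ := by unfold Cf; have : 0 ≤ t ^ 18 := by positivity
                nlinarith

lemma regA {t : ℝ} (ht : 1 ≤ t) {N : ℝ} (hN2 : 20 * N ≤ Real.exp (2748 * t ^ 3)) (c : ℝ) {d r R : ℕ} (hR : (R:ℝ) ≤ 4 * N) (hr : r ≤ R) (hR1 : 1 ≤ R) :
    ((2 * R + 1) ^ d : ℝ) ≤ Real.exp (Cf d c * t ^ 3 - (r : ℝ) ^ (1:ℝ) * Real.exp (-(Cf d c * t ^ 3))) := by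
  have h3 : (1:ℝ) ≤ t ^ 3 := one_le_pow₀ ht
  have hR1' : (1:ℝ) ≤ R := by exact_mod_cast hR1
  have hr' : (r:ℝ) ≤ R := by exact_mod_cast hr
  have hC : 2748 * d + 2749 ≤ Cf d c := by unfold Cf; have := abs_nonneg (Real.log c); have : 0 ≤ (5496 * (d:ℝ) + |Real.log c|) * (164 * (d + 1) + 4) := by positivity
                                           linarith
  have hd0 : (0:ℝ) ≤ d := by positivity
  have h1 : (r:ℝ) * Real.exp (-(Cf d c * t ^ 3)) ≤ 1 := by
    rw [Real.exp_neg, ← div_eq_mul_inv, div_le_one (Real.exp_pos _)]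
    have : Real.exp (2748 * t ^ 3) ≤ Real.exp (Cf d c * t ^ 3) := Real.exp_le_exp.2 (by gcongr; linarith)
    linarith
  have h2 : ((2 * R + 1) ^ d : ℝ) ≤ Real.exp (2748 * t ^ 3) ^ d := by gcongr; linarith
  refine h2.trans ?_
  rw [← Real.exp_nat_mul, Real.rpow_one]
  apply Real.exp_le_exp.2
  nlinarith

lemma main_c (hd : 0 < d) (hξ : IsXiFamily d P ξ) {c : ℝ} (hc : 0 < c) (h : ℝ) (r R : ℕ) (hr : 2 * r ≤ R) (t : ℝ) (ht : 1 ≤ t) (hR : 1 ≤ R)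
    (hyp : ∀ n : ℕ, 1 ≤ n → n ≤ R → c ≤ (n : ℝ) ^ d * (P {ω | ¬ ConnIn {y | h ≤ chiFun d 1000 1 t (cfg ξ ω) y}
                  (box d (ufn (n : ℝ))) (bdry d (n : ℝ))}).toReal ∧
              c ≤ (P {ω | ConnIn {y | h ≤ chiFun d 1000 1 t (cfg ξ ω) y}
                  (box d (((n + 1) / 2 : ℕ) : ℝ)) (bdry d (n : ℝ))}).toReal) (f : ℝ → ℝ) (hf : Measurable f) (hf0 : ∀ s, 0 ≤ f s)
    (hi : Integrable (fun ω => f (psiFun d 1000 1 t (shiftCfg d 1000 1 t 0 h (cfg ξ ω)) 0)) P) :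
            (∑' x : V d, ∫ ω,
                (PivSet d 1000 1 t h r R x).indicator
                  (fun c => f (psiFun d 1000 1 t c x))
                  (shiftCfg d 1000 1 t x h (cfg ξ ω)) ∂P) ≤
              (∫ ω, f (psiFun d 1000 1 t (shiftCfg d 1000 1 t 0 h (cfg ξ ω)) 0) ∂P) *
                (Real.exp (Cf d c * t ^ 18) *
                    ∑' x : V d,
                      (P {ω | shiftCfg d 1000 1 t x h (cfg ξ ω) ∈
                        PivSet d 1000 1 t h r R x}).toReal +
                  Real.exp (Cf d c * t ^ 3 - (r : ℝ) ^ (1:ℝ) * Real.exp (-(Cf d c * t ^ 3)))) := by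
  have hrR : r ≤ R := by omega
  have h1 : 1 ≤ 1000 := by norm_num
  simp only [psi_shift h1] at hi ⊢
  obtain ⟨n₀, hn1, hn2, hn3⟩ := n0_ex ht
  have hL : Lsc 1000 1 ⌈t⌉₊ = 1000 ^ ⌈t⌉₊ := by simp [Lsc]
  have hE0 : 0 ≤ ∫ ω, f (Psi (Lsc 1000 1 ⌈t⌉₊) (alphaT 1000 1 t) (betaT 1000 1 t) h (kap d 1000 1 t) 0 (cfg ξ ω)) ∂P := integral_nonneg fun ω => hf0 _
  have hlhs : (∑' x : V d, ∫ ω, (PivSet d 1000 1 t h r R x).indicator (fun c => f (psiFun d 1000 1 t c x)) (shiftCfg d 1000 1 t x h (cfg ξ ω)) ∂P) =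
      ∑ x ∈ fbox d 0 R, ∫ ω, (PivSet d 1000 1 t h r R x).indicator (fun c => f (psiFun d 1000 1 t c x)) (shiftCfg d 1000 1 t x h (cfg ξ ω)) ∂P :=
    tsum_eq_sum fun x hx => by simp [indicator_of_notMem (piv_out hd hrR hx _)]
  rw [hlhs]
  have hF0 : ∀ x ω, 0 ≤ (PivSet d 1000 1 t h r R x).indicator (fun c => f (psiFun d 1000 1 t c x)) (shiftCfg d 1000 1 t x h (cfg ξ ω)) :=
    fun x ω => indicator_nonneg (fun _ _ => hf0 _) _
  have hterm := fun x => term_bound (L := Lsc 1000 1 ⌈t⌉₊) (α := alphaT 1000 1 t) (β := betaT 1000 1 t) hd hξ h (kap d 1000 1 t) x hf hf0 hi hrR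
    (fun ω => (PivSet d 1000 1 t h r R x).indicator (fun c => f (psiFun d 1000 1 t c x)) (shiftCfg d 1000 1 t x h (cfg ξ ω)))
    (fun ω => by
      by_cases hp : shiftCfg d 1000 1 t x h (cfg ξ ω) ∈ PivSet d 1000 1 t h r R x
      · rw [indicator_of_mem hp, psi_shift h1, indicator_of_mem (s := {ω | CP d r R (Lsc 1000 1 ⌈t⌉₊) x (SS (Lsc 1000 1 ⌈t⌉₊) (alphaT 1000 1 t) h (cfg ξ ω))}) (piv_CP h1 h x _ hp)]
      · rw [indicator_of_notMem hp]; exact indicator_nonneg (fun _ _ => hf0 _) _) (hF0 x)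
  have hpn : 0 ≤ ∑' x : V d, (P {ω | shiftCfg d 1000 1 t x h (cfg ξ ω) ∈ PivSet d 1000 1 t h r R x}).toReal := tsum_nonneg fun _ => ENNReal.toReal_nonneg
  have hc1 : c ≤ 1 := (hyp 1 le_rfl hR).2.trans measureReal_le_one
  rcases le_or_gt R (4 * n₀) with hA | hB
  · have hA' : (R:ℝ) ≤ 4 * n₀ := by exact_mod_cast hA
    have hb := regA ht hn3 c (d := d) hA' hrR hR
    calc _ ≤ ∑ x ∈ fbox d 0 R, (∫ ω, f (Psi (Lsc 1000 1 ⌈t⌉₊) (alphaT 1000 1 t) (betaT 1000 1 t) h (kap d 1000 1 t) 0 (cfg ξ ω)) ∂P) :=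
          Finset.sum_le_sum fun x _ => (hterm x).trans (mul_le_of_le_one_right hE0 measureReal_le_one)
      _ = (∫ ω, f (Psi (Lsc 1000 1 ⌈t⌉₊) (alphaT 1000 1 t) (betaT 1000 1 t) h (kap d 1000 1 t) 0 (cfg ξ ω)) ∂P) * (2 * R + 1) ^ d := by
          rw [Finset.sum_const, card_fbox, nsmul_eq_mul]; push_cast; ring
      _ ≤ _ := by
          refine mul_le_mul_of_nonneg_left (hb.trans ?_) hE0
          have := mul_nonneg (Real.exp_pos (Cf d c * t ^ 18)).le hpn
          linarith
  · have hn0r : (1:ℝ) ≤ n₀ := by have : 1 ≤ n₀ := le_trans Nat.one_le_two_pow (le_trans (Nat.pow_le_pow_left (by norm_num : 2 ≤ 1000) ⌈t⌉₊) hn1)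
                                 exact_mod_cast this
    have hSS : ∀ ω, {y | h ≤ chiFun d 1000 1 t (cfg ξ ω) y} = SS (Lsc 1000 1 ⌈t⌉₊) (alphaT 1000 1 t) h (cfg ξ ω) := fun ω => by
      ext y; simp only [mem_ofPred_eq, SS, chiFun_eq h1]
    simp only [hSS] at hyp
    have hsum := CP_sum (L := Lsc 1000 1 ⌈t⌉₊) (α := alphaT 1000 1 t) (P := P) (ξ := ξ) hd (adm_alphaT _ _ (by linarith)) hξ h c hc (by rw [hL]; exact Nat.one_le_pow _ _ (by norm_num)) (38 * ⌈t⌉₊) n₀ r R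
      (by rw [hL]; exact hk_pow _) (by rw [hL]; exact hn1) hr hB (fun n hn hn' => (hyp n hn (by rw [hL] at hn'; omega)).2) (by
        have h2 := (hyp n₀ (by exact_mod_cast hn0r) (by omega)).1
        rw [div_le_iff₀ (by positivity), mul_comm]
        refine h2.trans (mul_le_mul_of_nonneg_left ?_ (by positivity))
        refine measureReal_mono (fun ω hω hcc => hω ?_) (measure_ne_top _ _)
        refine ConnIn.mono subset_rfl ?_ ?_ hcc
        · intro y hy
          refine (mem_boxAt_floor (Real.exp_pos _).le).2 (le_trans hy ?_)
          rw [hL]; exact Nat.le_floor hn2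
        · intro y hy; exact (mem_bdry hd).2 hy)
    have hq : ∑ y ∈ fbox d 0 (R + 20 * n₀), qh P ξ (Lsc 1000 1 ⌈t⌉₊) (alphaT 1000 1 t) (fbox d 0 (R + 20 * n₀)) h (Crs d r R) y =
        ∑' x : V d, (P {ω | shiftCfg d 1000 1 t x h (cfg ξ ω) ∈ PivSet d 1000 1 t h r R x}).toReal := by
      rw [tsum_eq_sum (s := fbox d 0 (R + 20 * n₀))]
      · exact Finset.sum_congr rfl fun y _ => qh_eq hd h1 h hrR (by omega) y
      · intro x hx
        have : {ω | shiftCfg d 1000 1 t x h (cfg ξ ω) ∈ PivSet d 1000 1 t h r R x} = ∅ := by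
          ext ω; simp only [mem_ofPred_eq, mem_empty_iff_false, iff_false]
          exact piv_out hd hrR (fun hh => hx (by rw [mem_fbox] at hh ⊢; omega)) _
        rw [this]; simp
    rw [hq] at hsum
    have hC := Cnum (N := ((20 * n₀ : ℕ) : ℝ)) hc hc1 ht (by push_cast; linarith) (by push_cast; exact hn3) d
    calc _ ≤ ∑ x ∈ fbox d 0 R, (∫ ω, f (Psi (Lsc 1000 1 ⌈t⌉₊) (alphaT 1000 1 t) (betaT 1000 1 t) h (kap d 1000 1 t) 0 (cfg ξ ω)) ∂P) * P.real {ω | CP d r R (Lsc 1000 1 ⌈t⌉₊) x (SS (Lsc 1000 1 ⌈t⌉₊) (alphaT 1000 1 t) h (cfg ξ ω))} :=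
          Finset.sum_le_sum fun x _ => hterm x
      _ = (∫ ω, f (Psi (Lsc 1000 1 ⌈t⌉₊) (alphaT 1000 1 t) (betaT 1000 1 t) h (kap d 1000 1 t) 0 (cfg ξ ω)) ∂P) * ∑ x ∈ fbox d 0 R, P.real {ω | CP d r R (Lsc 1000 1 ⌈t⌉₊) x (SS (Lsc 1000 1 ⌈t⌉₊) (alphaT 1000 1 t) h (cfg ξ ω))} := by
          rw [Finset.mul_sum]
      _ ≤ _ := by
          refine mul_le_mul_of_nonneg_left ?_ hE0
          refine (hsum.trans (mul_le_mul_of_nonneg_right hC hpn)).trans ?_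
          have := Real.exp_pos (Cf d c * t ^ 3 - (r : ℝ) ^ (1:ℝ) * Real.exp (-(Cf d c * t ^ 3)))
          linarith
end

section
variable {d : ℕ}

def lam (θ : Fin d → ℝ) : ℝ := 1/2 + (1/(2*d)) * ∑ i, Real.cos (θ i)
def ph (z : V d) (θ : Fin d → ℝ) : ℝ := ∑ j, (z j : ℝ) * θ j
def tor (d : ℕ) : Measure (Fin d → ℝ) := Measure.pi (fun _ => volume.restrict (Icc (-Real.pi) Real.pi))

instance : IsFiniteMeasure (tor d) := by unfold tor; infer_instance

lemma cos_quad {x : ℝ} (hx : x ∈ Icc (-Real.pi) Real.pi) : Real.cos x ≤ 1 - 2 / Real.pi ^ 2 * x ^ 2 :=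
  by
  have h0 : |x / 2| ≤ Real.pi / 2 := by rw [abs_div, abs_two]; linarith [abs_le.2 hx]
  have h1 := Real.mul_abs_le_abs_sin h0
  have h2 := pow_le_pow_left₀ (by positivity) h1 2
  rw [mul_pow, sq_abs, sq_abs] at h2
  have h3 : Real.cos x = 1 - 2 * Real.sin (x/2) ^ 2 := by
    have := Real.cos_two_mul (x/2); rw [mul_div_cancel₀ x (by norm_num : (2:ℝ) ≠ 0)] at this
    rw [this, Real.cos_sq']; ring
  have e : (2 / Real.pi)^2 * (x/2)^2 = x^2 / Real.pi^2 := by ring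
  have e' : 2 / Real.pi^2 * x^2 = 2 * (x^2 / Real.pi^2) := by ring
  rw [h3, e']; linarith

lemma lam_nn (hd : 0 < d) (θ : Fin d → ℝ) : 0 ≤ lam θ := by
  have : ∑ i : Fin d, (-1:ℝ) ≤ ∑ i, Real.cos (θ i) := Finset.sum_le_sum fun i _ => Real.neg_one_le_cos _
  have hdr : (0:ℝ) < d := by exact_mod_cast hd
  simp at this
  unfold lam
  have h2 : (1/(2*d)) * -(d:ℝ) ≤ (1/(2*d)) * ∑ i, Real.cos (θ i) := by gcongr
  have : (1/(2*d)) * -(d:ℝ) = -(1/2) := by field_simp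
  linarith

lemma lam_le (hd : 0 < d) (θ : Fin d → ℝ) (b : Fin d → ℝ) (hb : ∀ i, Real.cos (θ i) ≤ 1 - b i) : lam θ ≤ 1 - (1/(2*d)) * ∑ i, b i := by
  have : ∑ i, Real.cos (θ i) ≤ ∑ i, (1 - b i) := Finset.sum_le_sum fun i _ => hb i
  have hdr : (0:ℝ) < d := by exact_mod_cast hd
  rw [Finset.sum_sub_distrib] at this
  simp at this
  unfold lam
  have h2 : (1/(2*d)) * ∑ i, Real.cos (θ i) ≤ (1/(2*d)) * (d - ∑ i, b i) := by gcongr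
  have : (1/(2*d)) * (d:ℝ) = 1/2 := by field_simp
  nlinarith

lemma lam_int (hd : 0 < d) (ℓ : ℕ) (z : V d) : Integrable (fun θ => ((lam θ : ℝ) : ℂ) ^ ℓ * Complex.exp (ph z θ * Complex.I)) (tor d) := by
  refine Integrable.of_bound (C := 1) (Continuous.aestronglyMeasurable (by unfold lam ph; fun_prop)) (Eventually.of_forall fun θ => ?_)
  rw [norm_mul, norm_pow, Complex.norm_exp_ofReal_mul_I, mul_one, Complex.norm_real, Real.norm_of_nonneg (lam_nn hd θ)]
  refine pow_le_one₀ (lam_nn hd θ) ?_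
  have := lam_le hd θ 0 (fun i => by simpa using Real.cos_le_one _)
  simpa using this

lemma int1 (z : ℤ) : ∫ x in Icc (-Real.pi) Real.pi, Complex.exp (((z:ℝ) * x : ℝ) * Complex.I) = if z = 0 then ((2 * Real.pi : ℝ) : ℂ) else 0 := by
  rw [integral_Icc_eq_integral_Ioc, ← intervalIntegral.integral_of_le (by linarith [Real.pi_pos])]
  split_ifs with h
  · simp [h]; ring
  · have hz : (z:ℂ) * Complex.I ≠ 0 := by simp [h]
    have e : ∀ x : ℝ, Complex.exp (((z:ℝ) * x : ℝ) * Complex.I) = Complex.exp (((z:ℂ) * Complex.I) * x) := fun x => by push_cast; ring_nf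
    simp_rw [e]
    rw [integral_exp_mul_complex hz, div_eq_zero_iff]; left
    rw [sub_eq_zero, Complex.exp_eq_exp_iff_exists_int]
    exact ⟨z, by push_cast; ring⟩

lemma four (hd : 0 < d) (ℓ : ℕ) (z : V d) : ∫ θ, ((lam θ : ℝ) : ℂ) ^ ℓ * Complex.exp (ph z θ * Complex.I) ∂(tor d) = (2 * Real.pi : ℝ) ^ d * (lazyP d ℓ z 0 : ℝ) := by
  induction ℓ generalizing z with
  | zero =>
    have e : ∀ θ : Fin d → ℝ, ((lam θ : ℝ) : ℂ) ^ 0 * Complex.exp (ph z θ * Complex.I) = ∏ j, Complex.exp (((z j:ℝ) * θ j : ℝ) * Complex.I) := fun θ => by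
      rw [pow_zero, one_mul, ← Complex.exp_sum, ph]; push_cast; rw [Finset.sum_mul]
    simp_rw [e]
    unfold tor
    rw [integral_fintype_prod_eq_prod (f := fun j (x:ℝ) => Complex.exp (((z j:ℝ) * x : ℝ) * Complex.I))]
    simp_rw [int1, lazyP_zero]
    by_cases hz : z = 0
    · simp [hz]
    · obtain ⟨j, hj⟩ := Function.ne_iff.1 hz
      rw [Finset.prod_eq_zero (Finset.mem_univ j) (by simpa using hj)]; simp [hz]
  | succ ℓ ih =>
    have e : ∀ θ : Fin d → ℝ, ((lam θ : ℝ) : ℂ) ^ (ℓ+1) * Complex.exp (ph z θ * Complex.I) = (1/2) * (((lam θ : ℝ) : ℂ) ^ ℓ * Complex.exp (ph z θ * Complex.I)) +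
        (1/(4*d)) * ∑ i, (((lam θ : ℝ) : ℂ) ^ ℓ * Complex.exp (ph (z + unitV d i) θ * Complex.I) + ((lam θ : ℝ) : ℂ) ^ ℓ * Complex.exp (ph (z - unitV d i) θ * Complex.I)) := by
      intro θ
      have p1 : ∀ i, ph (z + unitV d i) θ = ph z θ + θ i := fun i => by simp [ph, unitV, add_mul, Finset.sum_add_distrib]
      have p2 : ∀ i, ph (z - unitV d i) θ = ph z θ - θ i := fun i => by simp [ph, unitV, sub_mul, Finset.sum_sub_distrib]
      have p3 : ∀ i, ((lam θ : ℝ) : ℂ) ^ ℓ * Complex.exp (ph (z + unitV d i) θ * Complex.I) + ((lam θ : ℝ) : ℂ) ^ ℓ * Complex.exp (ph (z - unitV d i) θ * Complex.I) =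
          ((lam θ : ℝ) : ℂ) ^ ℓ * Complex.exp (ph z θ * Complex.I) * (2 * Complex.cos (θ i)) := fun i => by
        rw [p1, p2, Complex.two_cos]; push_cast; rw [add_mul, sub_mul, Complex.exp_add, sub_eq_add_neg, Complex.exp_add]; ring_nf
      simp_rw [p3]
      rw [← Finset.mul_sum, ← Finset.mul_sum, pow_succ]
      conv_lhs => rw [show ((lam θ : ℝ) : ℂ) = 1/2 + (1/(2*d)) * ∑ i, Complex.cos (θ i) by unfold lam; push_cast; rfl]
      conv_rhs => rw [show ((lam θ : ℝ) : ℂ) = 1/2 + (1/(2*d)) * ∑ i, Complex.cos (θ i) by unfold lam; push_cast; rfl]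
      have : (d:ℂ) ≠ 0 := by exact_mod_cast hd.ne'
      field_simp
      ring
    simp_rw [e]
    have hs : ∀ i, Integrable (fun θ => ((lam θ : ℝ) : ℂ) ^ ℓ * Complex.exp (ph (z + unitV d i) θ * Complex.I) + ((lam θ : ℝ) : ℂ) ^ ℓ * Complex.exp (ph (z - unitV d i) θ * Complex.I)) (tor d) := fun i => (lam_int hd ℓ _).add (lam_int hd ℓ _)
    rw [integral_add ((lam_int hd ℓ z).const_mul _) (Integrable.const_mul (integrable_finset_sum _ fun i _ => hs i) _),
      integral_const_mul, integral_const_mul, integral_finset_sum _ fun i _ => hs i]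
    simp_rw [integral_add (lam_int hd ℓ _) (lam_int hd ℓ _), ih]
    rw [lazyP_succ]; push_cast
    simp_rw [← mul_add]; rw [← Finset.mul_sum]; ring

lemma hk (hd : 3 ≤ d) : ∃ C : ℝ, 0 < C ∧ ∀ ℓ : ℕ, 1 ≤ ℓ → ∀ x y : V d, lazyP d ℓ x y ≤ C / √ℓ ^ 3 := by
  have hd0 : 0 < d := by omega
  have hdr : (0:ℝ) < d := by exact_mod_cast hd0
  have hπ := Real.pi_pos
  set a : ℝ := 1 / (d * Real.pi ^ 2) with ha
  have ha0 : 0 < a := by positivity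
  refine ⟨√(Real.pi / a) ^ d, by positivity, fun ℓ hℓ x y => ?_⟩
  have hl : (1:ℝ) ≤ ℓ := by exact_mod_cast hℓ
  have e0 : lazyP d ℓ x y = lazyP d ℓ (x - y) 0 := by have := lazyP_add d ℓ (x - y) 0 y; simpa using this
  rw [e0]
  have h1 := four hd0 ℓ (x - y)
  have h2 : (2 * Real.pi) ^ d * lazyP d ℓ (x - y) 0 ≤ ∫ θ, lam θ ^ ℓ ∂(tor d) := by
    have h3 := norm_integral_le_integral_norm (μ := tor d) (fun θ => ((lam θ : ℝ) : ℂ) ^ ℓ * Complex.exp (ph (x-y) θ * Complex.I))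
    rw [h1] at h3
    have e1 : ‖((2 * Real.pi : ℝ) : ℂ) ^ d * ((lazyP d ℓ (x - y) 0 : ℝ) : ℂ)‖ = (2 * Real.pi) ^ d * lazyP d ℓ (x - y) 0 := by
      rw [norm_mul, norm_pow, Complex.norm_real, Complex.norm_real, Real.norm_of_nonneg (by positivity), Real.norm_of_nonneg (lazyP_nonneg _ _ _ _)]
    rw [e1] at h3
    refine h3.trans (le_of_eq (integral_congr_ae (Eventually.of_forall fun θ => ?_)))
    simp only
    rw [norm_mul, norm_pow, Complex.norm_exp_ofReal_mul_I, mul_one, Complex.norm_real, Real.norm_of_nonneg (lam_nn hd0 θ)]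
  have hint : Integrable (fun t : ℝ => Real.exp (-(a * ℓ) * t ^ 2)) := integrable_exp_neg_mul_sq (by positivity)
  have h4 : ∫ θ, lam θ ^ ℓ ∂(tor d) ≤ ∫ θ : Fin d → ℝ, ∏ i, Real.exp (-(a * ℓ) * θ i ^ 2) ∂(tor d) := by
    refine integral_mono_of_nonneg (Eventually.of_forall fun θ => pow_nonneg (lam_nn hd0 θ) _) ?_ ?_
    · exact Integrable.fintype_prod (f := fun (_ : Fin d) (t:ℝ) => Real.exp (-(a * ℓ) * t ^ 2)) fun i => hint.restrict
    · have hm : ∀ᵐ θ ∂(tor d), θ ∈ univ.pi (fun _ : Fin d => Icc (-Real.pi) Real.pi) := by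
        unfold tor; rw [← Measure.restrict_pi_pi]; exact ae_restrict_mem (MeasurableSet.univ_pi fun _ => measurableSet_Icc)
      filter_upwards [hm] with θ hθ
      have h5 := lam_le hd0 θ (fun i => 2 / Real.pi ^ 2 * θ i ^ 2) (fun i => cos_quad (hθ i (mem_univ i)))
      have h6 : lam θ ≤ Real.exp (-(a * ∑ i, θ i ^ 2)) := by
        refine h5.trans ?_
        have := Real.add_one_le_exp (-(a * ∑ i, θ i ^ 2))
        refine le_trans (le_of_eq ?_) this
        rw [← Finset.mul_sum, ha]; field_simp; ring
      refine (pow_le_pow_left₀ (lam_nn hd0 θ) h6 _).trans (le_of_eq ?_)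
      rw [← Real.exp_nat_mul, ← Real.exp_sum, ← Finset.mul_sum]; ring_nf
  have h7 : ∫ θ : Fin d → ℝ, ∏ i, Real.exp (-(a * ℓ) * θ i ^ 2) ∂(tor d) ≤ √(Real.pi / (a * ℓ)) ^ d := by
    unfold tor
    rw [integral_fintype_prod_eq_prod (f := fun (_ : Fin d) (t:ℝ) => Real.exp (-(a * ℓ) * t ^ 2))]
    rw [Finset.prod_const, Finset.card_univ, Fintype.card_fin, ← integral_gaussian]
    exact pow_le_pow_left₀ (integral_nonneg fun _ => (Real.exp_pos _).le) (setIntegral_le_integral hint (Eventually.of_forall fun _ => (Real.exp_pos _).le)) _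
  have h8 : lazyP d ℓ (x - y) 0 ≤ (2 * Real.pi) ^ d * lazyP d ℓ (x - y) 0 :=
    le_mul_of_one_le_left (lazyP_nonneg _ _ _ _) (one_le_pow₀ (by linarith [Real.pi_gt_three]))
  refine (h8.trans (h2.trans (h4.trans h7))).trans ?_
  rw [← div_div, Real.sqrt_div (by positivity), div_pow]
  gcongr
  rw [Real.one_le_sqrt]; exact hl
end

section
variable {d : ℕ}

def G (d L : ℕ) (x y : V d) : ℝ := Kf d L (fun _ => 1) x y

lemma G_eq (L : ℕ) (x y : V d) : G d L x y = ∑ ℓ ∈ Finset.range (L+1), (1/2) * lazyP d ℓ x y := by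
  simp [G, Kf]

lemma sqrt_tele (ℓ : ℕ) (h : 1 ≤ ℓ) : 1 / √(ℓ:ℝ) ^ 3 ≤ 4 * (1 / √(ℓ:ℝ) - 1 / √((ℓ+1:ℕ):ℝ)) := by
  have hl : (1:ℝ) ≤ ℓ := by exact_mod_cast h
  have ha : 0 < √(ℓ:ℝ) := Real.sqrt_pos.2 (by linarith)
  have hb : 0 < √((ℓ+1:ℕ):ℝ) := Real.sqrt_pos.2 (by push_cast; linarith)
  have ea := Real.sq_sqrt (show (0:ℝ) ≤ ℓ by linarith)
  have eb := Real.sq_sqrt (show (0:ℝ) ≤ ((ℓ+1:ℕ):ℝ) by positivity)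
  push_cast at eb ha hb ⊢
  generalize √(ℓ:ℝ) = a at *
  generalize √((ℓ:ℝ)+1) = b at *
  have h1 : b ≤ 3/2 * a := by nlinarith
  have h2 : (b - a) * (b + a) = 1 := by nlinarith
  have h3 : 1 ≤ 4 * a^2 * (b-a) / b := by
    rw [le_div_iff₀ hb, one_mul]
    have h5 : 0 < b - a := by nlinarith
    have : b * (b + a) ≤ 4 * a^2 := by nlinarith
    nlinarith
  have : 4 * (1 / a - 1 / b) = (4 * a^2 * (b-a) / b) / a^3 := by field_simp
  rw [this]; gcongr

lemma G_bd (hd : 3 ≤ d) : ∃ C : ℝ, 0 < C ∧ ∀ L (x y : V d), G d L x y ≤ C ∧ ∀ k : ℕ, 100^k ≤ dinf x y → G d L x y ≤ C / 10^k := by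
  obtain ⟨C, hC, H⟩ := hk hd
  have key : ∀ (x y : V d) m N, 1 ≤ m → m ≤ N → ∑ ℓ ∈ Finset.Ico m N, (1/2) * lazyP d ℓ x y ≤ 4 * C * (1 / √(m:ℝ) - 1 / √(N:ℝ)) := by
    intro x y m N hm hN
    induction N, hN using Nat.le_induction with
    | base => simp
    | succ N hN ih =>
      rw [Finset.sum_Ico_succ_top hN]
      have h1 := H N (hm.trans hN) x y
      have h2 := sqrt_tele N (hm.trans hN)
      have h3 := lazyP_nonneg d N x y
      have h4 : C / √(N:ℝ)^3 ≤ C * (4 * (1 / √(N:ℝ) - 1 / √((N+1:ℕ):ℝ))) := by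
        rw [div_eq_mul_one_div]; gcongr
      nlinarith
  have nn : ∀ (x y : V d) ℓ, 0 ≤ (1/2:ℝ) * lazyP d ℓ x y := fun x y ℓ => by have := lazyP_nonneg d ℓ x y; positivity
  have key2 : ∀ (x y : V d) m L, 1 ≤ m → G d L x y ≤ ∑ ℓ ∈ Finset.range m, (1/2) * lazyP d ℓ x y + 4 * C / √(m:ℝ) := by
    intro x y m L hm
    have h1 := key x y m (max (L+1) m) hm (le_max_right _ _)
    rw [G_eq]
    have h2 : ∑ ℓ ∈ Finset.range (L+1), (1/2) * lazyP d ℓ x y ≤ ∑ ℓ ∈ Finset.range (max (L+1) m), (1/2) * lazyP d ℓ x y :=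
      Finset.sum_le_sum_of_subset_of_nonneg (Finset.range_subset_range.2 (le_max_left _ _)) fun i _ _ => nn x y i
    rw [← Finset.sum_range_add_sum_Ico _ (le_max_right (L+1) m)] at h2
    have : 0 ≤ 4 * C * (1 / √((max (L+1) m : ℕ):ℝ)) := by positivity
    have : 4 * C / √(m:ℝ) = 4 * C * (1 / √(m:ℝ)) := by ring
    linarith
  refine ⟨4 * C + 1, by positivity, fun L x y => ⟨?_, fun k hk => ?_⟩⟩
  · have := key2 x y 1 L le_rfl
    have h1 := lazyP_le_one d 0 x y
    simp at this
    linarith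
  · have := key2 x y (100^k) L (Nat.one_le_pow _ _ (by norm_num))
    rw [Finset.sum_eq_zero (fun ℓ hℓ => by rw [lazyP_range _ _ _ _ ((Finset.mem_range.1 hℓ).trans_le hk), mul_zero]), zero_add] at this
    have e : √((100^k:ℕ):ℝ) = 10^k := by
      rw [Real.sqrt_eq_iff_mul_self_eq (by positivity) (by positivity)]; push_cast; rw [← mul_pow]; norm_num
    rw [e] at this
    refine this.trans ?_; gcongr; linarith
end

section
variable {d : ℕ} {S : Set (V d)}

def SC (S : Set (V d)) (p q : V d) : Prop := p ∈ S ∧ Relation.ReflTransGen (fun u v => v ∈ S ∧ dinf u v ≤ 1) p q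

lemma SC.ivt {p q : V d} (h : SC S p q) (x : V d) (a : ℕ) (hp : dinf x p ≤ a) (hq : a ≤ dinf x q) :
    ∃ w, dinf x w = a ∧ SC S p w ∧ SC S w q := by
  obtain ⟨hS, h⟩ := h
  induction h using Relation.ReflTransGen.head_induction_on with
  | refl => exact ⟨q, le_antisymm hp hq, ⟨hS, .refl⟩, ⟨hS, .refl⟩⟩
  | @head p p' h1 h2 ih =>
    by_cases he : dinf x p = a
    · exact ⟨p, he, ⟨hS, .refl⟩, ⟨hS, .head h1 h2⟩⟩
    · have := dinf_tri x p p'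
      obtain ⟨w, hw, h3, h4⟩ := ih (by omega) h1.1
      exact ⟨w, hw, ⟨hS, .head h1 h3.2⟩, h4⟩

lemma ConnIn.sc {A B : Set (V d)} (h : ConnIn S A B) : ∃ p ∈ A, ∃ q ∈ B, SC S p q := by
  obtain ⟨n, γ, h0, hn, hs, ha⟩ := h
  refine ⟨_, h0, _, hn, hs 0 (by omega), ?_⟩
  clear hn
  induction n with
  | zero => exact .refl
  | succ n ih => exact (ih (fun k hk => hs k (by omega)) (fun k hk => ha k (by omega))).tail ⟨hs _ le_rfl, adj_dinf (ha n (by omega))⟩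

def XC (n : ℕ) (x : V d) (S : Set (V d)) : Prop := ∃ p q, SC S p q ∧ dinf x p ≤ 100^n ∧ 2 * 100^n ≤ dinf x q
def YC (D : ℕ) (S : Set (V d)) : Prop := ∃ p q, SC S p q ∧ dinf 0 p ≤ 2 * D ∧ D ≤ dinf p q

def ctr (x : V d) (s : ℕ) (z : V d) : V d := fun i => x i + s * z i

lemma round (x p : V d) {s M : ℕ} (hs : 0 < s) (h : dinf x p ≤ M * s) : ∃ z ∈ fbox d 0 M, dinf (ctr x s z) p ≤ s := by
  have hs' : (0:ℤ) < s := by exact_mod_cast hs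
  refine ⟨fun i => (p i - x i) / s, ?_, ?_⟩
  · rw [mem_fbox, dinf_le_iff]; intro i
    have h1 := (natAbs_le_dinf x p i).trans h
    have h2 : -((M:ℤ) * s) ≤ p i - x i ∧ p i - x i ≤ (M:ℤ) * s := by
      have : ((x i - p i).natAbs : ℤ) ≤ M * s := by exact_mod_cast h1
      omega
    have h3 : -(M:ℤ) ≤ (p i - x i) / s := (Int.le_ediv_iff_mul_le hs').2 (by linarith [h2.1])
    have h4 : (p i - x i) / s ≤ M := Int.ediv_le_of_le_mul hs' h2.2
    simp only [Pi.zero_apply]; omega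
  · rw [dinf_le_iff]; intro i
    have h1 := Int.emod_add_mul_ediv (p i - x i) s
    have h2 := Int.emod_nonneg (p i - x i) hs'.ne'
    have h3 := Int.emod_lt_of_pos (p i - x i) hs'
    simp only [ctr]; omega

lemma ctr_dist (x : V d) (s M : ℕ) {z : V d} (hz : z ∈ fbox d 0 M) : dinf x (ctr x s z) ≤ M * s := by
  rw [mem_fbox] at hz
  rw [dinf_le_iff]; intro i
  have := (natAbs_le_dinf 0 z i).trans hz
  simp only [Pi.zero_apply] at this
  have e : x i - ctr x s z i = s * (0 - z i) := by unfold ctr; ring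
  rw [e, Int.natAbs_mul, Int.natAbs_natCast, mul_comm]; gcongr

lemma tree {C : ℝ} (hC : 0 < C) (hG : ∀ L (x y : V d), G d L x y ≤ C ∧ ∀ k : ℕ, 100^k ≤ dinf x y → G d L x y ≤ C / 10^k)
    (n : ℕ) (x : V d) : ∃ W : Finset (Finset (V d)), W.card ≤ (301^d*301^d)^(2^(n+1)-1) ∧
      (∀ T ∈ W, T.card = 2^n ∧ (∀ u ∈ T, dinf x u ≤ 3 * 100^n) ∧
        ∀ L, ∀ u ∈ T, ∑ v ∈ T, G d L u v ≤ C * (3 - 5/4 * (1/5)^n)) ∧ ∀ S, XC n x S → ∃ T ∈ W, (T : Set (V d)) ⊆ S := by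
  classical
  induction n generalizing x with
  | zero =>
    refine ⟨(fbox d x 1).image singleton, ?_, ?_, ?_⟩
    · refine Finset.card_image_le.trans ?_
      rw [card_fbox, show 2^(0+1)-1 = 1 from rfl, pow_one]
      calc (2*1+1)^d ≤ 301^d := Nat.pow_le_pow_left (by norm_num) d
        _ ≤ _ := Nat.le_mul_of_pos_left _ (pow_pos (by norm_num) d)
    · intro T hT
      obtain ⟨u, hu, rfl⟩ := Finset.mem_image.1 hT
      rw [mem_fbox] at hu
      refine ⟨by simp, by simp; omega, ?_⟩
      intro L v hv
      rw [Finset.mem_singleton] at hv; subst hv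
      simp
      have := (hG L v v).1
      nlinarith
    · rintro S ⟨p, q, h, h1, h2⟩
      exact ⟨{p}, Finset.mem_image_of_mem _ (mem_fbox.2 (by simpa using h1)), by simpa using h.1⟩
  | succ n ih =>
    choose W hW1 hW2 hW3 using ih
    have hs : 0 < 100^n := by positivity
    obtain ⟨s, hse⟩ : ∃ s, s = 100^n := ⟨_, rfl⟩
    have e1 : 100^(n+1) = 100 * s := by rw [hse, pow_succ]; ring
    rw [← hse] at hs
    let F := (fbox d 0 150 ×ˢ fbox d (0 : V d) 150).filter fun z => 48 * s ≤ dinf (ctr x s z.1) (ctr x s z.2)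
    refine ⟨F.biUnion fun z => Finset.image₂ (· ∪ ·) (W (ctr x s z.1)) (W (ctr x s z.2)), ?_, ?_, ?_⟩
    · refine (Finset.card_biUnion_le_card_mul _ _ ((301^d*301^d)^(2^(n+1)-1) * (301^d*301^d)^(2^(n+1)-1)) fun z _ => ?_).trans ?_
      · exact (Finset.card_image₂_le _ _ _).trans (Nat.mul_le_mul (hW1 _) (hW1 _))
      · have h1 : F.card ≤ 301^d*301^d := (Finset.card_filter_le _ _).trans (by rw [Finset.card_product, card_fbox])
        refine (Nat.mul_le_mul_right _ h1).trans (le_of_eq ?_)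
        have : 1 ≤ 2^n := Nat.one_le_two_pow
        generalize 301^d*301^d = A
        rw [← pow_add, ← pow_succ']; congr 1; rw [pow_succ 2 (n+1), pow_succ 2 n]; omega
    · intro T hT
      obtain ⟨⟨z1, z2⟩, hz, hT⟩ := Finset.mem_biUnion.1 hT
      obtain ⟨T1, hT1, T2, hT2, rfl⟩ := Finset.mem_image₂.1 hT
      obtain ⟨hz, hfar⟩ := Finset.mem_filter.1 hz
      obtain ⟨hz1, hz2⟩ := Finset.mem_product.1 hz
      simp only at hz1 hz2 hfar hT1 hT2
      obtain ⟨a1, a2, a3⟩ := hW2 _ T1 hT1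
      obtain ⟨b1, b2, b3⟩ := hW2 _ T2 hT2
      rw [← hse] at a2 b2
      have c1 := ctr_dist x s 150 hz1
      have c2 := ctr_dist x s 150 hz2
      have hdist : ∀ u ∈ T1, ∀ v ∈ T2, s ≤ dinf u v := by
        intro u hu v hv
        have h1 := a2 u hu; have h2 := b2 v hv
        have h3 := dinf_tri (ctr x s z1) u (ctr x s z2)
        have h4 := dinf_tri u v (ctr x s z2)
        rw [dinf_comm v] at h4; omega
      have hdj : Disjoint T1 T2 := Finset.disjoint_left.2 fun u hu hv => by
        have := hdist u hu u hv; rw [dinf_self] at this; omega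
      have key : ∀ L, ∀ (Ta Tb : Finset (V d)), Tb.card = 2^n → (∀ v ∈ Ta, ∀ w ∈ Tb, s ≤ dinf v w) → (∀ u ∈ Ta, ∑ v ∈ Ta, G d L u v ≤ C * (3 - 5/4 * (1/5)^n)) →
          ∀ u ∈ Ta, ∑ v ∈ Ta, G d L u v + ∑ v ∈ Tb, G d L u v ≤ C * (3 - 5/4 * (1/5)^(n+1)) := by
        intro L Ta Tb hb hd hsum u hu
        have h1 : ∑ v ∈ Tb, G d L u v ≤ ∑ v ∈ Tb, C / 10^n := Finset.sum_le_sum fun v hv => (hG L u v).2 n (hse ▸ hd u hu v hv)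
        rw [Finset.sum_const, hb, nsmul_eq_mul] at h1
        have e : ((2^n : ℕ) : ℝ) * (C / 10^n) = C * (1/5)^n := by
          push_cast; rw [show (10:ℝ) = 2 * 5 by norm_num, mul_pow, one_div, inv_pow]; field_simp
        rw [e] at h1
        have := hsum u hu
        rw [pow_succ]; nlinarith
      refine ⟨by rw [Finset.card_union_of_disjoint hdj, a1, b1, pow_succ]; ring, ?_, ?_⟩
      · intro u hu
        rw [e1]
        rcases Finset.mem_union.1 hu with h | h
        · have := a2 u h; have := dinf_tri x (ctr x s z1) u; omega
        · have := b2 u h; have := dinf_tri x (ctr x s z2) u; omega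
      · intro L u hu
        rw [Finset.sum_union hdj]
        rcases Finset.mem_union.1 hu with h | h
        · exact key L T1 T2 b1 hdist (a3 L) u h
        · rw [add_comm]
          exact key L T2 T1 a1 (fun v hv w hw => dinf_comm w v ▸ hdist w hw v hv) (b3 L) u h
    · rintro S ⟨p, q, h, h1, h2⟩
      rw [e1] at h1 h2
      obtain ⟨p2, hp2, h3, h4⟩ := h.ivt x (150*s) (by omega) (by omega)
      obtain ⟨p3, hp3, h5, h6⟩ := h4.ivt x (200*s) (by omega) (by omega)
      obtain ⟨z1, hz1, hc1⟩ := round x p (M := 150) hs (by omega)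
      obtain ⟨z2, hz2, hc2⟩ := round x p2 (M := 150) hs hp2.le
      have t1 := dinf_tri x p p2
      have t2 := dinf_tri x p2 p3
      have t3 := dinf_tri p (ctr x s z1) p2
      have t4 := dinf_tri p2 (ctr x s z2) p3
      have t5 := dinf_tri (ctr x s z1) (ctr x s z2) p2
      rw [dinf_comm p (ctr x s z1)] at t3; rw [dinf_comm p2 (ctr x s z2)] at t4
      obtain ⟨T1, hT1, hS1⟩ := hW3 (ctr x s z1) S ⟨p, p2, h3, by omega, by omega⟩
      obtain ⟨T2, hT2, hS2⟩ := hW3 (ctr x s z2) S ⟨p2, p3, h5, by omega, by omega⟩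
      refine ⟨T1 ∪ T2, Finset.mem_biUnion.2 ⟨(z1, z2), Finset.mem_filter.2 ⟨Finset.mem_product.2 ⟨hz1, hz2⟩, by simp only; omega⟩, Finset.mem_image₂.2 ⟨T1, hT1, T2, hT2, rfl⟩⟩, ?_⟩
      rw [Finset.coe_union]; exact union_subset hS1 hS2
end

section
variable {d : ℕ} {Ω : Type*} [MeasurableSpace Ω] {P : Measure Ω} [IsProbabilityMeasure P] {ξ : ℕ → V d → Ω → ℝ}

lemma gtail1 (hξ : IsXiFamily d P ξ) {T : Finset (V d)} (hT : T.Nonempty) {sg K Γ : ℝ} (hsg : sg^2 = 1) (hK : 0 < K) (hΓ : 0 < Γ)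
    (N : ℕ) (hG : ∀ u ∈ T, ∑ v ∈ T, G d N u v ≤ Γ) :
    P.real {ω | K * T.card / 2 ≤ ∑ x ∈ T, sg * gchi N (fun _ => 1) (cfg ξ ω) x} ≤ Real.exp (-(K^2 * T.card / (8 * Γ))) := by
  have hn : (0:ℝ) < T.card := by exact_mod_cast hT.card_pos
  have gf := gf_gchi hξ N (fun _ => 1)
  have gl : GF P (fun (_ : Unit) ω => ∑ x ∈ T, sg * gchi N (fun _ => 1) (cfg ξ ω) x) := gf.lin (fun _ => T) (fun _ _ => sg) (fun _ _ => rfl)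
  have hm := gl.map_eval ()
  have hv : Var[fun ω => ∑ x ∈ T, sg * gchi N (fun _ => 1) (cfg ξ ω) x; P] ≤ T.card * Γ := by
    rw [← covariance_self (gl.meas ()).aemeasurable, gf.cov_lin T T (fun _ => sg) (fun _ => sg)]
    simp_rw [cov_gchi' hξ, ← pow_two, hsg, one_mul]
    refine (Finset.sum_le_sum hG).trans (le_of_eq ?_)
    simp
  have hv0 := variance_nonneg (fun ω => ∑ x ∈ T, sg * gchi N (fun _ => 1) (cfg ξ ω) x) P
  have hint : Integrable (fun ω => Real.exp (K / (2 * Γ) * ∑ x ∈ T, sg * gchi N (fun _ => 1) (cfg ξ ω) x)) P := by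
    have := integrable_exp_mul_gaussianReal (μ := 0) (v := (Var[fun ω => ∑ x ∈ T, sg * gchi N (fun _ => 1) (cfg ξ ω) x; P]).toNNReal) (K / (2 * Γ))
    rw [← hm] at this
    exact this.comp_measurable (gl.meas ())
  refine (measure_ge_le_exp_mul_mgf _ (by positivity) hint).trans ?_
  rw [mgf_gaussianReal hm, ← Real.exp_add, Real.exp_le_exp, Real.coe_toNNReal _ hv0]
  generalize Var[fun ω => ∑ x ∈ T, sg * gchi N (fun _ => 1) (cfg ξ ω) x; P] = v at *
  generalize (T.card : ℝ) = m at *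
  have h1 : v * (K / (2 * Γ))^2 / 2 ≤ m * Γ * (K / (2 * Γ))^2 / 2 := by gcongr
  have h2 : m * Γ * (K / (2 * Γ))^2 / 2 = K^2 * m / (8 * Γ) := by field_simp; ring
  have h3 : -(K / (2 * Γ)) * (K * m / 2) = - (2 * (K^2 * m / (8 * Γ))) := by field_simp; ring
  rw [h3]; linarith

lemma gtail (hξ : IsXiFamily d P ξ) {T : Finset (V d)} (hT : T.Nonempty) {sg K Γ : ℝ} (hsg : sg^2 = 1) (hK : 0 < K) (hΓ : 0 < Γ)
    (hG : ∀ N, ∀ u ∈ T, ∑ v ∈ T, G d N u v ≤ Γ) :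
    P.real {ω | ∀ x ∈ T, K ≤ sg * phiOf ξ x ω} ≤ Real.exp (-(K^2 * T.card / (8 * Γ))) := by
  have hn : (0:ℝ) < T.card := by exact_mod_cast hT.card_pos
  let F : ℕ → Set Ω := fun M => {ω | ∀ N, M ≤ N → K * T.card / 2 ≤ ∑ x ∈ T, sg * gchi N (fun _ => 1) (cfg ξ ω) x}
  have hmono : Monotone F := fun a b hab ω hω N hN => hω N (hab.trans hN)
  have hsub : {ω | ∀ x ∈ T, K ≤ sg * phiOf ξ x ω} ⊆ ⋃ M, F M := by
    intro ω hω
    have ht : Tendsto (fun N => ∑ x ∈ T, sg * gchi N (fun _ => 1) (cfg ξ ω) x) atTop (nhds (∑ x ∈ T, sg * phiOf ξ x ω)) := by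
      refine tendsto_finset_sum _ fun x hx => Tendsto.const_mul _ ?_
      have hs : Summable fun ℓ => ξ ℓ x ω := by
        by_contra hns
        have := hω x hx
        rw [phiOf, tsum_eq_zero_of_not_summable hns, mul_zero] at this; linarith
      have := (hs.hasSum.tendsto_sum_nat).comp (tendsto_add_atTop_nat 1)
      refine this.congr fun N => ?_
      simp [gchi, cfg]
    have hge : K * T.card ≤ ∑ x ∈ T, sg * phiOf ξ x ω := by
      have := Finset.sum_le_sum hω
      rw [Finset.sum_const, nsmul_eq_mul] at this; linarith
    have hpos : 0 < K * T.card := by positivity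
    obtain ⟨M, hM⟩ := eventually_atTop.1 (ht.eventually (eventually_ge_nhds (show K * T.card / 2 < _ by linarith)))
    exact mem_iUnion.2 ⟨M, hM⟩
  have hle : P (⋃ M, F M) ≤ ENNReal.ofReal (Real.exp (-(K^2 * T.card / (8 * Γ)))) :=
    le_of_tendsto' (tendsto_measure_iUnion_atTop hmono) fun M => by
      rw [Function.comp_apply, ← ofReal_measureReal]
      refine ENNReal.ofReal_le_ofReal ((measureReal_mono ?_ (measure_ne_top _ _)).trans (gtail1 hξ hT hsg hK hΓ M (hG M)))
      exact fun ω hω => hω M le_rfl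
  rw [measureReal_def]
  exact ENNReal.toReal_le_of_le_ofReal (Real.exp_pos _).le ((measure_mono hsub).trans hle)

lemma comb (hd : 3 ≤ d) (hξ : IsXiFamily d P ξ) : ∃ K : ℝ, 0 < K ∧ ∀ sg : ℝ, sg^2 = 1 →
    (∀ D, 4 ≤ D → P.real {ω | YC D {y | K ≤ sg * phiOf ξ y ω}} ≤ 1/2) ∧
    P.real {ω | ∃ y ∈ fbox d 0 3000, K ≤ sg * phiOf ξ y ω} ≤ 1/2 := by
  obtain ⟨C, hC, hG⟩ := G_bd hd
  obtain ⟨A, hA⟩ : ∃ A : ℝ, A = ((301^d*301^d : ℕ) : ℝ) := ⟨_, rfl⟩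
  have hA1 : 1 ≤ A := by rw [hA]; exact_mod_cast Nat.one_le_iff_ne_zero.2 (by positivity)
  obtain ⟨B, hB⟩ : ∃ B : ℝ, B = (6001:ℝ)^d := ⟨_, rfl⟩
  have hB1 : 1 ≤ B := by rw [hB]; exact one_le_pow₀ (by norm_num)
  have hM : 1 < A^2 * (2 * B) := by nlinarith [one_le_pow₀ hA1 (n := 2)]
  have hlog := Real.log_pos hM
  refine ⟨√(24 * C * Real.log (A^2 * (2*B))), by positivity, fun sg hsg => ?_⟩
  have hK : 0 < √(24 * C * Real.log (A^2 * (2*B))) := by positivity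
  have hK2 : √(24 * C * Real.log (A^2 * (2*B))) ^ 2 = 24 * C * Real.log (A^2 * (2*B)) := Real.sq_sqrt (by positivity)
  generalize √(24 * C * Real.log (A^2 * (2*B))) = K at *
  have tail : ∀ T : Finset (V d), T.Nonempty → (∀ N, ∀ u ∈ T, ∑ v ∈ T, G d N u v ≤ 3 * C) →
      P.real {ω | ∀ x ∈ T, K ≤ sg * phiOf ξ x ω} ≤ (1 / (A^2 * (2*B)))^T.card := by
    intro T hT hs
    refine (gtail hξ hT hsg hK (by positivity) hs).trans (le_of_eq ?_)
    rw [hK2, one_div, inv_pow, Real.exp_neg]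
    congr 1
    rw [show 24 * C * Real.log (A^2 * (2*B)) * T.card / (8 * (3 * C)) = T.card * Real.log (A^2 * (2*B)) by field_simp; ring, Real.exp_nat_mul, Real.exp_log (by positivity)]
  have single : ∀ (F : Finset (V d)), (F.card : ℝ) ≤ B → P.real {ω | ∃ y ∈ F, K ≤ sg * phiOf ξ y ω} ≤ 1/2 := by
    intro F hF
    have e : {ω | ∃ y ∈ F, K ≤ sg * phiOf ξ y ω} = ⋃ y ∈ F, {ω | K ≤ sg * phiOf ξ y ω} := by ext; simp
    rw [e]
    refine (measureReal_biUnion_finset_le _ _).trans ?_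
    have : ∀ y ∈ F, P.real {ω | K ≤ sg * phiOf ξ y ω} ≤ 1 / (2*B) := by
      intro y _
      have := tail {y} (by simp) (by intro N u hu; simp at hu; subst hu; simp; linarith [(hG N u u).1])
      simp only [Finset.mem_singleton, forall_eq, Finset.card_singleton, pow_one] at this
      refine this.trans ?_
      exact one_div_le_one_div_of_le (by positivity) (le_mul_of_one_le_left (by positivity) (one_le_pow₀ hA1))
    refine (Finset.sum_le_sum this).trans ?_
    rw [Finset.sum_const, nsmul_eq_mul, mul_one_div, div_le_iff₀ (by positivity)]; linarith
  have hX : ∀ n (x : V d), P.real {ω | XC n x {y | K ≤ sg * phiOf ξ y ω}} ≤ 1 / (2*B) := by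
    intro n x
    obtain ⟨W, hW1, hW2, hW3⟩ := tree hC hG n x
    have hsub : {ω | XC n x {y | K ≤ sg * phiOf ξ y ω}} ⊆ ⋃ T ∈ W, {ω | ∀ x ∈ T, K ≤ sg * phiOf ξ x ω} := by
      intro ω hω
      obtain ⟨T, hT, hS⟩ := hW3 _ hω
      simp only [mem_iUnion]; exact ⟨T, hT, fun x hx => hS hx⟩
    refine (measureReal_mono hsub (measure_ne_top _ _)).trans ((measureReal_biUnion_finset_le _ _).trans ?_)
    have h1 : ∀ T ∈ W, P.real {ω | ∀ x ∈ T, K ≤ sg * phiOf ξ x ω} ≤ (1 / (A^2 * (2*B)))^(2^n) := by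
      intro T hT
      obtain ⟨a1, a2, a3⟩ := hW2 T hT
      rw [← a1]
      refine tail T (Finset.card_pos.1 (by rw [a1]; positivity)) fun N u hu => (a3 N u hu).trans ?_
      have : (0:ℝ) ≤ (1/5)^n := by positivity
      nlinarith
    refine (Finset.sum_le_sum h1).trans ?_
    rw [Finset.sum_const, nsmul_eq_mul]
    have h2 : (W.card : ℝ) ≤ A^(2*2^n) := by
      have : (W.card : ℝ) ≤ A^(2^(n+1)-1) := by rw [hA]; exact_mod_cast hW1
      refine this.trans (pow_le_pow_right₀ hA1 ?_)
      rw [pow_succ]; omega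
    calc (W.card : ℝ) * (1 / (A^2 * (2*B)))^(2^n) ≤ A^(2*2^n) * (1 / (A^2 * (2*B)))^(2^n) := by gcongr
      _ = (1 / (2*B))^(2^n) := by rw [pow_mul, ← mul_pow]; congr 1; field_simp
      _ ≤ (1 / (2*B))^1 := pow_le_pow_of_le_one (by positivity) (by rw [div_le_one (by positivity)]; linarith) Nat.one_le_two_pow
      _ = _ := pow_one _
  refine ⟨fun D hD => ?_, single _ (by rw [card_fbox, hB]; norm_num)⟩
  have hk : ∃ k, D < 400 * 100^k ∧ 4 * 100^k ≤ D := by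
    refine ⟨Nat.log 100 (D/4), ?_, ?_⟩
    · have := Nat.lt_pow_succ_log_self (b := 100) (by norm_num) (D/4)
      rw [pow_succ] at this; omega
    · have := Nat.pow_log_le_self 100 (x := D/4) (by omega); omega
  obtain ⟨k, hk1, hk2⟩ := hk
  have hsub : {ω | YC D {y | K ≤ sg * phiOf ξ y ω}} ⊆ ⋃ z ∈ fbox d 0 800, {ω | XC k (ctr 0 (100^k) z) {y | K ≤ sg * phiOf ξ y ω}} := by
    rintro ω ⟨p, q, h, h1, h2⟩
    obtain ⟨z, hz, hp⟩ := round 0 p (s := 100^k) (M := 800) (by positivity) (by omega)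
    have := dinf_tri p (ctr 0 (100^k) z) q
    rw [dinf_comm p (ctr 0 (100^k) z)] at this
    simp only [mem_iUnion]; exact ⟨z, hz, p, q, h, hp, by omega⟩
  refine (measureReal_mono hsub (measure_ne_top _ _)).trans ((measureReal_biUnion_finset_le _ _).trans ((Finset.sum_le_sum fun z _ => hX k _).trans ?_))
  rw [Finset.sum_const, nsmul_eq_mul, mul_one_div, div_le_iff₀ (by positivity), card_fbox]
  have : ((2*800+1:ℕ):ℝ)^d ≤ B := by rw [hB]; gcongr; norm_num
  push_cast at this ⊢; linarith
end

section
variable {d : ℕ} {Ω : Type*} [MeasurableSpace Ω] {P : Measure Ω} [IsProbabilityMeasure P] {ξ : ℕ → V d → Ω → ℝ} {S S' : Set (V d)}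

lemma SC.right {p q : V d} (h : SC S p q) : q ∈ S := by
  obtain ⟨h0, h⟩ := h
  induction h with
  | refl => exact h0
  | tail _ h _ => exact h.1

lemma SC.mono {p q : V d} (hS : S ⊆ S') (h : SC S p q) : SC S' p q :=
  ⟨hS h.1, Relation.ReflTransGen.mono (r := fun u v => v ∈ S ∧ dinf u v ≤ 1) (p := fun u v => v ∈ S' ∧ dinf u v ≤ 1) (fun _ _ h => ⟨hS h.1, h.2⟩) _ _ h.2⟩

lemma ufn_half {n : ℕ} (hn : 3000 < n) : ufn n ≤ n / 2 := by
  have hn' : (3000:ℝ) < n := by exact_mod_cast hn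
  have hx : 8 ≤ Real.log n := by
    rw [Real.le_log_iff_exp_le (by linarith), show (8:ℝ) = ((8:ℕ):ℝ) * 1 by norm_num, Real.exp_nat_mul]
    have := pow_le_pow_left₀ (Real.exp_pos 1).le Real.exp_one_lt_d9.le 8
    refine this.trans (le_trans (by norm_num) hn'.le)
  have e : (n:ℝ) = Real.exp (Real.log n) := (Real.exp_log (by linarith)).symm
  have e3 : (Real.log n ^ ((1:ℝ)/3))^3 = Real.log n := by
    rw [← Real.rpow_natCast, ← Real.rpow_mul (by linarith)]; norm_num
  unfold ufn
  conv_rhs => rw [e]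
  have y0 : 0 ≤ Real.log n ^ ((1:ℝ)/3) := Real.rpow_nonneg (by linarith) _
  generalize Real.log n ^ ((1:ℝ)/3) = y at *
  have y2 : 2 ≤ y := by by_contra hc; push Not at hc; nlinarith [pow_lt_pow_left₀ hc y0 (n := 3) (by norm_num)]
  have h1 : y + 1 ≤ Real.log n := by rw [← e3]; nlinarith [mul_self_nonneg (y-2)]
  have h2 := Real.exp_le_exp.2 h1
  rw [Real.exp_add] at h2
  have h3 := Real.add_one_le_exp (1:ℝ)
  nlinarith [Real.exp_pos y]

lemma half_compl {A B : Set Ω} (h : Aᶜ ⊆ B) (hB : P.real B ≤ 1/2) : 1/2 ≤ P.real A := by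
  have h1 : P.real univ ≤ P.real A + P.real Aᶜ := by rw [← union_compl_self A]; exact measureReal_union_le _ _
  have h2 : P.real Aᶜ ≤ P.real B := measureReal_mono h (measure_ne_top _ _)
  simp at h1; linarith

lemma part1 (hd : 3 ≤ d) {K : ℝ} (hK : (∀ D, 4 ≤ D → P.real {ω | YC D {y | K ≤ 1 * phiOf ξ y ω}} ≤ 1/2) ∧
    P.real {ω | ∃ y ∈ fbox d 0 3000, K ≤ 1 * phiOf ξ y ω} ≤ 1/2) (n : ℕ) :
    1/2 ≤ P.real {ω | ¬ ConnIn (lvl (phiOf ξ) K ω) (box d (ufn n)) (bdry d n)} := by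
  have hd0 : 0 < d := by omega
  simp only [one_mul] at hK
  by_cases hn : n ≤ 3000
  · refine half_compl (fun ω hω => ?_) hK.2
    simp only [mem_compl_iff, mem_ofPred_eq, not_not] at hω
    obtain ⟨p, hp, q, hq, h⟩ := hω.sc
    exact ⟨q, mem_fbox.2 (((mem_bdry hd0).1 hq).le.trans hn), h.right⟩
  · push Not at hn
    refine half_compl (fun ω hω => ?_) (hK.1 (n/2) (by omega))
    simp only [mem_compl_iff, mem_ofPred_eq, not_not] at hω
    obtain ⟨p, hp, q, hq, h⟩ := hω.sc
    have h1 := (mem_boxAt_floor (Real.exp_pos _).le).1 hp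
    have h2 := (mem_bdry hd0).1 hq
    have h3 : ⌊ufn n⌋₊ ≤ n / 2 := by
      have := Nat.floor_le_floor (ufn_half hn)
      rwa [show (n:ℝ)/2 = (n:ℝ)/((2:ℕ):ℝ) by norm_num, Nat.floor_div_eq_div] at this
    have h4 := dinf_tri 0 p q
    have h1' := h1.trans h3
    exact ⟨p, q, h, by omega, by omega⟩

def ee (s t : Fin 4) : ZMod 2 := if (s = 0 ∧ t = 2) ∨ (s = 2 ∧ t = 0) then 1 else 0
def okn (s t : Fin 4) : Prop := ¬(s = 0 ∧ t = 1) ∧ ¬(s = 1 ∧ t = 0)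
def oks (s t : Fin 4) : Prop := ¬(s = 2 ∧ t = 3) ∧ ¬(s = 3 ∧ t = 2)

instance (s t : Fin 4) : Decidable (okn s t) := by unfold okn; infer_instance
instance (s t : Fin 4) : Decidable (oks s t) := by unfold oks; infer_instance

set_option maxRecDepth 100000 in
lemma plaq : ∀ a b c e : Fin 4, okn a b → okn e c → okn a e → okn b c → oks a b → oks e c → oks a e → oks b c → oks a c → oks b e →
    ee a b + ee e c + (ee a e + ee b c) = 0 := by decide

lemma tele2 (f : ℕ → ZMod 2) (n : ℕ) : ∑ i ∈ Finset.range n, (f i + f (i+1)) = f 0 + f n := by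
  induction n with
  | zero => simp [CharTwo.add_self_eq_zero]
  | succ n ih => rw [Finset.sum_range_succ, ih]; linear_combination CharTwo.add_self_eq_zero (f n)

lemma hex (R : ℕ) (s : ℕ → ℕ → Fin 4) (h0 : ∀ j, s 0 j = 0)
    (hh : ∀ i j, i ≤ R → j ≤ R → okn (s i j) (s (i+1) j) ∧ oks (s i j) (s (i+1) j))
    (hv : ∀ i j, i ≤ R + 1 → j < R → okn (s i j) (s i (j+1)) ∧ oks (s i j) (s i (j+1)))
    (hx : ∀ i j, i ≤ R → j < R → oks (s i j) (s (i+1) (j+1)) ∧ oks (s (i+1) j) (s i (j+1)))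
    (hb : ∀ i, i ≤ R + 1 → s i 0 ≠ 3) (hr : ∀ j, j ≤ R → s (R+1) j ≠ 0) (ht : ∀ i, i ≤ R + 1 → s i R ≠ 2) : False := by
  let Q : ℕ → ZMod 2 := fun j => ∑ i ∈ Finset.range (R+1), ee (s i j) (s (i+1) j)
  have hQ : ∀ j, j < R → Q j = Q (j+1) := by
    intro j hj
    have h1 : ∑ i ∈ Finset.range (R+1), (ee (s i j) (s (i+1) j) + ee (s i (j+1)) (s (i+1) (j+1)) + (ee (s i j) (s i (j+1)) + ee (s (i+1) j) (s (i+1) (j+1)))) = 0 :=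
      Finset.sum_eq_zero fun i hi => by
        have hi : i ≤ R := by simpa [Nat.lt_succ_iff] using hi
        exact plaq _ _ _ _ (hh i j hi hj.le).1 (hh i (j+1) hi hj).1 (hv i j (by omega) hj).1 (hv (i+1) j (by omega) hj).1
          (hh i j hi hj.le).2 (hh i (j+1) hi hj).2 (hv i j (by omega) hj).2 (hv (i+1) j (by omega) hj).2 (hx i j hi hj).1 (hx i j hi hj).2
    rw [Finset.sum_add_distrib, Finset.sum_add_distrib, tele2 (fun i => ee (s i j) (s i (j+1)))] at h1
    have h2 : ee (s 0 j) (s 0 (j+1)) = 0 := by rw [h0, h0]; decide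
    have h3 : ee (s (R+1) j) (s (R+1) (j+1)) = 0 := by simp [ee, hr j hj.le, hr (j+1) hj]
    rw [h2, h3, add_zero, add_zero] at h1
    exact CharTwo.add_eq_zero.1 h1
  have hQ' : ∀ j, j ≤ R → Q 0 = Q j := by
    intro j hj
    induction j with
    | zero => rfl
    | succ j ih => rw [ih (by omega), hQ j (by omega)]
  have e1 : Q R = 0 := Finset.sum_eq_zero fun i hi => by
    have hi := Finset.mem_range.1 hi
    simp [ee, ht i (by omega), ht (i+1) (by omega)]
  have e2 : Q 0 = 1 := by
    have key : ∀ a b : Fin 4, okn a b → a ≠ 3 → b ≠ 3 → ee a b = (if a = 0 then 1 else 0) + (if b = 0 then 1 else 0) := by decide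
    have : Q 0 = ∑ i ∈ Finset.range (R+1), ((if s i 0 = 0 then 1 else 0) + (if s (i+1) 0 = 0 then (1 : ZMod 2) else 0)) :=
      Finset.sum_congr rfl fun i hi => by
        have hi := Finset.mem_range.1 hi
        exact key _ _ (hh i 0 (by omega) (by omega)).1 (hb i (by omega)) (hb (i+1) (by omega))
    rw [this, tele2 (fun i => if s i 0 = 0 then (1 : ZMod 2) else 0), h0]
    simp [hr 0 (by omega)]
  have := hQ' R le_rfl
  rw [e1, e2] at this
  exact absurd this (by decide)

def ept (d R : ℕ) (i j : ℕ) : V d := fun k => if (k:ℕ) = 0 then R + i else if (k:ℕ) = 1 then j else 0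

lemma ept_adj1 (hd : 3 ≤ d) (R i j : ℕ) : adj (ept d R i j) (ept d R (i+1) j) := by
  have : ept d R (i+1) j = ept d R i j + unitV d ⟨0, by omega⟩ := by
    ext k; simp only [ept, unitV, Pi.add_apply, Fin.ext_iff]; split_ifs <;> push_cast <;> omega
  rw [this]; exact adj_unit _ _

lemma ept_adj2 (hd : 3 ≤ d) (R i j : ℕ) : adj (ept d R i j) (ept d R i (j+1)) := by
  have : ept d R i (j+1) = ept d R i j + unitV d ⟨1, by omega⟩ := by
    ext k; simp only [ept, unitV, Pi.add_apply, Fin.ext_iff]; split_ifs <;> push_cast <;> omega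
  rw [this]; exact adj_unit _ _

lemma ept_d (hd : 3 ≤ d) (R i j : ℕ) (hj : j ≤ R) : dinf 0 (ept d R i j) = R + i := by
  apply le_antisymm
  · rw [dinf_le_iff]; intro k; simp only [ept, Pi.zero_apply]; split_ifs <;> omega
  · have := natAbs_le_dinf 0 (ept d R i j) ⟨0, by omega⟩
    simp [ept] at this; omega

lemma cross (hd : 3 ≤ d) (R : ℕ) (S : Set (V d)) (h : ¬ ConnIn S (box d (R:ℝ)) (bdry d ((2*R:ℕ):ℝ))) : YC R Sᶜ := by
  classical
  by_contra hY
  have hd0 : 0 < d := by omega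
  let U : V d → Prop := fun x => ConnIn S (box d (R:ℝ)) {x}
  let D : V d → Prop := fun x => ∃ i, i ≤ R ∧ SC Sᶜ (ept d R i 0) x
  let st : V d → Fin 4 := fun x => if U x then 0 else if x ∈ S then 1 else if D x then 2 else 3
  have s0 : ∀ x, st x = 0 ↔ U x := fun x => by simp only [st]; split_ifs <;> simp_all
  have s1 : ∀ x, st x = 1 ↔ ¬ U x ∧ x ∈ S := fun x => by simp only [st]; split_ifs <;> simp_all
  have sU : ∀ x, U x → x ∈ S := fun x h => h.right
  have s2 : ∀ x, st x = 2 ↔ x ∉ S ∧ D x := fun x => by have := sU x; simp only [st]; split_ifs <;> simp_all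
  have s3 : ∀ x, st x = 3 ↔ x ∉ S ∧ ¬ D x := fun x => by have := sU x; simp only [st]; split_ifs <;> simp_all
  have on : ∀ x y, adj x y → okn (st x) (st y) := fun x y ha => by
    simp only [okn, s0, s1]
    exact ⟨fun ⟨h1, h2, h3⟩ => h2 (h1.trans (ConnIn.adj (sU x h1) h3 ha)), fun ⟨⟨h2, h3⟩, h1⟩ => h2 (h1.trans (ConnIn.adj (sU y h1) h3 (adj_comm ha)))⟩
  have Dc : ∀ x y, dinf x y ≤ 1 → D x → y ∉ S → D y := fun x y hxy ⟨i, hi, h⟩ hy => ⟨i, hi, h.1, h.2.tail ⟨hy, hxy⟩⟩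
  have os : ∀ x y, dinf x y ≤ 1 → oks (st x) (st y) := fun x y ha => by
    simp only [oks, s2, s3]
    exact ⟨fun ⟨⟨_, h1⟩, h2, h3⟩ => h3 (Dc x y ha h1 h2), fun ⟨⟨h2, h3⟩, _, h1⟩ => h3 (Dc y x (dinf_comm x y ▸ ha) h1 h2)⟩
  have n0 : ∀ t : Fin 4, oks 0 t ∧ oks t 0 := by decide
  refine hex R (fun i j => match i with | 0 => 0 | i+1 => st (ept d R i j)) (fun j => rfl) ?_ ?_ ?_ ?_ ?_ ?_
  · rintro (_ | i) j hi hj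
    · refine ⟨?_, (n0 _).1⟩
      have : st (ept d R 0 j) ≠ 1 := fun h => by
        rw [s1] at h
        exact h.1 ((ConnIn.refl h.2).imp (mem_box.2 (ept_d hd R 0 j hj).le) rfl)
      simp [okn, this]
    · exact ⟨on _ _ (ept_adj1 hd _ _ _), os _ _ (adj_dinf (ept_adj1 hd _ _ _))⟩
  · rintro (_ | i) j hi hj
    · exact (show okn 0 0 ∧ oks 0 0 by decide)
    · exact ⟨on _ _ (ept_adj2 hd _ _ _), os _ _ (adj_dinf (ept_adj2 hd _ _ _))⟩
  · rintro (_ | i) j hi hj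
    · exact ⟨(n0 _).1, (n0 _).2⟩
    · refine ⟨os _ _ ?_, os _ _ ?_⟩ <;>
      · rw [dinf_le_iff]; intro k; simp only [ept]; split_ifs <;> push_cast <;> omega
  · rintro (_ | i) hi
    · exact (show (0 : Fin 4) ≠ 3 by decide)
    · intro h
      rw [s3] at h
      exact h.2 ⟨i, by omega, h.1, .refl⟩
  · intro j hj h'
    rw [s0] at h'
    exact h (h'.mono subset_rfl subset_rfl (by
      rw [singleton_subset_iff, mem_bdry hd0, ept_d hd R R j hj]; omega))
  · rintro (_ | i) hi
    · exact (show (0 : Fin 4) ≠ 2 by decide)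
    · intro h'
      rw [s2] at h'
      obtain ⟨i', hi', hs⟩ := h'.2
      refine hY ⟨_, _, hs, by rw [ept_d hd _ _ _ (by omega)]; omega, ?_⟩
      have := natAbs_le_dinf (ept d R i' 0) (ept d R i R) ⟨1, by omega⟩
      simp [ept] at this; omega

lemma part2 (hd : 3 ≤ d) {K : ℝ} (hK : (∀ D, 4 ≤ D → P.real {ω | YC D {y | K ≤ (-1) * phiOf ξ y ω}} ≤ 1/2) ∧
    P.real {ω | ∃ y ∈ fbox d 0 3000, K ≤ (-1) * phiOf ξ y ω} ≤ 1/2) (n : ℕ) :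
    1/2 ≤ P.real {ω | ConnIn (lvl (phiOf ξ) (-K) ω) (box d (n:ℝ)) (bdry d ((2*n:ℕ):ℝ))} := by
  have hS : ∀ ω, (lvl (phiOf ξ) (-K) ω)ᶜ ⊆ {y | K ≤ (-1) * phiOf ξ y ω} := fun ω y hy => by
    simp only [lvl, mem_compl_iff, mem_ofPred_eq, not_le] at hy ⊢; linarith
  by_cases hn : 4 ≤ n
  · refine half_compl (fun ω hω => ?_) (hK.1 n hn)
    obtain ⟨p, q, h, h1, h2⟩ := cross hd n _ hω
    exact ⟨p, q, h.mono (hS ω), h1, h2⟩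
  · refine half_compl (fun ω hω => ?_) hK.2
    obtain ⟨p, q, h, h1, h2⟩ := cross hd n _ hω
    exact ⟨p, mem_fbox.2 (by omega), hS ω h.1⟩
end

section
variable {d : ℕ} {Ω : Type*} [MeasurableSpace Ω] {P : Measure Ω} [IsProbabilityMeasure P] {ξ : ℕ → V d → Ω → ℝ}

lemma lvl_anti (φ : V d → Ω → ℝ) {h h' : ℝ} (hh : h ≤ h') (ω : Ω) : lvl φ h' ω ⊆ lvl φ h ω := fun _ hx => hh.trans hx

lemma ofReal_half {E : Set Ω} (h : 1/2 ≤ P.real E) : ENNReal.ofReal (1/2) ≤ P E := by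
  rw [← ofReal_measureReal]; exact ENNReal.ofReal_le_ofReal h

lemma cSix_pos (hd : 3 ≤ d) (hξ : IsXiFamily d P ξ) {ε : ℝ} (hε : 0 < ε)
    (hε6 : 6 * ε < hStarStar d P (phiOf ξ) - hTilde d P (phiOf ξ)) : 0 < cSix d P ξ ε := by
  obtain ⟨K, hK, HK⟩ := comb hd hξ
  have hd0 : 0 < d := by omega
  have p1 := part1 hd (HK 1 (by norm_num))
  have p2 := part2 hd (HK (-1) (by norm_num))
  let I1 : ℝ → ENNReal := fun h => ⨅ R : ℕ, ENNReal.ofReal (((R : ℝ) + 1) ^ d) *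
        P {ω | ¬ ConnIn (lvl (phiOf ξ) h ω) (box d (ufn ((R : ℝ) + 1))) (bdry d ((R : ℝ) + 1))}
  let I2 : ℝ → ENNReal := fun h => ⨅ R : ℕ, P {ω | ConnIn (lvl (phiOf ξ) h ω) (box d ((R : ℝ) + 1)) (bdry d (2 * ((R : ℝ) + 1)))}
  have m1 : Monotone I1 := fun h h' hh => iInf_mono fun R => by
    refine mul_le_mul_right (measure_mono fun ω hc hc' => ?_) _
    exact hc (ConnIn.mono (lvl_anti _ hh ω) subset_rfl subset_rfl hc')
  have m2 : Antitone I2 := fun h h' hh => iInf_mono fun R => by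
    refine measure_mono fun ω hc => ?_
    exact ConnIn.mono (lvl_anti _ hh ω) subset_rfl subset_rfl hc
  have k1 : I1 K ≠ 0 := by
    have : ENNReal.ofReal (1/2) ≤ I1 K := le_iInf fun R => by
      have := ofReal_half (p1 (R+1))
      push_cast at this
      refine this.trans (le_mul_of_one_le_left zero_le ?_)
      rw [ENNReal.one_le_ofReal]; exact one_le_pow₀ (by linarith [R.cast_nonneg (α := ℝ)])
    intro h0; rw [h0] at this; norm_num at this
  have k2 : I2 (-K) ≠ 0 := by
    have : ENNReal.ofReal (1/2) ≤ I2 (-K) := le_iInf fun R => by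
      have := ofReal_half (p2 (R+1))
      push_cast at this
      exact this
    intro h0; rw [h0] at this; norm_num at this
  have a1 : I1 (hTilde d P (phiOf ξ) + ε) ≠ 0 := by
    intro h0
    have : hTilde d P (phiOf ξ) + ε ≤ hTilde d P (phiOf ξ) :=
      le_csSup ⟨K, fun h (hh : I1 h = 0) => le_of_not_ge fun hc => k1 (le_antisymm (hh ▸ m1 hc) zero_le)⟩ h0
    linarith
  have a2 : I2 (hStarStar d P (phiOf ξ) - ε) ≠ 0 := by
    intro h0
    have : hStarStar d P (phiOf ξ) ≤ hStarStar d P (phiOf ξ) - ε :=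
      csInf_le ⟨-K, fun h (hh : I2 h = 0) => le_of_not_ge fun hc => k2 (le_antisymm (hh ▸ m2 hc) zero_le)⟩ h0
    linarith
  have t1 : I1 (hTilde d P (phiOf ξ) + ε) ≠ ⊤ := ne_top_of_le_ne_top (ENNReal.mul_ne_top ENNReal.ofReal_ne_top (measure_ne_top _ _)) (iInf_le _ 0)
  have t2 : I2 (hStarStar d P (phiOf ξ) - ε) ≠ ⊤ := ne_top_of_le_ne_top (measure_ne_top _ _) (iInf_le _ 0)
  have b1 := ENNReal.toReal_pos a1 t1
  have b2 := ENNReal.toReal_pos a2 t2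
  have hmin := lt_min b1 b2
  have key : min (I1 (hTilde d P (phiOf ξ) + ε)).toReal (I2 (hStarStar d P (phiOf ξ) - ε)).toReal ≤ sInf {v : ℝ | ∃ n : ℕ, 1 ≤ n ∧ ∃ h' : ℝ,
    hTilde d P (phiOf ξ) + ε < h' ∧ h' < hStarStar d P (phiOf ξ) - ε ∧
    (v = (n : ℝ) ^ d *
        (P {ω | ¬ ConnIn (lvl (phiOf ξ) h' ω) (box d (ufn (n : ℝ)))
          (bdry d (n : ℝ))}).toReal ∨
      v = (P {ω | ConnIn (lvl (phiOf ξ) h' ω) (box d (((n + 1) / 2 : ℕ) : ℝ))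
        (bdry d (n : ℝ))}).toReal)} := by
    refine le_csInf ⟨_, 1, le_rfl, (hTilde d P (phiOf ξ) + hStarStar d P (phiOf ξ)) / 2, by linarith, by linarith, Or.inl rfl⟩ ?_
    rintro v ⟨n, hn, h', h1, h2, rfl | rfl⟩
    · refine (min_le_left _ _).trans ?_
      obtain ⟨m, rfl⟩ : ∃ m, n = m + 1 := ⟨n - 1, by omega⟩
      have := ((m1 h1.le).trans (iInf_le _ m))
      have := ENNReal.toReal_mono (ENNReal.mul_ne_top ENNReal.ofReal_ne_top (measure_ne_top _ _)) this
      rw [ENNReal.toReal_mul, ENNReal.toReal_ofReal (by positivity)] at this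
      push_cast; exact this
    · refine (min_le_right _ _).trans ?_
      obtain ⟨k, hk⟩ : ∃ k, (n + 1) / 2 = k + 1 := ⟨(n+1)/2 - 1, by omega⟩
      rw [hk]
      refine ENNReal.toReal_mono (measure_ne_top _ _) (((m2 h2.le).trans (iInf_le _ k)).trans (measure_mono fun ω hc => ?_))
      have hc : ConnIn (lvl (phiOf ξ) h' ω) (box d ((k+1:ℕ):ℝ)) (bdry d ((2*(k+1):ℕ):ℝ)) := by push_cast; exact hc
      exact (hc.exit 0 n (fun y hy => (mem_box.1 hy).trans (by omega)) (fun y hy => by rw [(mem_bdry hd0).1 hy]; omega)).mono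
        inter_subset_left subset_rfl (fun y hy => (mem_bdry hd0).2 hy)
  unfold cSix
  linarith
end

/-- Lemma 5.2 (Decoupling). -/
theorem decoupling (d : ℕ) (hd : 3 ≤ d) {Ω : Type*} [MeasurableSpace Ω]
    (P : Measure Ω) [IsProbabilityMeasure P] (ξ : ℕ → V d → Ω → ℝ)
    (hξ : IsXiFamily d P ξ)
    (hlt : hTilde d P (phiOf ξ) < hStarStar d P (phiOf ξ))
    (ε : ℝ) (hε : 0 < ε) (hε6 : 6 * ε < hStarStar d P (phiOf ξ) - hTilde d P (phiOf ξ)) :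
    ∃ ℓ₀ : ℕ, 1000 ≤ ℓ₀ ∧ ∃ C₃ C₄ c₅ : ℝ, 0 < C₃ ∧ 0 < C₄ ∧ 0 < c₅ ∧ ∃ L₀ : ℕ, 1 ≤ L₀ ∧
      ∀ h : ℝ, hTilde d P (phiOf ξ) + 2 * ε < h → h < hStarStar d P (phiOf ξ) - 2 * ε →
        ∀ r R : ℕ, C₃ ≤ (r : ℝ) → 2 * r ≤ R → ∀ t : ℝ, 1 ≤ t → 1 ≤ R →
          (∀ n : ℕ, 1 ≤ n → n ≤ R →
            cSix d P ξ ε ≤ (n : ℝ) ^ d *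
                (P {ω | ¬ ConnIn {y | h ≤ chiFun d ℓ₀ L₀ t (cfg ξ ω) y}
                  (box d (ufn (n : ℝ))) (bdry d (n : ℝ))}).toReal ∧
              cSix d P ξ ε ≤
                (P {ω | ConnIn {y | h ≤ chiFun d ℓ₀ L₀ t (cfg ξ ω) y}
                  (box d (((n + 1) / 2 : ℕ) : ℝ)) (bdry d (n : ℝ))}).toReal) →
          ∀ f : ℝ → ℝ, Measurable f → (∀ s, 0 ≤ f s) →
            Integrable
              (fun ω => f (psiFun d ℓ₀ L₀ t (shiftCfg d ℓ₀ L₀ t 0 h (cfg ξ ω)) 0)) P →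
            (∑' x : V d, ∫ ω,
                (PivSet d ℓ₀ L₀ t h r R x).indicator
                  (fun c => f (psiFun d ℓ₀ L₀ t c x))
                  (shiftCfg d ℓ₀ L₀ t x h (cfg ξ ω)) ∂P) ≤
              (∫ ω, f (psiFun d ℓ₀ L₀ t (shiftCfg d ℓ₀ L₀ t 0 h (cfg ξ ω)) 0) ∂P) *
                (Real.exp (C₄ * t ^ 18) *
                    ∑' x : V d,
                      (P {ω | shiftCfg d ℓ₀ L₀ t x h (cfg ξ ω) ∈
                        PivSet d ℓ₀ L₀ t h r R x}).toReal +
                  Real.exp (C₄ * t ^ 3 - (r : ℝ) ^ c₅ * Real.exp (-(C₄ * t ^ 3)))) := by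
  have hc := cSix_pos hd hξ hε hε6
  refine ⟨1000, le_rfl, 1, Cf d (cSix d P ξ ε), 1, one_pos, ?_, one_pos, 1, le_rfl, ?_⟩
  · unfold Cf; positivity
  · intro h _ _ r R _ hr t ht hR hyp f hf hf0 hi
    exact main_c (by omega) hξ hc h r R hr t ht hR hyp f hf hf0 hi

end
end GFFperc
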